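/- arXiv:1408.5475 — 3 statements merged into one kernel-verified Lean document; each statement's English description precedes it below -/
import Mathlib

section
/- Let I be the edge ideal of a simple graph G and suppose I has maximal finite index > 1, i.e. 1 < index(I) = projdim(I) < infinity. Then I^k has a linear resolution (index(I^k) = infinity) for all k >= 2. -/
open MvPolynomial

noncomputable section

abbrev SRing (K : Type) [Field K] (n : ℕ) := MvPolynomial (Fin n) K

/-- total degree of an exponent vector -/
def mdeg {n : ℕ} (e : Fin n →₀ ℕ) : ℕ := e.sum fun _ v => v

/-- minimal monomial generators of a monomial ideal, as exponent vectors: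
monomials in `J` none of whose proper divisors lies in `J` -/
def minGen {K : Type} [Field K] {n : ℕ} (J : Ideal (SRing K n)) : Set (Fin n →₀ ℕ) :=
  {e | (monomial e (1:K)) ∈ J ∧
    ∀ e' : Fin n →₀ ℕ, e' ≤ e → e' ≠ e → (monomial e' (1:K)) ∉ J}

/-- adjacency in the graph `G_J^{(u,v)}` : vertices are the minimal generators of `J`
dividing `lcm(u,v)`, with an edge between two of them iff their lcm has degree `d+1` -/
def lcmGraphAdj {K : Type} [Field K] {n : ℕ} (J : Ideal (SRing K n)) (d : ℕ)
    (u v : Fin n →₀ ℕ) (w w' : Fin n →₀ ℕ) : Prop :=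
  w ∈ minGen J ∧ w' ∈ minGen J ∧ w ≤ u ⊔ v ∧ w' ≤ u ⊔ v ∧ mdeg (w ⊔ w') = d + 1

/-- a graded partial free resolution of the ideal `I`, exact at homological positions `< r`:
`F_i` is free with basis in (internal) degrees `dg i`, the maps are graded of degree `0`,
`F_0` surjects onto `I`, and the sequence is exact at `F_i` for `i < r`. -/
structure GradedPartialRes {K : Type} [Field K] {n : ℕ} (I : Ideal (SRing K n)) (r : ℕ∞) where
  s : ℕ → ℕ
  dg : ∀ i, Fin (s i) → ℕ
  aug : (Fin (s 0) →₀ SRing K n) →ₗ[SRing K n] SRing K n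
  diff : ∀ i, (Fin (s (i+1)) →₀ SRing K n) →ₗ[SRing K n] (Fin (s i) →₀ SRing K n)
  aug_hom : ∀ k, (aug (Finsupp.single k 1)).IsHomogeneous (dg 0 k)
  diff_hom : ∀ i k l, (diff i (Finsupp.single k 1)) l = 0 ∨
      ∃ m, ((diff i (Finsupp.single k 1)) l).IsHomogeneous m ∧ dg i l + m = dg (i+1) k
  aug_range : LinearMap.range aug = I
  exact_zero : (0 : ℕ∞) < r → LinearMap.range (diff 0) = LinearMap.ker aug
  exact_succ : ∀ i : ℕ, ((i : ℕ∞) + 1) < r →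
      LinearMap.range (diff (i+1)) = LinearMap.ker (diff i)

/-- the graded Betti number `β_{i,j}(I)`: the minimal number of degree-`j` basis elements
in homological position `i`, over all graded partial resolutions of `I` exact at
positions `0, …, i` (the minimum is attained by the minimal graded free resolution). -/
def gradedBetti {K : Type} [Field K] {n : ℕ} (I : Ideal (SRing K n)) (i j : ℕ) : ℕ∞ :=
  ⨅ R : GradedPartialRes I ((i : ℕ∞)+1),
    ((Finset.univ.filter fun k => R.dg i k = j).card : ℕ∞)

/-- `I` (generated in degree `d`) is `r` steps linear: `β_{i,i+j}(I) = 0` for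
all `i ≤ r` and `j > d` -/
def stepsLinear {K : Type} [Field K] {n : ℕ} (I : Ideal (SRing K n)) (d r : ℕ) : Prop :=
  ∀ i ≤ r, ∀ j, d < j → gradedBetti I i (i+j) = 0

/-- `index(I) = sup{r : I is r steps linear} + 1` -/
def idealIndex {K : Type} [Field K] {n : ℕ} (I : Ideal (SRing K n)) (d : ℕ) : ℕ∞ :=
  sSup {x : ℕ∞ | ∃ r : ℕ, x = (r : ℕ∞) + 1 ∧ stepsLinear I d r}

/-- `I` is linearly related: all first syzygies are linear, i.e. `index(I) > 1` -/
def LinearlyRelated {K : Type} [Field K] {n : ℕ} (I : Ideal (SRing K n)) (d : ℕ) : Prop :=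
  stepsLinear I d 1

/-- projective dimension of `I`: the minimal length of a graded free resolution of `I` -/
def projDim {K : Type} [Field K] {n : ℕ} (I : Ideal (SRing K n)) : ℕ∞ :=
  sInf {x : ℕ∞ | ∃ m : ℕ, x = (m : ℕ∞) ∧
    ∃ R : GradedPartialRes I ⊤, ∀ i : ℕ, m < i → R.s i = 0}

/-- the edge ideal of the graph (possibly with loops) given by a symmetric relation `E`:
generated by the monomials `X i * X j` with `E i j` -/
def edgeIdeal (K : Type) [Field K] {n : ℕ} (E : Fin n → Fin n → Prop) : Ideal (SRing K n) :=
  Ideal.span {p | ∃ i j, E i j ∧ p = X i * X j}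

/-- `E` is gap free: for any two disjoint edges there is an edge meeting both -/
def GapFree {n : ℕ} (E : Fin n → Fin n → Prop) : Prop :=
  ∀ i i' j j', E i i' → E j j' → i ≠ j → i ≠ j' → i' ≠ j → i' ≠ j' →
    ∃ a b, E a b ∧ (a = i ∨ a = i') ∧ (b = j ∨ b = j')

/-! ### Koszul complexes -/

/-- The sign of `v` relative to `T` in the Koszul differential. -/
def ksgn {n : ℕ} (v : Fin n) (T : Finset (Fin n)) : ℤ := (-1) ^ (T.filter (· < v)).card

lemma ksgn_mul_self {n : ℕ} (v : Fin n) (T : Finset (Fin n)) : ksgn v T * ksgn v T = 1 := by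
  unfold ksgn
  rw [← mul_pow]; simp

lemma ksgn_insert {n : ℕ} {v w : Fin n} {T : Finset (Fin n)} (hv : v ∉ T) :
    ksgn w (insert v T) = if v < w then - ksgn w T else ksgn w T := by
  unfold ksgn
  rw [Finset.filter_insert]
  split_ifs with h
  · rw [Finset.card_insert_of_notMem (by simp [hv]), pow_succ]; ring
  · rfl

lemma ksgn_anticomm {n : ℕ} {v w : Fin n} {T : Finset (Fin n)} (hvw : v ≠ w) (hv : v ∉ T)
    (hw : w ∉ T) : ksgn v T * ksgn w (insert v T) = -(ksgn w T * ksgn v (insert w T)) := by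
  rw [ksgn_insert hv, ksgn_insert hw]
  rcases lt_or_gt_of_ne hvw with h | h
  · rw [if_pos h, if_neg h.not_gt]; ring
  · rw [if_neg h.not_gt, if_pos h]; ring

/-- The Koszul differential of the sequence `x` with coefficients in `N`; a chain is a family of
coefficients indexed by subsets of the variables. -/
def koszul {n : ℕ} {R N : Type} [CommRing R] [AddCommGroup N] [Module R N] (x : Fin n → R) :
    (Finset (Fin n) → N) →ₗ[R] (Finset (Fin n) → N) where
  toFun c T := ∑ v ∈ Tᶜ, ksgn v T • x v • c (insert v T)
  map_add' c c' := by
    funext T; simp [smul_add, Finset.sum_add_distrib]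
  map_smul' r c := by
    funext T
    simp only [Pi.smul_apply, RingHom.id_apply, Finset.smul_sum]
    exact Finset.sum_congr rfl fun v _ => by rw [smul_comm r (ksgn v T), smul_comm r (x v)]

lemma koszul_apply {n : ℕ} {R N : Type} [CommRing R] [AddCommGroup N] [Module R N]
    (x : Fin n → R) (c : Finset (Fin n) → N) (T : Finset (Fin n)) :
    koszul x c T = ∑ v ∈ Tᶜ, ksgn v T • x v • c (insert v T) := rfl

lemma koszul_koszul {n : ℕ} {R N : Type} [CommRing R] [AddCommGroup N] [Module R N]
    (x : Fin n → R) (c : Finset (Fin n) → N) : koszul x (koszul x c) = 0 := by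
  funext T
  simp only [koszul_apply, Finset.smul_sum, Pi.zero_apply]
  rw [Finset.sum_sigma']
  refine Finset.sum_involution (fun p _ => ⟨p.2, p.1⟩) ?_ ?_ ?_ ?_
  · rintro ⟨v, w⟩ h
    simp only [Finset.mem_sigma, Finset.mem_compl, Finset.mem_insert, not_or] at h
    obtain ⟨hv, hwv, hw⟩ := h
    have := ksgn_anticomm (Ne.symm hwv) hv hw
    rw [smul_comm (x v), smul_comm (x w) (ksgn v _), smul_smul, smul_smul, smul_smul, smul_smul,
      Finset.insert_comm w v, this, mul_comm (x w), neg_smul, neg_add_cancel]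
  · rintro ⟨v, w⟩ h _ heq
    simp only [Finset.mem_sigma, Finset.mem_compl, Finset.mem_insert, not_or] at h
    simp only [Sigma.mk.injEq, heq_eq_eq] at heq
    exact h.2.1 heq.1
  · rintro ⟨v, w⟩ h
    simp only [Finset.mem_sigma, Finset.mem_compl, Finset.mem_insert, not_or] at h ⊢
    exact ⟨h.2.2, fun e => h.2.1 e.symm, h.1⟩
  · rintro ⟨v, w⟩ h; rfl

/-- Coefficientwise application of a linear map commutes with the Koszul differential. -/
lemma koszul_map {n : ℕ} {R N P : Type} [CommRing R] [AddCommGroup N] [Module R N]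
    [AddCommGroup P] [Module R P] (x : Fin n → R) (f : N →ₗ[R] P) (c : Finset (Fin n) → N) :
    koszul x (fun T => f (c T)) = fun T => f (koszul x c T) := by
  funext T
  simp [koszul_apply, map_sum]

lemma koszul_apply_mem {n : ℕ} {R N : Type} [CommRing R] [AddCommGroup N] [Module R N]
    (x : Fin n → R) (M : Submodule R N) {c : Finset (Fin n) → N} (hc : ∀ T, c T ∈ M)
    (T : Finset (Fin n)) : koszul x c T ∈ M :=
  M.sum_mem fun _ _ => zsmul_mem (M.smul_mem _ (hc _)) _

/-- The contracting homotopy in the direction of the variable `v`. -/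
def khtpy {n : ℕ} {K : Type} [Field K] (v : Fin n) (φ : Finset (Fin n) → K) :
    Finset (Fin n) → K :=
  fun T => if v ∈ T then ksgn v (T.erase v) • φ (T.erase v) else 0

lemma khtpy_zero {n : ℕ} {K : Type} [Field K] (v : Fin n) :
    khtpy v (0 : Finset (Fin n) → K) = 0 := by
  funext T; simp [khtpy]

lemma koszul_khtpy {n : ℕ} {K : Type} [Field K] (v : Fin n) (φ : Finset (Fin n) → K) :
    koszul (1 : Fin n → K) (khtpy v φ) + khtpy v (koszul (1 : Fin n → K) φ) = φ := by
  funext T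
  by_cases hv : v ∈ T
  · obtain ⟨U, hU, rfl⟩ : ∃ U, v ∉ U ∧ insert v U = T :=
      ⟨T.erase v, Finset.notMem_erase _ _, Finset.insert_erase hv⟩
    have e1 : Uᶜ = insert v (insert v U)ᶜ := by
      ext w; simp only [Finset.mem_compl, Finset.mem_insert, not_or]
      by_cases h : w = v <;> simp [h, hU]
    simp only [Pi.add_apply, khtpy, hv, if_true, Finset.erase_insert hU, koszul_apply, e1]
    rw [Finset.sum_insert (by simp)]
    simp only [Pi.one_apply, one_smul, smul_add, smul_smul, ksgn_mul_self, Finset.smul_sum]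
    rw [add_comm, add_assoc, ← Finset.sum_add_distrib, Finset.sum_eq_zero, add_zero]
    intro w hw
    simp only [Finset.mem_compl, Finset.mem_insert, not_or] at hw
    have h1 : v ∈ insert w (insert v U) := by simp
    have h2 : (insert w (insert v U)).erase v = insert w U := by
      rw [Finset.insert_comm, Finset.erase_insert]; simp [hU, Ne.symm hw.1]
    rw [if_pos h1, h2, smul_smul, ← add_smul, ksgn_insert hU, ksgn_insert hw.2]
    rcases lt_or_gt_of_ne hw.1 with h | h
    · simp only [h, h.not_gt, if_true, if_false]
      convert zero_smul ℤ _ using 2; ring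
    · simp only [h, h.not_gt, if_true, if_false]
      convert zero_smul ℤ _ using 2; ring
  · simp only [Pi.add_apply, khtpy, hv, if_false, add_zero, koszul_apply]
    rw [Finset.sum_eq_single v]
    · rw [if_pos (Finset.mem_insert_self _ _), Finset.erase_insert hv, Pi.one_apply, one_smul,
        smul_smul, ksgn_mul_self, one_smul]
    · intro w hw hwv
      simp [hv, hwv.symm]
    · intro h; simp [hv] at h

/-! ### Multigraded Koszul complexes of monomial ideals -/

/-- The squarefree exponent vector with support `T`. -/
def ind {n : ℕ} (T : Finset (Fin n)) : Fin n →₀ ℕ :=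
  Finsupp.equivFunOnFinite.symm fun v => if v ∈ T then 1 else 0

@[simp] lemma ind_apply {n : ℕ} (T : Finset (Fin n)) (v : Fin n) :
    ind T v = if v ∈ T then 1 else 0 := rfl

lemma ind_insert {n : ℕ} {v : Fin n} {T : Finset (Fin n)} (hv : v ∉ T) :
    ind (insert v T) = Finsupp.single v 1 + ind T := by
  ext w
  simp only [ind_apply, Finsupp.add_apply, Finsupp.single_apply, Finset.mem_insert]
  by_cases h : w = v
  · subst h; simp [hv]
  · simp [h, Ne.symm h]

lemma mdeg_eq {n : ℕ} (a : Fin n →₀ ℕ) : mdeg a = ∑ v, a v :=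
  Finsupp.sum_fintype _ _ fun _ => rfl

lemma mdeg_add {n : ℕ} (a b : Fin n →₀ ℕ) : mdeg (a + b) = mdeg a + mdeg b := by
  simp [mdeg_eq, Finset.sum_add_distrib]

@[simp] lemma mdeg_single {n : ℕ} (v : Fin n) : mdeg (Finsupp.single v 1) = 1 := by
  simp [mdeg]

lemma single_one_le {n : ℕ} {a : Fin n →₀ ℕ} {v : Fin n} (h : 0 < a v) :
    Finsupp.single v 1 ≤ a := Finsupp.single_le_iff.2 h

/-- `φ`, a chain in multidegree `b`, has its coefficients in the monomial ideal with set of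
exponents `J`, all of them in degree `e`. -/
def KSupp {n : ℕ} {K : Type} [Field K] (J : Set (Fin n →₀ ℕ)) (b : Fin n →₀ ℕ) (e : ℕ)
    (φ : Finset (Fin n) → K) : Prop :=
  ∀ T, φ T ≠ 0 → ∃ a ∈ J, mdeg a = e ∧ a + ind T = b

/-- The monomial ideal with set of exponents `J` has regularity at most `d`, expressed by the
multigraded strands of its Koszul complex. -/
def KLin (K : Type) [Field K] {n : ℕ} (d : ℕ) (J : Set (Fin n →₀ ℕ)) : Prop :=
  ∀ b e, d < e → ∀ φ : Finset (Fin n) → K, KSupp J b e φ → koszul (1 : Fin n → K) φ = 0 →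
    ∃ ψ, koszul (1 : Fin n → K) ψ = φ ∧ KSupp J b (e - 1) ψ

section KSupp

variable {n : ℕ} {K : Type} [Field K] {J J' : Set (Fin n →₀ ℕ)} {b : Fin n →₀ ℕ} {e : ℕ}
  {φ ψ : Finset (Fin n) → K}

lemma KSupp.mono (h : KSupp J b e φ) (hJ : J ⊆ J') : KSupp J' b e φ := fun T hT =>
  let ⟨a, ha, h'⟩ := h T hT; ⟨a, hJ ha, h'⟩

lemma KSupp.add (h : KSupp J b e φ) (h' : KSupp J b e ψ) : KSupp J b e (φ + ψ) := fun T hT => by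
  by_cases h0 : φ T = 0
  · exact h' T fun h1 => hT (by simp [h0, h1])
  · exact h T h0

lemma KSupp.sub (h : KSupp J b e φ) (h' : KSupp J b e ψ) : KSupp J b e (φ - ψ) := fun T hT => by
  by_cases h0 : φ T = 0
  · exact h' T fun h1 => hT (by simp [h0, h1])
  · exact h T h0

lemma KSupp.koszul_succ (hJ : IsUpperSet J) (h : KSupp J b e φ) :
    KSupp J b (e + 1) (koszul (1 : Fin n → K) φ) := fun T hT => by
  rw [koszul_apply] at hT
  obtain ⟨v, hv, hne⟩ := Finset.exists_ne_zero_of_sum_ne_zero hT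
  have hv' : v ∉ T := by simpa using hv
  obtain ⟨a, ha, hd, hb⟩ := h (insert v T) fun h0 => hne (by simp [h0])
  refine ⟨a + Finsupp.single v 1, hJ (by simp) ha, by simp [mdeg_add, hd], ?_⟩
  rw [← hb, ind_insert hv', add_assoc]

lemma KSupp.exact (h : KSupp J b e φ) (hφ : koszul (1 : Fin n → K) φ = 0) (v : Fin n)
    (hv : 0 < b v)
    (H : ∀ a ∈ J, mdeg a = e → (∃ T, a + ind T = b) → 0 < a v → a - Finsupp.single v 1 ∈ J) :
    ∃ ψ, koszul (1 : Fin n → K) ψ = φ ∧ KSupp J b (e - 1) ψ := by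
  refine ⟨khtpy v φ, ?_, ?_⟩
  · have := koszul_khtpy v φ
    rwa [hφ, khtpy_zero, add_zero] at this
  · intro T hT
    by_cases hvT : v ∈ T
    · obtain ⟨U, hU, rfl⟩ : ∃ U, v ∉ U ∧ insert v U = T :=
        ⟨T.erase v, Finset.notMem_erase _ _, Finset.insert_erase hvT⟩
      simp only [khtpy, hvT, if_true, Finset.erase_insert hU] at hT
      obtain ⟨a, ha, hd, hb⟩ := h U fun h0 => hT (by simp [h0])
      have hav : 0 < a v := by
        have := DFunLike.congr_fun hb v
        simp [hU] at this; omega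
      have hs := tsub_add_cancel_of_le (single_one_le hav)
      refine ⟨_, H a ha hd ⟨U, hb⟩ hav, ?_, ?_⟩
      · have := congrArg mdeg hs
        rw [mdeg_add, mdeg_single] at this; omega
      · rw [ind_insert hU, ← add_assoc, hs, hb]
    · simp [khtpy, hvT] at hT

/-- A monomial ideal that, up to free variables, contains all monomials of degree `d` has
regularity at most `d`. -/
lemma KLin.of_free {d : ℕ} (F : Set (Fin n))
    (hF : ∀ a ∈ J, ∀ v ∈ F, 0 < a v → a - Finsupp.single v 1 ∈ J)
    (hd : ∀ a : Fin n →₀ ℕ, (∀ v ∈ F, a v = 0) → d ≤ mdeg a → a ∈ J) : KLin K d J := by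
  intro b e he φ hφ h0
  by_cases hb : ∃ v ∈ F, 0 < b v
  · obtain ⟨v, hv, hbv⟩ := hb
    exact hφ.exact h0 v hbv fun a ha _ _ hav => hF a ha v hv hav
  · push Not at hb
    by_cases hz : φ = 0
    · exact ⟨0, by simp [hz], fun T hT => by simp at hT⟩
    · obtain ⟨T, hT⟩ := Function.ne_iff.1 hz
      obtain ⟨a, ha, hae, hab⟩ := hφ T hT
      obtain ⟨v, hv⟩ : ∃ v, 0 < a v := by
        by_contra! h
        rw [mdeg_eq, Finset.sum_eq_zero fun w _ => Nat.le_zero.1 (h w)] at hae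
        omega
      refine hφ.exact h0 v ?_ ?_
      · rw [← hab, Finsupp.add_apply]; omega
      · rintro a' ha' hae' ⟨T', hT'⟩ hav
        have hs := tsub_add_cancel_of_le (single_one_le hav)
        refine hd _ (fun w hw => ?_) ?_
        · have h1 := hb w hw
          rw [← hT', Finsupp.add_apply] at h1
          rw [Finsupp.tsub_apply]; omega
        · have := congrArg mdeg hs
          rw [mdeg_add, mdeg_single] at this; omega

lemma KLin.univ : KLin K 0 (Set.univ : Set (Fin n →₀ ℕ)) :=
  KLin.of_free ∅ (by simp) (by simp)

lemma KLin.union {d : ℕ} (hJ : IsUpperSet J) (hJ' : IsUpperSet J') (h : KLin K d J)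
    (h' : KLin K d J') (hi : KLin K (d + 1) (J ∩ J')) : KLin K d (J ∪ J') := by
  classical
  intro b e he φ hφ h0
  let α : Finset (Fin n) → K := fun T => if b - ind T ∈ J then φ T else 0
  have hα : KSupp J b e α := fun T hT => by
    by_cases h1 : b - ind T ∈ J
    · simp only [α, h1, if_true] at hT
      obtain ⟨a, ha, hd, hb⟩ := hφ T hT
      refine ⟨a, ?_, hd, hb⟩
      rwa [← hb, add_tsub_cancel_right] at h1
    · simp [α, h1] at hT
  have hβ : KSupp J' b e (φ - α) := fun T hT => by
    by_cases h1 : b - ind T ∈ J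
    · simp [α, h1] at hT
    · simp only [α, h1, if_false, Pi.sub_apply, sub_zero] at hT
      obtain ⟨a, ha, hd, hb⟩ := hφ T hT
      refine ⟨a, ha.resolve_left ?_, hd, hb⟩
      rwa [← hb, add_tsub_cancel_right] at h1
  have hab : koszul (1 : Fin n → K) (φ - α) = - koszul (1 : Fin n → K) α := by
    rw [map_sub, h0, zero_sub]
  have hi1 : KSupp (J ∩ J') b (e + 1) (koszul (1 : Fin n → K) α) := fun T hT => by
    obtain ⟨a, ha, hd, hb⟩ := hα.koszul_succ hJ T hT
    obtain ⟨a', ha', hd', hb'⟩ := hβ.koszul_succ hJ' T (by rw [hab]; simpa using hT)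
    have : a = a' := add_right_cancel (hb.trans hb'.symm)
    subst this
    exact ⟨a, ⟨ha, ha'⟩, hd, hb⟩
  obtain ⟨γ, hγ, hγs⟩ := hi b (e + 1) (by omega) _ hi1 (koszul_koszul _ _)
  rw [Nat.add_sub_cancel] at hγs
  obtain ⟨ψ₁, h1, hs1⟩ := h b e he (α - γ) (hα.sub (hγs.mono Set.inter_subset_left))
    (by rw [map_sub, hγ, sub_self])
  obtain ⟨ψ₂, h2, hs2⟩ := h' b e he ((φ - α) + γ) (hβ.add (hγs.mono Set.inter_subset_right))
    (by rw [map_add, hγ, hab, neg_add_cancel])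
  refine ⟨ψ₁ + ψ₂, ?_, (hs1.mono Set.subset_union_left).add (hs2.mono Set.subset_union_right)⟩
  rw [map_add, h1, h2]; abel

lemma KLin.shift {d : ℕ} (h : KLin K d J) (u : Fin n) :
    KLin K (d + 1) {a | 0 < a u ∧ a - Finsupp.single u 1 ∈ J} := by
  intro b e he φ hφ h0
  by_cases hb : 0 < b u
  · have hs := tsub_add_cancel_of_le (single_one_le hb)
    obtain ⟨ψ, hψ, hψs⟩ := h (b - Finsupp.single u 1) (e - 1) (by omega) φ (fun T hT => by
      obtain ⟨a, ⟨hau, haJ⟩, hd, hab⟩ := hφ T hT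
      have hs' := tsub_add_cancel_of_le (single_one_le hau)
      refine ⟨_, haJ, ?_, ?_⟩
      · have := congrArg mdeg hs'
        rw [mdeg_add, mdeg_single] at this; omega
      · refine add_right_cancel (b := Finsupp.single u 1) ?_
        rw [hs, add_right_comm, hs', hab]) h0
    refine ⟨ψ, hψ, fun T hT => ?_⟩
    obtain ⟨a, ha, hd, hab⟩ := hψs T hT
    refine ⟨a + Finsupp.single u 1, ⟨by simp, by simpa using ha⟩, ?_, ?_⟩
    · rw [mdeg_add, mdeg_single]; omega
    · rw [add_right_comm, hab, hs]
  · have : φ = 0 := by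
      funext T
      by_contra hT
      obtain ⟨a, ⟨hau, -⟩, -, hab⟩ := hφ T hT
      rw [← hab, Finsupp.add_apply] at hb; omega
    exact ⟨0, by simp [this], fun T hT => by simp at hT⟩

end KSupp

/-! ### Truncated symbolic powers of the edge ideal of an anticycle -/

section Anticycle

lemma ne_add_one {l : ℕ} (hl : 2 ≤ l) (j : ZMod l) : j ≠ j + 1 := fun h => by
  have : Fact (1 < l) := ⟨hl⟩
  simp at h

lemma mdeg_eq_sum_cycle {n l : ℕ} {f : ZMod l → Fin n} (hf : Function.Injective f)
    {s : Finset (ZMod l)} {a : Fin n →₀ ℕ}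
    (ha : ∀ v, (∀ i ∈ s, f i ≠ v) → a v = 0) : mdeg a = ∑ i ∈ s, a (f i) := by
  classical
  rw [mdeg_eq, ← Finset.sum_image (f := fun v => a v) (fun x _ y _ h => hf h)]
  symm
  refine Finset.sum_subset (Finset.subset_univ _) fun v _ hv => ha v fun i hi h => hv ?_
  exact Finset.mem_image.2 ⟨i, hi, h⟩

variable {n l : ℕ} [NeZero l] {K : Type} [Field K] (f : ZMod l → Fin n) (k : ℕ)

/-- The exponents of the monomials in the `k`-th power of the prime ideal of the variables on the
cycle `f` other than the `j`-th and the `j + 1`-st. -/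
def arcPow (j : ZMod l) : Set (Fin n →₀ ℕ) := {a | k ≤ ∑ i ∈ {j, j + 1}ᶜ, a (f i)}

/-- The exponents of the monomials in the truncation in degree `2 * k` of the intersection of the
powers `arcPow f k j`. -/
def anticyclePow : Set (Fin n →₀ ℕ) := {a | 2 * k ≤ ∑ i, a (f i) ∧ ∀ j, a ∈ arcPow f k j}

lemma isUpperSet_arcPow (j : ZMod l) : IsUpperSet (arcPow f k j) := fun _ _ hab ha =>
  le_trans ha (Finset.sum_le_sum fun i _ => hab (f i))

variable {f k}

lemma sum_arc (hl : 2 ≤ l) (a : Fin n →₀ ℕ) (j : ZMod l) :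
    a (f j) + a (f (j + 1)) + ∑ i ∈ {j, j + 1}ᶜ, a (f i) = ∑ i, a (f i) := by
  rw [← Finset.sum_add_sum_compl {j, j + 1}, Finset.sum_pair (ne_add_one hl j)]

lemma sub_single_mem_arcPow {a : Fin n →₀ ℕ} {j : ZMod l} {v : Fin n}
    (hv : ∀ i ∈ ({j, j + 1}ᶜ : Finset (ZMod l)), f i ≠ v) (ha : a ∈ arcPow f k j) :
    a - Finsupp.single v 1 ∈ arcPow f k j := by
  refine le_trans (show k ≤ _ from ha) (Finset.sum_le_sum fun i hi => ?_)
  rw [Finsupp.tsub_apply, Finsupp.single_eq_of_ne (hv i hi)]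
  simp

lemma KLin.arcPow (hf : Function.Injective f) (j : ZMod l) : KLin K k (arcPow f k j) := by
  refine KLin.of_free {v | ∀ i ∈ ({j, j + 1}ᶜ : Finset (ZMod l)), f i ≠ v}
    (fun a ha v hv _ => sub_single_mem_arcPow hv ha) fun a ha hd => ?_
  rwa [mdeg_eq_sum_cycle hf (s := {j, j + 1}ᶜ) ha] at hd

lemma KLin.arcPow_union (hf : Function.Injective f) (hl : 3 ≤ l) (hk : 1 ≤ k) (j : ZMod l) :
    KLin K (2 * k - 1) (_root_.arcPow f k (j - 1) ∪ _root_.arcPow f k j) := by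
  refine KLin.of_free {v | ∀ i ∈ ({j}ᶜ : Finset (ZMod l)), f i ≠ v} ?_ fun a ha hd => ?_
  · rintro a (ha | ha) v hv -
    · exact .inl (sub_single_mem_arcPow (fun i hi => hv i (by simp at hi ⊢; tauto)) ha)
    · exact .inr (sub_single_mem_arcPow (fun i hi => hv i (by simp at hi ⊢; tauto)) ha)
  · by_contra hcon
    simp only [Set.mem_union, _root_.arcPow, Set.mem_ofPred_eq, not_or, not_le] at hcon
    have h0 : a (f j) = 0 := ha _ fun i hi h => by simp [hf h] at hi
    rw [mdeg_eq_sum_cycle hf (s := {j}ᶜ) ha] at hd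
    have h1 := sum_arc (f := f) (by omega) a (j - 1)
    have h2 := sum_arc (f := f) (by omega) a j
    have h3 : j - 1 ≠ j + 1 := fun h => by
      have h4 : ((2 : ℕ) : ZMod l) = 0 := by push_cast; linear_combination -h
      rw [ZMod.natCast_eq_zero_iff] at h4
      exact absurd (Nat.le_of_dvd (by norm_num) h4) (by omega)
    have h5 : a (f (j - 1)) + a (f (j + 1)) ≤ ∑ i, a (f i) := by
      rw [← Finset.sum_pair (f := fun i => a (f i)) h3]
      exact Finset.sum_le_sum_of_subset (Finset.subset_univ _)
    have h6 : ∑ i ∈ {j}ᶜ, a (f i) ≤ ∑ i, a (f i) :=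
      Finset.sum_le_sum_of_subset (Finset.subset_univ _)
    rw [sub_add_cancel] at h1 hcon
    omega

lemma adjacent_of_notMem_arcPow (hl : 2 ≤ l) {a : Fin n →₀ ℕ} (ha : 2 * k - 1 ≤ ∑ i, a (f i))
    {j j' : ZMod l} (hj : a ∉ arcPow f k j) (hj' : a ∉ arcPow f k j') :
    j = j' ∨ j = j' - 1 ∨ j' = j - 1 := by
  by_contra! hcon
  obtain ⟨c1, c2, c3⟩ := hcon
  simp only [arcPow, Set.mem_ofPred_eq, not_le] at hj hj'
  have h1 : a (f j') + a (f (j' + 1)) ≤ ∑ i ∈ {j, j + 1}ᶜ, a (f i) := by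
    rw [← Finset.sum_pair (f := fun i => a (f i)) (ne_add_one hl j')]
    refine Finset.sum_le_sum_of_subset fun i hi => ?_
    simp only [Finset.mem_insert, Finset.mem_singleton, Finset.mem_compl] at hi ⊢
    rintro (h | h) <;> rcases hi with h' | h'
    · exact c1 (h.symm.trans h')
    · exact c3 (by rw [← h, h']; ring)
    · exact c2 (by rw [← h', h]; ring)
    · exact c1 (add_right_cancel (h.symm.trans h'))
  have h2 := sum_arc (f := f) hl a j'
  omega

lemma exists_mem_arcPow (hl : 5 ≤ l) (hk : 2 ≤ k) {a : Fin n →₀ ℕ}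
    (ha : 2 * k - 2 ≤ ∑ i, a (f i)) : ∃ j, a ∈ arcPow f k j := by
  by_contra! hcon
  simp only [arcPow, Set.mem_ofPred_eq, not_le] at hcon
  obtain ⟨m, rfl⟩ : ∃ m, k = m + 2 := ⟨k - 2, by omega⟩
  have h1 : ∑ j : ZMod l, (∑ i, a (f i)) ≤
      ∑ j : ZMod l, (a (f j) + a (f (j + 1)) + (m + 1)) := by
    refine Finset.sum_le_sum fun j _ => ?_
    rw [← sum_arc (f := f) (by omega) a j]
    have := hcon j
    omega
  have h2 : ∑ j : ZMod l, a (f (j + 1)) = ∑ j, a (f j) :=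
    Equiv.sum_comp (Equiv.addRight (1 : ZMod l)) (fun j => a (f j))
  simp only [Finset.sum_add_distrib, Finset.sum_const, Finset.card_univ, ZMod.card, smul_eq_mul,
    h2] at h1
  generalize ∑ i, a (f i) = w at *
  obtain ⟨c, rfl⟩ : ∃ c, l = c + 5 := ⟨l - 5, by omega⟩
  have hw : 2 * m + 2 ≤ w := by omega
  nlinarith [Nat.mul_le_mul_left c hw]

/-- Cyclic telescoping: away from a cut, a family on a cycle is a family of differences. -/
lemma exists_cyclic_primitive (j₀ : ZMod l) {N : Type} [AddCommGroup N] (q : ZMod l → N) :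
    ∃ r : ZMod l → N, (∀ j, j ≠ j₀ → r j - r (j - 1) = q j) ∧
      ∀ (A : AddSubgroup N), (∀ j, q j ∈ A) → ∀ j, r j ∈ A := by
  refine ⟨fun j => ∑ m ∈ Finset.range (j - j₀).val, q (j₀ + 1 + m), fun j hj => ?_,
    fun A hA j => A.sum_mem fun m _ => hA _⟩
  have hv : (j - j₀).val = (j - 1 - j₀).val + 1 := by
    have h0 : (j - j₀).val ≠ 0 := by
      rw [Ne, ZMod.val_eq_zero, sub_eq_zero]; exact hj
    have hlt := ZMod.val_lt (j - j₀)
    have h1 : j - 1 - j₀ = (((j - j₀).val - 1 : ℕ) : ZMod l) := by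
      rw [Nat.cast_sub (by omega), ZMod.natCast_zmod_val]; push_cast; ring
    rw [h1, ZMod.val_natCast_of_lt (by omega)]; omega
  simp only [hv, Finset.sum_range_succ, add_sub_cancel_left]
  congr 1
  rw [ZMod.natCast_zmod_val]; ring

theorem KLin.anticyclePow (hf : Function.Injective f) (hl : 5 ≤ l) (hk : 2 ≤ k) :
    KLin K (2 * k) (anticyclePow f k) := by
  classical
  intro b e he φ hφ h0
  by_cases hb : ∃ v, (∀ i, f i ≠ v) ∧ 0 < b v
  · obtain ⟨v, hv, hbv⟩ := hb
    refine hφ.exact h0 v hbv fun a ha _ _ hav => ⟨?_, fun j => ?_⟩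
    · refine le_trans ha.1 (Finset.sum_le_sum fun i hi => ?_)
      rw [Finsupp.tsub_apply, Finsupp.single_eq_of_ne (hv i)]
      simp
    · exact sub_single_mem_arcPow (fun i _ => hv i) (ha.2 j)
  push Not at hb
  have hw : ∀ a T, a + ind T = b → mdeg a = ∑ i, a (f i) := fun a T hab =>
    mdeg_eq_sum_cycle hf fun v hv => by
      have := hb v fun i => hv i (Finset.mem_univ i)
      rw [← hab, Finsupp.add_apply] at this
      omega
  have hM : ∀ j, _root_.anticyclePow f k ⊆ _root_.arcPow f k j := fun j a ha => ha.2 j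
  obtain ⟨z, hz, hzs⟩ := KLin.univ b e (by omega) φ (hφ.mono (Set.subset_univ _)) h0
  have hu : ∀ j, ∃ u, koszul (1 : Fin n → K) u = φ ∧ KSupp (_root_.arcPow f k j) b (e - 1) u :=
    fun j => KLin.arcPow hf j b e (by omega) φ (hφ.mono (hM j)) h0
  choose u hu hus using hu
  have hy : ∀ j, ∃ y, koszul (1 : Fin n → K) y = z - u j ∧ KSupp Set.univ b (e - 1 - 1) y :=
    fun j => KLin.univ b (e - 1) (by omega) _ (hzs.sub ((hus j).mono (Set.subset_univ _)))
      (by rw [map_sub, hz, hu, sub_self])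
  choose y hy hys using hy
  have hwj : ∀ j, ∃ w, koszul (1 : Fin n → K) w = u (j - 1) - u j ∧
      KSupp (_root_.arcPow f k (j - 1) ∪ _root_.arcPow f k j) b (e - 1 - 1) w :=
    fun j => KLin.arcPow_union hf (by omega) (by omega) j b (e - 1) (by omega) _
      (((hus (j - 1)).mono Set.subset_union_left).sub ((hus j).mono Set.subset_union_right))
      (by rw [map_sub, hu, hu, sub_self])
  choose w hwd hws using hwj
  have hq : ∀ j, ∃ q, koszul (1 : Fin n → K) q = y j - y (j - 1) - w j ∧
      KSupp Set.univ b (e - 1 - 1 - 1) q :=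
    fun j => KLin.univ b (e - 1 - 1) (by omega) _
      (((hys j).sub (hys (j - 1))).sub ((hws j).mono (Set.subset_univ _)))
      (by rw [map_sub, map_sub, hy, hy, hwd]; abel)
  choose q hq hqs using hq
  have hr : ∀ T, ∃ r : ZMod l → K,
      (∀ j, (∃ a, a ∉ _root_.arcPow f k (j - 1) ∪ _root_.arcPow f k j ∧ a + ind T = b) →
        r j - r (j - 1) = q j T) ∧
      ∀ j, r j ≠ 0 → ∃ a, mdeg a = e - 1 - 1 - 1 ∧ a + ind T = b := by
    intro T
    by_cases hT : ∃ a, mdeg a = e - 1 - 1 - 1 ∧ a + ind T = b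
    · obtain ⟨a, had, hab⟩ := hT
      obtain ⟨j₀, hj₀⟩ := exists_mem_arcPow (f := f) hl hk (a := a) (by rw [← hw a T hab]; omega)
      obtain ⟨r, hr, -⟩ := exists_cyclic_primitive j₀ (fun j => q j T)
      refine ⟨r, fun j ⟨a', ha', hab'⟩ => hr j ?_, fun _ _ => ⟨a, had, hab⟩⟩
      rintro rfl
      obtain rfl : a = a' := add_right_cancel (hab.trans hab'.symm)
      exact ha' (.inr hj₀)
    · refine ⟨0, fun j _ => ?_, fun j hj => by simp at hj⟩
      by_contra hne
      obtain ⟨a, -, had, hab⟩ := hqs j T fun h => hne (by simp [h])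
      exact hT ⟨a, had, hab⟩
  choose r hr hrs using hr
  let y' : ZMod l → Finset (Fin n) → K := fun j => y j - koszul (1 : Fin n → K) fun T => r T j
  have hrs' : ∀ j, KSupp Set.univ b (e - 1 - 1 - 1) fun T => r T j := fun j T hT => by
    obtain ⟨a, had, hab⟩ := hrs T j hT
    exact ⟨a, trivial, had, hab⟩
  have e1 : e - 1 - 1 - 1 + 1 = e - 1 - 1 := by omega
  have hys' : ∀ j, KSupp Set.univ b (e - 1 - 1) (y' j) := fun j =>
    (hys j).sub (e1 ▸ (hrs' j).koszul_succ isUpperSet_univ)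
  have hdiff : ∀ j, KSupp (_root_.arcPow f k (j - 1) ∪ _root_.arcPow f k j) b (e - 1 - 1)
      (y' j - y' (j - 1)) := by
    intro j
    have h1 : KSupp (_root_.arcPow f k (j - 1) ∪ _root_.arcPow f k j) b (e - 1 - 1 - 1)
        (q j - (fun T => r T j) + fun T => r T (j - 1)) := fun T hT => by
      have h2 : KSupp Set.univ b (e - 1 - 1 - 1) (q j - (fun T => r T j) + fun T => r T (j - 1)) :=
        ((hqs j).sub (hrs' j)).add (hrs' (j - 1))
      obtain ⟨a, -, had, hab⟩ := h2 T hT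
      refine ⟨a, ?_, had, hab⟩
      by_contra hcon
      have := hr T j ⟨a, hcon, hab⟩
      exact hT (by simp [← this])
    have h3 := e1 ▸ h1.koszul_succ
      ((isUpperSet_arcPow f k (j - 1)).union (isUpperSet_arcPow f k j))
    have h4 : y' j - y' (j - 1) =
        w j + koszul (1 : Fin n → K) (q j - (fun T => r T j) + fun T => r T (j - 1)) := by
      rw [map_add, map_sub, hq]
      simp only [y']; abel
    rw [h4]
    exact (hws j).add h3
  let Y : Finset (Fin n) → K := fun T =>
    if h : ∃ j, b - ind T ∉ _root_.arcPow f k j then y' h.choose T else 0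
  have hY : ∀ j, KSupp (_root_.arcPow f k j) b (e - 1 - 1) (y' j - Y) := by
    intro j T hT
    have key : ∃ i, y' i T ≠ 0 := by
      by_contra! hcon
      apply hT
      simp only [Pi.sub_apply, hcon, Y]
      split_ifs <;> simp
    obtain ⟨i, hi⟩ := key
    obtain ⟨a, -, had, hab⟩ := hys' i T hi
    refine ⟨a, ?_, had, hab⟩
    by_contra hj
    have hba : b - ind T = a := by rw [← hab, add_tsub_cancel_right]
    have hex : ∃ j, b - ind T ∉ _root_.arcPow f k j := ⟨j, by rwa [hba]⟩
    have hc := hex.choose_spec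
    simp only [Pi.sub_apply, Y, dif_pos hex] at hT
    generalize hex.choose = j' at hc hT
    rw [hba] at hc
    have hzero : ∀ j, a ∉ _root_.arcPow f k (j - 1) → a ∉ _root_.arcPow f k j →
        y' j T - y' (j - 1) T = 0 := fun j h1 h2 => by
      by_contra hne
      obtain ⟨a', ha', -, hab'⟩ := hdiff j T hne
      obtain rfl : a' = a := add_right_cancel (hab'.trans hab.symm)
      exact ha'.elim h1 h2
    rcases adjacent_of_notMem_arcPow (f := f) (by omega) (by rw [← hw a T hab]; omega) hj hc with
      h | h | h
    · exact hT (by rw [h, sub_self])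
    · subst h
      exact hT (by rw [← neg_sub, hzero j' hj hc, neg_zero])
    · subst h
      exact hT (hzero j hc hj)
  have e2 : e - 1 - 1 + 1 = e - 1 := by omega
  have hx : ∀ j, KSupp (_root_.arcPow f k j) b (e - 1) (z - koszul (1 : Fin n → K) Y) := by
    intro j
    have h1 : z - koszul (1 : Fin n → K) Y = u j + koszul (1 : Fin n → K) (y' j - Y) := by
      simp only [y', map_sub, koszul_koszul, hy]; abel
    rw [h1]
    exact (hus j).add (e2 ▸ (hY j).koszul_succ (isUpperSet_arcPow f k j))
  refine ⟨z - koszul (1 : Fin n → K) Y, by rw [map_sub, koszul_koszul, hz, sub_zero], ?_⟩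
  intro T hT
  obtain ⟨a, -, had, hab⟩ := hx 0 T hT
  refine ⟨a, ⟨by rw [← hw a T hab]; omega, fun j => ?_⟩, had, hab⟩
  obtain ⟨a', ha', -, hab'⟩ := hx j T hT
  obtain rfl : a' = a := add_right_cancel (hab'.trans hab.symm)
  exact ha'

end Anticycle


/-! ### Powers of the edge ideal of an anticycle -/

/-- The monomials on a cycle with `k + k` vertices counted with multiplicity, at most `k` of them
on any arc of length one, can be paired off along non-edges of the cycle. -/
lemma exists_cyclic_pairing {m k : ℕ} (A : Fin (m + 1) → ℕ) (hA : ∑ i, A i = k + k)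
    (h : ∀ j, A j + A (j + 1) ≤ k) (h' : ∀ j, A j ≤ k) :
    ∃ x y : Fin k → Fin (m + 1), (∀ t, x t ≠ y t ∧ x t ≠ y t + 1 ∧ y t ≠ x t + 1) ∧
      ∀ {N : Type} [AddCommMonoid N] (g : Fin (m + 1) → N),
        ∑ i, A i • g i = ∑ t, (g (x t) + g (y t)) := by
  let B : ℕ → ℕ := fun j => if hj : j < m + 1 then A ⟨j, hj⟩ else 0
  have hB : ∀ j : Fin (m + 1), B j = A j := fun j => by simp [B, Nat.lt_succ_iff.1 j.2]
  let P : ℕ → ℕ := fun i => ∑ j ∈ Finset.range i, B j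
  have hP : ∀ i, P (i + 1) = P i + B i := fun i => Finset.sum_range_succ _ _
  have hmono : Monotone P := monotone_nat_of_le_succ fun i => by rw [hP]; omega
  have hPm : P (m + 1) = k + k := by
    rw [← hA]
    simp only [P, ← Fin.sum_univ_eq_sum_range, hB]
  let e : ((i : Fin (m + 1)) × Fin (A i)) ≃ Fin (k + k) := finSigmaFinEquiv.trans (finCongr hA)
  let p : Fin (k + k) → Fin (m + 1) := fun t => (e.symm t).1
  have he : ∀ s, (e s : ℕ) = P s.1 + s.2 := fun s => by
    simp only [e, Equiv.trans_apply, finCongr_apply, Fin.val_cast, finSigmaFinEquiv_apply, P,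
      ← Fin.sum_univ_eq_sum_range]
    congr 1
    exact Finset.sum_congr rfl fun i _ => (hB _).symm
  have hp : ∀ t, P (p t) ≤ t ∧ (t : ℕ) < P (p t + 1) := fun t => by
    have h1 := he (e.symm t)
    rw [Equiv.apply_symm_apply] at h1
    have h2 := (e.symm t).2.2
    rw [hP, hB]
    change P (e.symm t).1 ≤ t ∧ (t : ℕ) < P (e.symm t).1 + A (e.symm t).1
    omega
  refine ⟨fun t => p (t.castAdd k), fun t => p (t.natAdd k), fun t => ?_, fun g => ?_⟩
  · change p _ ≠ p _ ∧ p _ ≠ p _ + 1 ∧ p _ ≠ p _ + 1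
    obtain ⟨h1, h2⟩ := hp (t.castAdd k)
    obtain ⟨h3, h4⟩ := hp (t.natAdd k)
    generalize p (t.castAdd k) = x at *
    generalize p (t.natAdd k) = y at *
    simp only [Fin.val_castAdd, Fin.val_natAdd] at h1 h2 h3 h4
    have h5 := h x
    have h6 := h y
    have h7 := h' x
    have h8 := hP x
    have h9 := hP y
    refine ⟨fun hxy => ?_, fun hxy => ?_, fun hxy => ?_⟩
    · subst hxy
      rw [hB] at h8
      omega
    · rw [← hxy, ← hB, ← hB] at h6
      have hv := congrArg Fin.val hxy
      rw [Fin.val_add_one] at hv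
      split_ifs at hv with hy
      · have hy' : (y : ℕ) = m := by rw [hy, Fin.val_last]
        have h0 : P 0 = 0 := rfl
        rw [hy'] at h3 h6
        rw [hv] at h2 h6 h8
        rw [hy'] at h9
        omega
      · have := hmono hv.ge
        omega
    · rw [← hxy, ← hB, ← hB] at h5
      rw [← hB] at h7
      have hv := congrArg Fin.val hxy
      rw [Fin.val_add_one] at hv
      split_ifs at hv with hx
      · have hx' : (x : ℕ) = m := by rw [hx, Fin.val_last]
        have h0 : P 0 = 0 := rfl
        rw [hx'] at h1
        rw [hv] at h4 h9
        rcases Nat.eq_zero_or_pos m with hm | hm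
        · rw [hx', hm] at h7
          omega
        · have := hmono (show 0 + 1 ≤ m by omega)
          omega
      · rw [hv] at h4 h5 h9
        omega
  · rw [Finset.sum_add_distrib, ← Fin.sum_univ_add fun t => g (p t), ← e.sum_comp,
      Fintype.sum_sigma]
    simp [p]

section PowExponents

variable {n l : ℕ} [NeZero l] {f : ZMod l → Fin n} {k : ℕ}

lemma ZMod.natCast_ne_zero_of_lt {l c : ℕ} (hc : 0 < c) (hl : c < l) : (c : ZMod l) ≠ 0 := by
  rw [Ne, ZMod.natCast_eq_zero_iff]
  exact fun h => absurd (Nat.le_of_dvd hc h) (by omega)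

lemma exists_sub_single_mem_anticyclePow (hf : Function.Injective f) (hl : 5 ≤ l)
    {a : Fin n →₀ ℕ} (ha : a ∈ anticyclePow f k) (hlt : 2 * k < ∑ i, a (f i)) :
    ∃ i, 0 < a (f i) ∧ a - Finsupp.single (f i) 1 ∈ anticyclePow f k := by
  have h2 : (2 : ZMod l) ≠ 0 := by
    simpa using ZMod.natCast_ne_zero_of_lt (l := l) (c := 2) (by omega) (by omega)
  have h3 : (3 : ZMod l) ≠ 0 := by
    simpa using ZMod.natCast_ne_zero_of_lt (l := l) (c := 3) (by omega) (by omega)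
  have key : ∀ i, 0 < a (f i) →
      (∀ j, ∑ i ∈ {j, j + 1}ᶜ, a (f i) = k → i = j ∨ i = j + 1) →
      ∃ i, 0 < a (f i) ∧ a - Finsupp.single (f i) 1 ∈ anticyclePow f k := by
    intro i hi h
    have hs : ∀ s : Finset (ZMod l), ∑ x ∈ s, a (f x) =
        ∑ x ∈ s, (a - Finsupp.single (f i) 1 : Fin n →₀ ℕ) (f x) + if i ∈ s then 1 else 0 := fun s => by
      rw [← Finset.sum_ite_eq s i fun _ => 1, ← Finset.sum_add_distrib]
      refine Finset.sum_congr rfl fun x _ => ?_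
      rw [Finsupp.tsub_apply, Finsupp.single_apply]
      by_cases hx : i = x
      · subst hx; simp; omega
      · simp [hx, hf.ne hx]
    refine ⟨i, hi, ?_, fun j => ?_⟩
    · have := hs Finset.univ
      rw [if_pos (Finset.mem_univ _)] at this
      omega
    · have h4 := hs {j, j + 1}ᶜ
      have h5 : k ≤ ∑ i ∈ {j, j + 1}ᶜ, a (f i) := ha.2 j
      have h6 := h j
      simp only [Finset.mem_compl, Finset.mem_insert, Finset.mem_singleton] at h4
      change k ≤ ∑ x ∈ {j, j + 1}ᶜ, (a - Finsupp.single (f i) 1 : Fin n →₀ ℕ) (f x)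
      split_ifs at h4 with h7
      · omega
      · rcases h5.eq_or_lt with h8 | h8
        · exact absurd (h6 h8.symm) h7
        · omega
  have hadj : ∀ j j', ∑ i ∈ {j, j + 1}ᶜ, a (f i) = k → ∑ i ∈ {j', j' + 1}ᶜ, a (f i) = k →
      j = j' ∨ j = j' - 1 ∨ j' = j - 1 := fun j j' hj hj' =>
    adjacent_of_notMem_arcPow (f := f) (k := k + 1) (by omega) (a := a) (by omega)
      (fun h : k + 1 ≤ _ => by omega) (fun h : k + 1 ≤ _ => by omega)
  by_cases ht : ∃ j, ∑ i ∈ {j, j + 1}ᶜ, a (f i) = k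
  · by_cases ht' : ∃ j, ∑ i ∈ {j, j + 1}ᶜ, a (f i) = k ∧
        ∑ i ∈ {j + 1, j + 1 + 1}ᶜ, a (f i) = k
    · obtain ⟨j, hj, hj'⟩ := ht'
      refine key (j + 1) ?_ fun i hi => ?_
      · have h4 := sum_arc (f := f) (by omega) a j
        have h5 := sum_arc (f := f) (by omega) a (j + 1)
        have h6 : a (f j) + a (f (j + 1 + 1)) ≤ ∑ i, a (f i) := by
          rw [← Finset.sum_pair (f := fun i => a (f i))
            (show j ≠ j + 1 + 1 from fun h => h2 (by linear_combination -h))]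
          exact Finset.sum_le_sum_of_subset (Finset.subset_univ _)
        omega
      · rcases hadj i j hi hj with h | h | h
        · exact .inr (by rw [h])
        · rcases hadj i (j + 1) hi hj' with h' | h' | h'
          · exact .inl h'.symm
          · exact absurd (h.symm.trans h') (by simpa using (ne_add_one (l := l) (by omega) (j - 1)))
          · exact absurd (show (3 : ZMod l) = 0 by linear_combination h' + h) h3
        · exact .inl (by rw [h]; ring)
    · obtain ⟨j, hj⟩ := ht
      have huniq : ∀ i, ∑ x ∈ {i, i + 1}ᶜ, a (f x) = k → i = j := fun i hi => by
        rcases hadj i j hi hj with h | h | h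
        · exact h
        · obtain rfl : j = i + 1 := by rw [h]; ring
          exact absurd ⟨_, hi, hj⟩ ht'
        · obtain rfl : i = j + 1 := by rw [h]; ring
          exact absurd ⟨_, hj, hi⟩ ht'
      have h4 := sum_arc (f := f) (by omega) a j
      rcases Nat.eq_zero_or_pos (a (f j)) with h0 | h0
      · exact key (j + 1) (by omega) fun i hi => .inr (by rw [huniq i hi])
      · exact key j h0 fun i hi => .inl (huniq i hi).symm
  · obtain ⟨i, -, hi⟩ : ∃ i ∈ Finset.univ, a (f i) ≠ 0 :=
      Finset.exists_ne_zero_of_sum_ne_zero (by omega)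
    exact key i (Nat.pos_of_ne_zero hi) fun j hj => absurd ⟨j, hj⟩ ht

/-- A monomial ideal generated by the edges of an anticycle contains in its `k`-th power all
monomials with exponent in `anticyclePow`. -/
lemma monomial_mem_pow {K : Type} [Field K] (hf : Function.Injective f) (hl : 5 ≤ l)
    {I : Ideal (SRing K n)}
    (hI : ∀ i j : ZMod l, i ≠ j → i ≠ j + 1 → j ≠ i + 1 →
      monomial (Finsupp.single (f i) 1 + Finsupp.single (f j) 1) (1 : K) ∈ I)
    {a : Fin n →₀ ℕ} (ha : a ∈ anticyclePow f k) : monomial a (1 : K) ∈ I ^ k := by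
  obtain ⟨w, hw⟩ : ∃ w, ∑ i, a (f i) = 2 * k + w := ⟨_, (Nat.add_sub_cancel' ha.1).symm⟩
  induction w generalizing a with
  | succ w ih =>
    obtain ⟨i, hi, hmem⟩ := exists_sub_single_mem_anticyclePow hf hl ha (by omega)
    have hs := tsub_add_cancel_of_le (single_one_le hi)
    rw [← hs, ← one_mul (1 : K), ← monomial_mul]
    refine Ideal.mul_mem_right _ _ (ih hmem ?_)
    have h1 : ∑ x, a (f x) = ∑ x, (a - Finsupp.single (f i) 1 : Fin n →₀ ℕ) (f x) + 1 := by
      conv_lhs => rw [← hs]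
      simp [Finset.sum_add_distrib, Finsupp.single_apply, hf.eq_iff]
    omega
  | zero =>
    obtain ⟨m, rfl⟩ : ∃ m, l = m + 1 := ⟨l - 1, by omega⟩
    have hj : ∀ j, a (f j) + a (f (j + 1)) ≤ k := fun j => by
      have h1 := sum_arc (f := f) (by omega) a j
      have h2 : k ≤ ∑ i ∈ {j, j + 1}ᶜ, a (f i) := ha.2 j
      omega
    obtain ⟨x, y, hxy, hsum⟩ := exists_cyclic_pairing (fun i : Fin (m + 1) => a (f i))
      (show _ = k + k by rw [← two_mul]; exact hw) hj fun j => by have := hj j; omega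
    have h0 : ∀ f : Fin (m + 1) → Fin n, Function.Injective f →
        ∑ i, a (f i) • Finsupp.single (f i) 1 ≤ a := by
      intro f hf v
      rw [Finsupp.finsetSum_apply]
      by_cases hv : ∃ i, f i = v
      · obtain ⟨i, rfl⟩ := hv
        rw [Finset.sum_eq_single_of_mem i (Finset.mem_univ _)]
        · simp
        · intro j _ hji
          simp [hf.ne hji]
      · push Not at hv
        rw [Finset.sum_eq_zero fun i _ => by simp [hv i]]
        exact Nat.zero_le _
    have h1 := h0 f hf
    rw [← tsub_add_cancel_of_le h1, ← one_mul (1 : K), ← monomial_mul]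
    refine Ideal.mul_mem_left _ _ ?_
    rw [hsum fun i => Finsupp.single (f i) 1]
    have h2 : monomial (∑ t, (Finsupp.single (f (x t)) 1 + Finsupp.single (f (y t)) 1)) (1 : K) =
        ∏ t : Fin k, monomial (Finsupp.single (f (x t)) 1 + Finsupp.single (f (y t)) 1) (1 : K) := by
      rw [monomial_sum_one]
    rw [h2]
    have h3 := Ideal.prod_mem_prod (s := Finset.univ) (I := fun _ : Fin k => I)
      (x := fun t => monomial (Finsupp.single (f (x t)) 1 + Finsupp.single (f (y t)) 1) (1 : K))
      fun t _ => hI _ _ (hxy t).1 (hxy t).2.1 (hxy t).2.2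
    simpa using h3

lemma isUpperSet_anticyclePow : IsUpperSet (anticyclePow f k) := fun _ _ hab ha =>
  ⟨ha.1.trans (Finset.sum_le_sum fun i _ => hab (f i)),
    fun j => isUpperSet_arcPow f k j hab (ha.2 j)⟩

lemma mem_restrictSupportIdeal {K : Type} [Field K] {J : Set (Fin n →₀ ℕ)} {hJ : IsUpperSet J}
    {p : SRing K n} : p ∈ restrictSupportIdeal K J hJ ↔ ∀ a, coeff a p ≠ 0 → a ∈ J := by
  change p ∈ restrictSupport K J ↔ _
  rw [mem_restrictSupport_iff]
  exact ⟨fun h a ha => h (by simpa using ha), fun h a ha => h a (by simpa using ha)⟩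

lemma restrictSupportIdeal_le_iff {K : Type} [Field K] {J : Set (Fin n →₀ ℕ)} {hJ : IsUpperSet J}
    {I : Ideal (SRing K n)} :
    restrictSupportIdeal K J hJ ≤ I ↔ ∀ a ∈ J, monomial a (1 : K) ∈ I := by
  refine ⟨fun h a ha => h ?_, fun h p hp => ?_⟩
  · rw [mem_restrictSupportIdeal]
    intro b hb
    rw [coeff_monomial] at hb
    split_ifs at hb with hab
    · exact hab ▸ ha
    · exact absurd rfl hb
  · rw [mem_restrictSupportIdeal] at hp
    rw [p.as_sum]
    refine I.sum_mem fun a ha => ?_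
    rw [← mul_one (coeff a p), ← C_mul_monomial]
    exact I.mul_mem_left _ (h a (hp a (by simpa using ha)))

/-- The exponents of the monomials in the edge ideal of `E`. -/
def edgeExp (E : Fin n → Fin n → Prop) : Set (Fin n →₀ ℕ) :=
  {a | ∃ i j, E i j ∧ Finsupp.single i 1 + Finsupp.single j 1 ≤ a}

lemma isUpperSet_edgeExp (E : Fin n → Fin n → Prop) : IsUpperSet (edgeExp E) :=
  fun _ _ hab ⟨i, j, h, ha⟩ => ⟨i, j, h, ha.trans hab⟩

lemma edgeIdeal_eq (K : Type) [Field K] (E : Fin n → Fin n → Prop) :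
    edgeIdeal K E = restrictSupportIdeal K (edgeExp E) (isUpperSet_edgeExp E) := by
  refine le_antisymm (Ideal.span_le.2 ?_) (restrictSupportIdeal_le_iff.2 ?_)
  · rintro p ⟨i, j, h, rfl⟩
    rw [X, X, monomial_mul, one_mul]
    exact restrictSupportIdeal_le_iff.1 (le_refl (restrictSupportIdeal K _
      (isUpperSet_edgeExp E))) _ ⟨i, j, h, le_rfl⟩
  · rintro a ⟨i, j, h, ha⟩
    rw [← tsub_add_cancel_of_le ha, ← one_mul (1 : K), ← monomial_mul]
    refine Ideal.mul_mem_left _ _ (Ideal.subset_span ⟨i, j, h, ?_⟩)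
    rw [X, X, monomial_mul, one_mul]

lemma edgeIdeal_pow_eq (K : Type) [Field K] {E : Fin n → Fin n → Prop}
    (hf : Function.Injective f) (hl : 5 ≤ l)
    (hE : ∀ i j, E i j → ∃ i' j', i = f i' ∧ j = f j')
    (hEf : ∀ i j, E (f i) (f j) ↔ i ≠ j ∧ i ≠ j + 1 ∧ j ≠ i + 1) :
    edgeIdeal K E ^ k = restrictSupportIdeal K (anticyclePow f k) isUpperSet_anticyclePow := by
  refine le_antisymm ?_ (restrictSupportIdeal_le_iff.2 fun a ha => monomial_mem_pow hf hl ?_ ha)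
  · induction k with
    | zero =>
      intro p _
      rw [mem_restrictSupportIdeal]
      intro a _
      exact ⟨by simp, fun j => Nat.zero_le _⟩
    | succ k ih =>
      rw [pow_succ, Ideal.mul_le]
      intro p hp q hq
      have hp' := ih hp
      rw [edgeIdeal_eq, mem_restrictSupportIdeal] at hq
      rw [mem_restrictSupportIdeal] at hp' ⊢
      intro c hc
      rw [coeff_mul] at hc
      obtain ⟨⟨a, b⟩, hab, hne⟩ := Finset.exists_ne_zero_of_sum_ne_zero hc
      rw [Finset.HasAntidiagonal.mem_antidiagonal] at hab
      subst hab
      obtain ⟨h1, h2⟩ := hp' a (left_ne_zero_of_mul hne)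
      obtain ⟨i, j, hij, hle⟩ := hq b (right_ne_zero_of_mul hne)
      obtain ⟨i, j, rfl, rfl⟩ := hE i j hij
      obtain ⟨hij, h3, h4⟩ := (hEf i j).1 hij
      have hs : ∀ s : Finset (ZMod l), (if i ∈ s then 1 else 0) + (if j ∈ s then 1 else 0) ≤
          ∑ x ∈ s, b (f x) := fun s => by
        rw [← Finset.sum_ite_eq s i fun _ => 1, ← Finset.sum_ite_eq s j fun _ => 1,
          ← Finset.sum_add_distrib]
        refine Finset.sum_le_sum fun x _ => le_trans (le_of_eq ?_) (hle (f x))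
        simp [Finsupp.single_apply, hf.eq_iff]
      refine ⟨?_, fun m => ?_⟩
      · have := hs Finset.univ
        simp only [Finset.mem_univ, if_true] at this
        simp only [Finsupp.add_apply, Finset.sum_add_distrib]
        omega
      · have h5 := hs {m, m + 1}ᶜ
        have h6 : k ≤ ∑ i ∈ {m, m + 1}ᶜ, a (f i) := h2 m
        change k + 1 ≤ ∑ i ∈ {m, m + 1}ᶜ, (a + b) (f i)
        simp only [Finsupp.add_apply, Finset.sum_add_distrib]
        have h7 : i ∈ ({m, m + 1}ᶜ : Finset (ZMod l)) ∨ j ∈ ({m, m + 1}ᶜ : Finset (ZMod l)) := by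
          by_contra! hcon
          simp only [Finset.mem_compl, Finset.mem_insert, Finset.mem_singleton, not_not] at hcon
          rcases hcon with ⟨rfl | rfl, rfl | rfl⟩ <;> simp_all
        rcases h7 with h7 | h7
        · rw [if_pos h7] at h5
          omega
        · rw [if_pos h7] at h5
          omega
  · intro i j h1 h2 h3
    refine Ideal.subset_span ⟨f i, f j, (hEf i j).2 ⟨h1, h2, h3⟩, ?_⟩
    rw [X, X, monomial_mul, one_mul]

end PowExponents

/-! ### Edge ideals of graphs with chordal complement -/

section Chordal

variable {n : ℕ} {K : Type} [Field K] {G : SimpleGraph (Fin n)}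

lemma mem_edgeExp_iff {E : Fin n → Fin n → Prop} (hE : ∀ i, ¬ E i i) {a : Fin n →₀ ℕ} :
    a ∈ edgeExp E ↔ ∃ i j, E i j ∧ 0 < a i ∧ 0 < a j := by
  refine exists_congr fun i => exists_congr fun j => and_congr_right fun h => ?_
  have hij : i ≠ j := fun h' => hE j (h' ▸ h)
  constructor
  · intro h
    have h1 := h i
    have h2 := h j
    simp [hij, hij.symm] at h1 h2
    omega
  · rintro ⟨hi, hj⟩ v
    by_cases h1 : i = v
    · subst h1
      simp [hij.symm]; omega
    · by_cases h2 : j = v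
      · subst h2
        simp [hij]; omega
      · simp [h1, h2]

lemma kLin_edgeExp_of_forall_exists_simplicial
    (hS : ∀ W : Finset (Fin n), W.Nonempty → ∃ u ∈ W, ∀ x ∈ W, ∀ y ∈ W, G.Adj x y →
      x = u ∨ y = u ∨ G.Adj x u ∨ G.Adj y u) : KLin K 2 (edgeExp G.Adj) := by
  have key : ∀ W : Finset (Fin n), KLin K 2 {a | ∃ i ∈ W, ∃ j ∈ W, G.Adj i j ∧ 0 < a i ∧ 0 < a j} := by
    intro W
    induction W using Finset.strongInduction with
    | H W ih =>
    rcases W.eq_empty_or_nonempty with rfl | hW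
    · intro b e he φ hφ h0
      refine ⟨0, ?_, fun T hT => absurd rfl hT⟩
      rw [map_zero]
      funext T
      by_contra hT
      obtain ⟨a, ⟨i, hi, -⟩, -⟩ := hφ T (Ne.symm hT)
      simp at hi
    · obtain ⟨u, hu, hsimp⟩ := hS W hW
      have h1 := ih (W.erase u) (Finset.erase_ssubset hu)
      have h2 : KLin K 1 {a : Fin n →₀ ℕ | ∃ j ∈ W, G.Adj u j ∧ 0 < a j} := by
        refine KLin.of_free {v | ¬ (v ∈ W ∧ G.Adj u v)} ?_ ?_
        · rintro a ⟨j, hj, huj, haj⟩ v hv -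
          refine ⟨j, hj, huj, ?_⟩
          have : v ≠ j := fun h => hv (h ▸ ⟨hj, huj⟩)
          simpa [Finsupp.single_apply, this] using haj
        · intro a ha hd
          rw [mdeg_eq] at hd
          obtain ⟨j, -, hj⟩ : ∃ j ∈ Finset.univ, a j ≠ 0 :=
            Finset.exists_ne_zero_of_sum_ne_zero (by omega)
          have : ¬ (¬ (j ∈ W ∧ G.Adj u j)) := fun h => hj (ha j h)
          push Not at this
          exact ⟨j, this.1, this.2, Nat.pos_of_ne_zero hj⟩
      have hsub : ∀ (a : Fin n →₀ ℕ) j, j ≠ u → (a - Finsupp.single u 1 : Fin n →₀ ℕ) j = a j := fun a j hj => by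
        simp [hj.symm]
      have h3 := KLin.union (K := K) (d := 2) ?_ ?_ h1 (h2.shift u) ?_
      · convert h3 using 1
        ext a
        simp only [Set.mem_ofPred_eq, Set.mem_union]
        constructor
        · rintro ⟨i, hi, j, hj, hij, hai, haj⟩
          by_cases hiu : i = u
          · subst hiu
            exact .inr ⟨hai, j, hj, hij, by rwa [hsub a j hij.ne']⟩
          · by_cases hju : j = u
            · subst hju
              exact .inr ⟨haj, i, hi, hij.symm, by rwa [hsub a i hij.ne]⟩
            · exact .inl ⟨i, by simp [hi, hiu], j, by simp [hj, hju], hij, hai, haj⟩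
        · rintro (⟨i, hi, j, hj, h⟩ | ⟨hau, j, hj, huj, haj⟩)
          · exact ⟨i, Finset.mem_of_mem_erase hi, j, Finset.mem_of_mem_erase hj, h⟩
          · rw [hsub a j huj.ne'] at haj
            exact ⟨u, hu, j, hj, huj, hau, haj⟩
      · rintro a b hab ⟨i, hi, j, hj, hij, hai, haj⟩
        exact ⟨i, hi, j, hj, hij, hai.trans_le (hab i), haj.trans_le (hab j)⟩
      · rintro a b hab ⟨hau, j, hj, huj, haj⟩
        rw [hsub a j huj.ne'] at haj
        refine ⟨hau.trans_le (hab u), j, hj, huj, ?_⟩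
        rw [hsub b j huj.ne']
        exact haj.trans_le (hab j)
      · convert h1.shift u using 1
        ext a
        simp only [Set.mem_ofPred_eq, Set.mem_inter_iff]
        constructor
        · rintro ⟨⟨i, hi, j, hj, hij, hai, haj⟩, hau, -⟩
          refine ⟨hau, i, hi, j, hj, hij, ?_, ?_⟩
          · rwa [hsub a i (Finset.ne_of_mem_erase hi)]
          · rwa [hsub a j (Finset.ne_of_mem_erase hj)]
        · rintro ⟨hau, i, hi, j, hj, hij, hai, haj⟩
          have hiu := Finset.ne_of_mem_erase hi
          have hju := Finset.ne_of_mem_erase hj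
          have hi' := Finset.mem_of_mem_erase hi
          have hj' := Finset.mem_of_mem_erase hj
          have hai' := hai
          have haj' := haj
          rw [hsub a i hiu] at hai
          rw [hsub a j hju] at haj
          refine ⟨⟨i, hi, j, hj, hij, hai, haj⟩, hau, ?_⟩
          rcases hsimp i hi' j hj' hij with h | h | h | h
          · exact absurd h hiu
          · exact absurd h hju
          · exact ⟨i, hi', h.symm, hai'⟩
          · exact ⟨j, hj', h.symm, haj'⟩
  convert key Finset.univ using 1
  ext a
  rw [mem_edgeExp_iff fun _ => G.irrefl]
  simp

end Chordal

/-! ### Simplicial vertices and induced cycles -/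

section Dirac

variable {V : Type} {H : SimpleGraph V}

/-- `f` runs around an induced cycle of `H`. -/
def IsInducedCycle (H : SimpleGraph V) {l : ℕ} (f : ZMod l → V) : Prop :=
  Function.Injective f ∧ ∀ i j, H.Adj (f i) (f j) ↔ j = i + 1 ∨ i = j + 1

lemma exists_isInducedCycle_of_reachable {v s t : V} {D : Set V} (hst : s ≠ t)
    (hnst : ¬ H.Adj s t) (hvs : H.Adj v s) (hvt : H.Adj v t) (hD : ∀ y ∈ D, ¬ H.Adj v y)
    (hvD : v ∉ D)
    (hr : (SimpleGraph.fromRel fun y z => H.Adj y z ∧ y ∈ insert s (insert t D) ∧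
      z ∈ insert s (insert t D)).Reachable s t) :
    ∃ (l : ℕ) (f : ZMod l → V), 4 ≤ l ∧ IsInducedCycle H f := by
  set H' : SimpleGraph V := SimpleGraph.fromRel fun y z => H.Adj y z ∧
    y ∈ insert s (insert t D) ∧ z ∈ insert s (insert t D) with hH'
  have hadj : ∀ y z, H'.Adj y z ↔ H.Adj y z ∧ y ∈ insert s (insert t D) ∧
      z ∈ insert s (insert t D) := fun y z => by
    rw [hH', SimpleGraph.fromRel_adj]
    constructor
    · rintro ⟨-, h | ⟨h1, h2, h3⟩⟩
      · exact h
      · exact ⟨h1.symm, h3, h2⟩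
    · exact fun h => ⟨h.1.ne, .inl h⟩
  obtain ⟨p, hp⟩ := hr.exists_walk_length_eq_dist
  set m := p.length with hm
  set g : ℕ → V := p.getVert with hg
  have hg0 : g 0 = s := p.getVert_zero
  have hgm : g m = t := p.getVert_length
  have hdist : ∀ i ≤ m, H'.dist s (g i) = i := fun i hi => by
    have h1 : H'.dist s (g i) ≤ i := (SimpleGraph.dist_le (p.take i)).trans (by simp)
    have h2 : H'.dist (g i) t ≤ m - i := (SimpleGraph.dist_le (p.drop i)).trans (by simp [hm])
    have h3 : H'.dist s t ≤ H'.dist s (g i) + H'.dist (g i) t :=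
      SimpleGraph.Reachable.dist_triangle_left ⟨p.take i⟩ _
    omega
  have hmem : ∀ i ≤ m, g i ∈ insert s (insert t D) := fun i hi => by
    rcases Nat.eq_zero_or_pos i with rfl | h0
    · simp [hg0]
    · have := p.adj_getVert_succ (i := i - 1) (by omega)
      rw [Nat.sub_add_cancel h0] at this
      exact ((hadj _ _).1 this).2.2
  have hgadj : ∀ i ≤ m, ∀ j ≤ m, H.Adj (g i) (g j) ↔ j = i + 1 ∨ i = j + 1 := by
    intro i hi j hj
    constructor
    · intro h
      have h' : H'.Adj (g i) (g j) := (hadj _ _).2 ⟨h, hmem i hi, hmem j hj⟩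
      have h1 : H'.dist s (g i) ≤ H'.dist s (g j) + H'.dist (g j) (g i) :=
        SimpleGraph.Reachable.dist_triangle_left ⟨p.take j⟩ _
      have h2 : H'.dist s (g j) ≤ H'.dist s (g i) + H'.dist (g i) (g j) :=
        SimpleGraph.Reachable.dist_triangle_left ⟨p.take i⟩ _
      rw [SimpleGraph.dist_eq_one_iff_adj.2 h', hdist i hi, hdist j hj] at h2
      rw [SimpleGraph.dist_eq_one_iff_adj.2 h'.symm, hdist i hi, hdist j hj] at h1
      have h3 : i ≠ j := fun h4 => h.ne (by rw [h4])
      omega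
    · rintro (rfl | rfl)
      · exact ((hadj _ _).1 (p.adj_getVert_succ (by omega))).1
      · exact ((hadj _ _).1 (p.adj_getVert_succ (by omega))).1.symm
  have hginj : ∀ i ≤ m, ∀ j ≤ m, g i = g j → i = j := fun i hi j hj h => by
    rw [← hdist i hi, ← hdist j hj, h]
  have hm2 : 2 ≤ m := by
    by_contra hlt
    rcases (show m = 0 ∨ m = 1 by omega) with h | h
    · exact hst (by rw [← hg0, ← hgm, h])
    · exact hnst (by rw [← hg0, ← hgm]; exact (hgadj 0 (by omega) m le_rfl).2 (.inl (by omega)))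
  have hgv : ∀ i ≤ m, (H.Adj v (g i) ↔ i = 0 ∨ i = m) ∧ g i ≠ v := fun i hi => by
    rcases hmem i hi with h | h | h
    · have h0 : i = 0 := hginj i hi 0 (by omega) (h.trans hg0.symm)
      exact ⟨⟨fun _ => .inl h0, fun _ => h ▸ hvs⟩, h ▸ hvs.ne'⟩
    · have h0 : i = m := hginj i hi m le_rfl (h.trans hgm.symm)
      exact ⟨⟨fun _ => .inr h0, fun _ => h ▸ hvt⟩, h ▸ hvt.ne'⟩
    · refine ⟨⟨fun h' => absurd h' (hD _ h), ?_⟩, fun h' => hvD (h' ▸ h)⟩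
      rintro (rfl | rfl)
      · rwa [hg0]
      · rwa [hgm]
  let f : Fin (m + 1 + 1) → V := fun i => if (i : ℕ) ≤ m then g i else v
  have hlast : ∀ i : Fin (m + 1 + 1), ¬ (i : ℕ) ≤ m → (i : ℕ) = m + 1 := fun i hi => by omega
  have hsucc : ∀ i j : Fin (m + 1 + 1), j = i + 1 ↔
      (j : ℕ) = if (i : ℕ) = m + 1 then 0 else (i : ℕ) + 1 := fun i j => by
    rw [Fin.ext_iff, Fin.val_add_one]
    simp only [Fin.ext_iff, Fin.val_last]
  have hf : Function.Injective f ∧ ∀ i j, H.Adj (f i) (f j) ↔ j = i + 1 ∨ i = j + 1 := by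
    constructor
    · intro i j hij
      simp only [f] at hij
      split_ifs at hij with h1 h2 h2
      · exact Fin.ext (hginj _ h1 _ h2 hij)
      · exact absurd hij (hgv _ h1).2
      · exact absurd hij.symm (hgv _ h2).2
      · exact Fin.ext (by omega)
    · intro i j
      rw [hsucc i j, hsucc j i]
      simp only [f]
      by_cases h1 : (i : ℕ) ≤ m <;> by_cases h2 : (j : ℕ) ≤ m
      · rw [if_pos h1, if_pos h2, hgadj _ h1 _ h2, if_neg (by omega), if_neg (by omega)]
      · have := hlast j h2
        rw [if_pos h1, if_neg h2, SimpleGraph.adj_comm, (hgv _ h1).1, if_neg (by omega),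
          if_pos (by omega)]
        omega
      · have := hlast i h1
        rw [if_neg h1, if_pos h2, (hgv _ h2).1, if_pos (by omega), if_neg (by omega)]
        omega
      · have := hlast j h2
        have := hlast i h1
        rw [if_neg h1, if_neg h2, if_pos (by omega), if_pos (by omega)]
        simp only [SimpleGraph.irrefl, false_iff]
        omega
  exact ⟨m + 1 + 1, f, by omega, hf⟩

/-- Dirac's lemma: in a graph without long induced cycles, some simplicial vertex is not adjacent
to a given non-universal vertex. -/
lemma exists_simplicial_of_not_adj [DecidableEq V]
    (hno : ¬ ∃ (l : ℕ) (f : ZMod l → V), 4 ≤ l ∧ IsInducedCycle H f) (W : Finset V) :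
    ∀ v ∈ W, ∀ x ∈ W, x ≠ v → ¬ H.Adj v x → ∃ u ∈ W, u ≠ v ∧ ¬ H.Adj v u ∧
      ∀ y ∈ W, ∀ z ∈ W, H.Adj u y → H.Adj u z → y ≠ z → H.Adj y z := by
  classical
  induction W using Finset.strongInduction with
  | H W ih =>
  intro v hv x hx hxv hvx
  let D : Finset V := W.filter fun y => y ≠ v ∧ ¬ H.Adj v y
  let HD : SimpleGraph V := SimpleGraph.fromRel fun y z => H.Adj y z ∧ y ∈ D ∧ z ∈ D
  let C : Finset V := D.filter fun y => HD.Reachable x y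
  let S : Finset V := W.filter fun s => H.Adj v s ∧ ∃ y ∈ C, H.Adj s y
  have hxD : x ∈ D := Finset.mem_filter.2 ⟨hx, hxv, hvx⟩
  have hxC : x ∈ C := Finset.mem_filter.2 ⟨hxD, .refl _⟩
  have hCD : ∀ y ∈ C, y ∈ D := fun y hy => (Finset.mem_filter.1 hy).1
  have hDW : ∀ y ∈ D, y ∈ W := fun y hy => (Finset.mem_filter.1 hy).1
  have hDv : ∀ y ∈ D, y ≠ v ∧ ¬ H.Adj v y := fun y hy => (Finset.mem_filter.1 hy).2
  have hnbr : ∀ y ∈ C, ∀ z ∈ W, H.Adj y z → z ∈ C ∨ z ∈ S := fun y hy z hz hyz => by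
    by_cases hvz : H.Adj v z
    · exact .inr (Finset.mem_filter.2 ⟨hz, hvz, y, hy, hyz.symm⟩)
    · have hzD : z ∈ D := Finset.mem_filter.2
        ⟨hz, fun h => (hDv y (hCD y hy)).2 (h ▸ hyz.symm), hvz⟩
      refine .inl (Finset.mem_filter.2 ⟨hzD, (Finset.mem_filter.1 hy).2.trans ?_⟩)
      exact SimpleGraph.Adj.reachable
        ((SimpleGraph.fromRel_adj _ _ _).2 ⟨hyz.ne, .inl ⟨hyz, hCD y hy, hzD⟩⟩)
  have hS : ∀ s ∈ S, ∀ t ∈ S, s ≠ t → H.Adj s t := by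
    intro s hs t ht hst
    by_contra hnst
    obtain ⟨hsW, hvs, y, hy, hsy⟩ := Finset.mem_filter.1 hs
    obtain ⟨htW, hvt, z, hz, htz⟩ := Finset.mem_filter.1 ht
    refine hno (exists_isInducedCycle_of_reachable (D := {y | y ∈ D}) hst hnst hvs hvt
      (fun y hy => (hDv y hy).2) (fun h => (hDv v h).1 rfl) ?_)
    have hadj : ∀ a b, H.Adj a b → a ∈ insert s (insert t {y | y ∈ D}) →
        b ∈ insert s (insert t {y | y ∈ D}) →
        (SimpleGraph.fromRel fun y z => H.Adj y z ∧ y ∈ insert s (insert t {y | y ∈ D}) ∧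
          z ∈ insert s (insert t {y | y ∈ D})).Reachable a b := fun a b h ha hb =>
      SimpleGraph.Adj.reachable ((SimpleGraph.fromRel_adj _ _ _).2 ⟨h.ne, .inl ⟨h, ha, hb⟩⟩)
    refine (hadj s y hsy (.inl rfl) (.inr (.inr (hCD y hy)))).trans ((SimpleGraph.Reachable.mono
      ?_ ((Finset.mem_filter.1 hy).2.symm.trans (Finset.mem_filter.1 hz).2)).trans
      (hadj z t htz.symm (.inr (.inr (hCD z hz))) (.inr (.inl rfl))))
    intro a b hab
    rw [SimpleGraph.fromRel_adj] at hab ⊢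
    refine ⟨hab.1, hab.2.imp ?_ ?_⟩ <;>
    exact fun h => ⟨h.1, .inr (.inr h.2.1), .inr (.inr h.2.2)⟩
  have hvC : v ∉ C := fun h => (hDv v (hCD v h)).1 rfl
  have hvS : v ∉ S := fun h => (Finset.mem_filter.1 h).2.1.ne rfl
  have hW1 : C ∪ S ⊂ W := by
    refine (Finset.ssubset_iff_of_subset (Finset.union_subset (fun y hy => hDW y (hCD y hy))
      (Finset.filter_subset _ _))).2 ⟨v, hv, ?_⟩
    simp [hvC]
  by_cases hcase : ∃ s ∈ S, ∃ x' ∈ C ∪ S, x' ≠ s ∧ ¬ H.Adj s x'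
  · obtain ⟨s, hs, x', hx', hx's, hsx'⟩ := hcase
    obtain ⟨u, hu, hus, hsu, hsimp⟩ := ih _ hW1 s (Finset.mem_union_right _ hs) x' hx' hx's hsx'
    have huC : u ∈ C := (Finset.mem_union.1 hu).resolve_right fun h => hsu (hS s hs u h hus.symm)
    refine ⟨u, hDW u (hCD u huC), (hDv u (hCD u huC)).1, (hDv u (hCD u huC)).2, ?_⟩
    intro y hy z hz huy huz hyz
    exact hsimp y (Finset.mem_union.2 (hnbr u huC y hy huy)) z
      (Finset.mem_union.2 (hnbr u huC z hz huz)) huy huz hyz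
  · push Not at hcase
    have hC : ∃ u ∈ C, ∀ y ∈ C, ∀ z ∈ C, H.Adj u y → H.Adj u z → y ≠ z → H.Adj y z := by
      by_cases hcl : ∃ y ∈ C, ∃ z ∈ C, z ≠ y ∧ ¬ H.Adj y z
      · obtain ⟨y, hy, z, hz, hzy, hyz⟩ := hcl
        obtain ⟨u, hu, -, -, h⟩ :=
          ih C (Finset.subset_union_left.trans_ssubset hW1) y hy z hz hzy hyz
        exact ⟨u, hu, h⟩
      · push Not at hcl
        exact ⟨x, hxC, fun y hy z hz _ _ hyz => hcl y hy z hz hyz.symm⟩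
    obtain ⟨u, huC, hsimp⟩ := hC
    refine ⟨u, hDW u (hCD u huC), (hDv u (hCD u huC)).1, (hDv u (hCD u huC)).2, ?_⟩
    intro y hy z hz huy huz hyz
    rcases hnbr u huC y hy huy with h1 | h1
    · rcases hnbr u huC z hz huz with h2 | h2
      · exact hsimp y h1 z h2 huy huz hyz
      · exact (hcase z h2 y (Finset.mem_union_left _ h1) hyz).symm
    · exact hcase y h1 z (Finset.mem_union.2 (hnbr u huC z hz huz)) hyz.symm

lemma exists_simplicial
    (hno : ¬ ∃ (l : ℕ) (f : ZMod l → V), 4 ≤ l ∧ IsInducedCycle H f) {W : Finset V}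
    (hW : W.Nonempty) :
    ∃ u ∈ W, ∀ y ∈ W, ∀ z ∈ W, H.Adj u y → H.Adj u z → y ≠ z → H.Adj y z := by
  classical
  by_cases hcl : ∃ y ∈ W, ∃ z ∈ W, z ≠ y ∧ ¬ H.Adj y z
  · obtain ⟨y, hy, z, hz, hzy, hyz⟩ := hcl
    obtain ⟨u, hu, -, -, h⟩ := exists_simplicial_of_not_adj hno W y hy z hz hzy hyz
    exact ⟨u, hu, h⟩
  · push Not at hcl
    obtain ⟨u, hu⟩ := hW
    exact ⟨u, hu, fun y hy z hz _ _ hyz => hcl y hy z hz hyz.symm⟩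

end Dirac

lemma exists_isInducedCycle_of_not_kLin {n : ℕ} {K : Type} [Field K] {G : SimpleGraph (Fin n)}
    (h : ¬ KLin K 2 (edgeExp G.Adj)) :
    ∃ (l : ℕ) (f : ZMod l → Fin n), 4 ≤ l ∧ IsInducedCycle Gᶜ f := by
  by_contra hno
  refine h (kLin_edgeExp_of_forall_exists_simplicial fun W hW => ?_)
  obtain ⟨u, hu, hsimp⟩ := exists_simplicial hno hW
  refine ⟨u, hu, fun x hx y hy hxy => ?_⟩
  by_contra! hcon
  obtain ⟨h1, h2, h3, h4⟩ := hcon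
  have := hsimp x hx y hy ((SimpleGraph.compl_adj _ _ _).2 ⟨h1.symm, fun h => h3 h.symm⟩)
    ((SimpleGraph.compl_adj _ _ _).2 ⟨h2.symm, fun h => h4 h.symm⟩) hxy.ne
  exact ((SimpleGraph.compl_adj _ _ _).1 this).2 hxy

/-! ### Multigraded parts of polynomial Koszul chains -/

section Extract

variable {n : ℕ} {K : Type} [Field K]

/-- The part in multidegree `b` of a Koszul chain with polynomial coefficients. -/
def multiPart (b : Fin n →₀ ℕ) (c : Finset (Fin n) → SRing K n) (T : Finset (Fin n)) : K :=
  if ind T ≤ b then coeff (b - ind T) (c T) else 0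

lemma multiPart_add_ind (c : Finset (Fin n) → SRing K n) (a : Fin n →₀ ℕ) (T : Finset (Fin n)) :
    multiPart (a + ind T) c T = coeff a (c T) := by
  rw [multiPart, if_pos le_add_self, add_tsub_cancel_right]

lemma multiPart_koszul (b : Fin n →₀ ℕ) (c : Finset (Fin n) → SRing K n) :
    multiPart b (koszul (X : Fin n → SRing K n) c) = koszul (1 : Fin n → K) (multiPart b c) := by
  funext T
  simp only [multiPart, koszul_apply]
  split_ifs with h
  · rw [coeff_sum]
    refine Finset.sum_congr rfl fun v hv => ?_
    have hv' : v ∉ T := by simpa using hv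
    have hle : Finsupp.single v 1 + ind T ≤ b ↔ v ∈ (b - ind T).support := by
      rw [Finsupp.mem_support_iff, ← Nat.pos_iff_ne_zero, ← Nat.succ_le_iff,
        ← Finsupp.single_le_iff, le_tsub_iff_right h]
    rw [coeff_smul, smul_eq_mul, coeff_X_mul', Pi.one_apply, one_smul]
    simp only [ind_insert hv', hle, tsub_add_eq_tsub_tsub_swap]
  · refine (Finset.sum_eq_zero fun v hv => ?_).symm
    have hv' : v ∉ T := by simpa using hv
    rw [if_neg, smul_zero, smul_zero]
    rw [ind_insert hv']
    exact fun h' => h (le_add_self.trans h')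

lemma koszul_X_ext {c c' : Finset (Fin n) → SRing K n}
    (h : ∀ b, multiPart b c = multiPart b c') : c = c' := by
  funext T
  ext a
  rw [← multiPart_add_ind, ← multiPart_add_ind, h]

lemma exists_koszul_eq {J : Set (Fin n →₀ ℕ)} (c : Finset (Fin n) → SRing K n)
    (h : ∀ b, ∃ ψ, koszul (1 : Fin n → K) ψ = multiPart b c ∧
      ∀ T, ψ T ≠ 0 → ∃ a ∈ J, a + ind T = b) :
    ∃ q, koszul (X : Fin n → SRing K n) q = c ∧ ∀ T a, coeff a (q T) ≠ 0 → a ∈ J := by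
  classical
  choose ψ hψ hψJ using h
  let B : Finset (Fin n →₀ ℕ) := Finset.univ.biUnion fun T => (c T).support.image (· + ind T)
  have hB : ∀ b, b ∉ B → multiPart b c = 0 := fun b hb => by
    funext T
    rw [multiPart]
    split_ifs with hT
    · by_contra hne
      refine hb (Finset.mem_biUnion.2 ⟨T, Finset.mem_univ _, Finset.mem_image.2
        ⟨b - ind T, mem_support_iff.2 hne, tsub_add_cancel_of_le hT⟩⟩)
    · rfl
  let q : Finset (Fin n) → SRing K n := fun T =>
    ∑ b ∈ B.filter (ind T ≤ ·), monomial (b - ind T) (ψ b T)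
  have hq : ∀ T a, coeff a (q T) = if a + ind T ∈ B then ψ (a + ind T) T else 0 := fun T a => by
    simp only [q, coeff_sum, coeff_monomial]
    split_ifs with ha
    · rw [Finset.sum_eq_single_of_mem (a + ind T) (Finset.mem_filter.2 ⟨ha, le_add_self⟩)]
      · simp
      · intro b hb hne
        rw [if_neg]
        rintro rfl
        exact hne (tsub_add_cancel_of_le (Finset.mem_filter.1 hb).2).symm
    · refine Finset.sum_eq_zero fun b hb => if_neg ?_
      rintro rfl
      rw [tsub_add_cancel_of_le (Finset.mem_filter.1 hb).2] at ha
      exact ha (Finset.mem_filter.1 hb).1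
  refine ⟨q, koszul_X_ext fun b => ?_, fun T a ha => ?_⟩
  · have h1 : multiPart b q = if b ∈ B then ψ b else 0 := by
      funext T
      rw [multiPart]
      split_ifs with hT hb hb
      · rw [hq, tsub_add_cancel_of_le hT, if_pos hb]
      · rw [hq, tsub_add_cancel_of_le hT, if_neg hb]; rfl
      · by_contra hne
        obtain ⟨a, -, h⟩ := hψJ b T (Ne.symm hne)
        exact hT (h ▸ le_add_self)
      · rfl
    rw [multiPart_koszul, h1]
    split_ifs with hb
    · exact hψ b
    · rw [map_zero, hB b hb]
  · rw [hq] at ha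
    split_ifs at ha with hb
    · obtain ⟨a', ha', h⟩ := hψJ _ T ha
      rwa [← add_right_cancel h]
    · exact absurd rfl ha

/-- Exactness of the Koszul complex of the polynomial ring outside the constants. -/
lemma exists_koszul_eq_of_coeff_zero {c : Finset (Fin n) → SRing K n}
    (hc : koszul (X : Fin n → SRing K n) c = 0) (h0 : coeff 0 (c ∅) = 0) :
    ∃ q, koszul (X : Fin n → SRing K n) q = c := by
  suffices h : ∀ b, ∃ ψ, koszul (1 : Fin n → K) ψ = multiPart b c ∧
      ∀ T, ψ T ≠ 0 → ∃ a ∈ (Set.univ : Set (Fin n →₀ ℕ)), a + ind T = b by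
    obtain ⟨q, hq, -⟩ := exists_koszul_eq c h
    exact ⟨q, hq⟩
  · intro b
    have hb : koszul (1 : Fin n → K) (multiPart b c) = 0 := by
      rw [← multiPart_koszul, hc]
      funext T
      simp [multiPart]
    by_cases hb0 : b = 0
    · subst hb0
      refine ⟨0, ?_, fun T hT => absurd rfl hT⟩
      rw [map_zero]
      funext T
      rw [multiPart]
      split_ifs with hT
      · have : T = ∅ := by
          refine Finset.eq_empty_of_forall_notMem fun v hv => ?_
          have := hT v
          simp [hv] at this
        subst this
        simpa using h0.symm
      · rfl
    · obtain ⟨v, hv⟩ : ∃ v, b v ≠ 0 := by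
        by_contra! h
        exact hb0 (Finsupp.ext h)
      refine ⟨khtpy v (multiPart b c), ?_, fun T hT => ?_⟩
      · have := koszul_khtpy v (multiPart b c)
        rwa [hb, khtpy_zero, add_zero] at this
      · simp only [khtpy, multiPart] at hT
        split_ifs at hT with h1 h2
        · refine ⟨b - ind T, trivial, tsub_add_cancel_of_le fun w => ?_⟩
          have h3 := h2 w
          by_cases hw : w = v
          · subst hw
            rw [ind_apply, if_pos h1]
            omega
          · simpa [hw] using h3
        · simp at hT
        · simp at hT

lemma KLin.exists_koszul_eq {d : ℕ} {J : Set (Fin n →₀ ℕ)} (h : KLin K d J) {e : ℕ} (he : d < e)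
    {c : Finset (Fin n) → SRing K n} (hcJ : ∀ T a, coeff a (c T) ≠ 0 → a ∈ J ∧ mdeg a = e)
    (hc : koszul (X : Fin n → SRing K n) c = 0) :
    ∃ q, koszul (X : Fin n → SRing K n) q = c ∧ ∀ T a, coeff a (q T) ≠ 0 → a ∈ J := by
  refine _root_.exists_koszul_eq c fun b => ?_
  have hs : KSupp J b e (multiPart b c) := fun T hT => by
    rw [multiPart] at hT
    split_ifs at hT with hTb
    · exact ⟨b - ind T, (hcJ T _ hT).1, (hcJ T _ hT).2, tsub_add_cancel_of_le hTb⟩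
    · exact absurd rfl hT
  have h0 : koszul (1 : Fin n → K) (multiPart b c) = 0 := by
    rw [← multiPart_koszul, hc]
    funext T
    simp [multiPart]
  obtain ⟨ψ, hψ, hψJ⟩ := h b e he _ hs h0
  exact ⟨ψ, hψ, fun T hT => (hψJ T hT).imp fun _ h => ⟨h.1, h.2.2⟩⟩

end Extract

/-! ### Graded modules and linear resolutions -/

/-- An `ℕ`-grading of a module over the standard graded polynomial ring, given by its
projections onto homogeneous components. -/
structure Grading (K : Type) [Field K] (n : ℕ) (N : Type) [AddCommGroup N]
    [Module (SRing K n) N] where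
  comp : ℕ → N →+ N
  comp_comp : ∀ i j x, comp i (comp j x) = if i = j then comp j x else 0
  comp_C : ∀ e a x, comp e ((C a : SRing K n) • x) = (C a : SRing K n) • comp e x
  comp_X : ∀ e v x, comp (e + 1) ((X v : SRing K n) • x) = (X v : SRing K n) • comp e x
  comp_X_zero : ∀ v x, comp 0 ((X v : SRing K n) • x) = 0
  exists_sum : ∀ x, ∃ B, ∑ e ∈ Finset.range B, comp e x = x

section Poly

variable {K : Type} [Field K] {n : ℕ}

lemma coeff_homogeneousComponent' (e : ℕ) (p : SRing K n) (a : Fin n →₀ ℕ) :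
    coeff a (homogeneousComponent e p) = if mdeg a = e then coeff a p else 0 := by
  rw [coeff_homogeneousComponent, Finsupp.degree_eq_sum, mdeg_eq]

lemma homogeneousComponent_comp (i j : ℕ) (p : SRing K n) :
    homogeneousComponent i (homogeneousComponent j p) =
      if i = j then homogeneousComponent j p else 0 := by
  ext a
  split_ifs with h <;> simp only [coeff_homogeneousComponent'] <;> grind [coeff_zero]

lemma homogeneousComponent_X_mul (e : ℕ) (v : Fin n) (p : SRing K n) :
    homogeneousComponent (e + 1) (X v * p) = X v * homogeneousComponent e p := by
  ext a
  simp only [coeff_homogeneousComponent', coeff_X_mul']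
  split_ifs with h1 h2 h3 h4 <;> try rfl
  all_goals
    have := tsub_add_cancel_of_le (single_one_le (Nat.pos_of_ne_zero (Finsupp.mem_support_iff.1 ‹_›)))
    rw [← this, mdeg_add, mdeg_single] at h1
    omega

lemma homogeneousComponent_zero_X_mul (v : Fin n) (p : SRing K n) :
    homogeneousComponent 0 (X v * p) = 0 := by
  ext a
  simp only [coeff_homogeneousComponent', coeff_X_mul', coeff_zero]
  split_ifs with h1 h2 <;> try rfl
  have := tsub_add_cancel_of_le (single_one_le (Nat.pos_of_ne_zero (Finsupp.mem_support_iff.1 h2)))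
  rw [← this, mdeg_add, mdeg_single] at h1
  omega

lemma exists_sum_homogeneousComponent (p : SRing K n) :
    ∃ B, ∀ B', B ≤ B' → ∑ e ∈ Finset.range B', homogeneousComponent e p = p := by
  refine ⟨p.support.sup mdeg + 1, fun B' h => ?_⟩
  ext a
  simp only [coeff_sum, coeff_homogeneousComponent', Finset.sum_ite_eq, Finset.mem_range]
  split_ifs with ha
  · rfl
  · by_contra hne
    have := Finset.le_sup (f := mdeg) (mem_support_iff.2 (Ne.symm hne))
    omega

variable (K n) in
/-- The standard grading of the polynomial ring. -/
def stdGrading : Grading K n (SRing K n) where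
  comp e := (homogeneousComponent e).toAddMonoidHom
  comp_comp := homogeneousComponent_comp
  comp_C e a p := by simp [homogeneousComponent_C_mul]
  comp_X e v p := homogeneousComponent_X_mul e v p
  comp_X_zero v p := homogeneousComponent_zero_X_mul v p
  exists_sum p := (exists_sum_homogeneousComponent p).imp fun _ h => h _ le_rfl

lemma stdGrading_comp (e : ℕ) (p : SRing K n) :
    (stdGrading K n).comp e p = homogeneousComponent e p := rfl

variable {s : ℕ} (dg : Fin s → ℕ)

variable (K n) in
/-- The grading of a free module with a basis in the given degrees. -/
def freeGrading : Grading K n (Fin s →₀ SRing K n) where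
  comp e :=
    { toFun := fun f => Finsupp.equivFunOnFinite.symm fun k =>
        if dg k ≤ e then homogeneousComponent (e - dg k) (f k) else 0
      map_zero' := by ext; simp
      map_add' := fun f g => by
        ext1 k
        simp only [Finsupp.equivFunOnFinite_symm_apply_apply, Finsupp.add_apply, map_add]
        split_ifs <;> simp }
  comp_comp i j f := by
    ext1 k
    split_ifs with h
    · subst h
      simp only [AddMonoidHom.coe_mk, ZeroHom.coe_mk, Finsupp.equivFunOnFinite_symm_apply_apply]
      split_ifs with h'
      · rw [homogeneousComponent_comp, if_pos rfl]
      · rfl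
    · simp only [AddMonoidHom.coe_mk, ZeroHom.coe_mk, Finsupp.equivFunOnFinite_symm_apply_apply]
      split_ifs with h1 h2
      · rw [homogeneousComponent_comp, if_neg (by omega)]; rfl
      · rw [map_zero]; rfl
      · rfl
  comp_C e a f := by
    ext1 k
    simp [homogeneousComponent_C_mul]
  comp_X e v f := by
    ext1 k
    simp only [AddMonoidHom.coe_mk, ZeroHom.coe_mk, Finsupp.equivFunOnFinite_symm_apply_apply,
      Finsupp.smul_apply, smul_eq_mul]
    split_ifs with h1 h2 h2
    · rw [Nat.sub_add_comm h2, homogeneousComponent_X_mul]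
    · rw [show e + 1 - dg k = 0 by omega, homogeneousComponent_zero_X_mul, mul_zero]
    · omega
    · rw [mul_zero]
  comp_X_zero v f := by
    ext1 k
    simp only [AddMonoidHom.coe_mk, ZeroHom.coe_mk, Finsupp.equivFunOnFinite_symm_apply_apply,
      Finsupp.smul_apply, smul_eq_mul]
    split_ifs with h1
    · rw [Nat.zero_sub, homogeneousComponent_zero_X_mul]; rfl
    · rfl
  exists_sum f := by
    choose B hB using fun k => exists_sum_homogeneousComponent (f k)
    refine ⟨Finset.univ.sup fun k => dg k + B k, ?_⟩
    ext1 k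
    have hk : dg k + B k ≤ Finset.univ.sup fun k => dg k + B k :=
      Finset.le_sup (f := fun k => dg k + B k) (Finset.mem_univ k)
    obtain ⟨m, hm⟩ := Nat.exists_eq_add_of_le (le_of_add_le_left hk)
    simp only [AddMonoidHom.coe_mk, ZeroHom.coe_mk, Finsupp.finsetSum_apply,
      Finsupp.equivFunOnFinite_symm_apply_apply]
    rw [hm, Finset.sum_range_add, Finset.sum_eq_zero, zero_add]
    · simp only [le_add_iff_nonneg_right, zero_le, if_true, add_tsub_cancel_left]
      exact hB k m (by omega)
    · intro e he
      rw [if_neg]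
      simpa using he

lemma freeGrading_comp_apply (e : ℕ) (f : Fin s →₀ SRing K n) (k : Fin s) :
    (freeGrading K n dg).comp e f k =
      if dg k ≤ e then homogeneousComponent (e - dg k) (f k) else 0 := rfl

lemma freeGrading_comp_single (k : Fin s) :
    (freeGrading K n dg).comp (dg k) (Finsupp.single k 1) = Finsupp.single k 1 := by
  ext1 l
  rw [freeGrading_comp_apply]
  by_cases h : k = l
  · subst h
    simp [homogeneousComponent_zero]
  · simp [Finsupp.single_eq_of_ne' h]

lemma coeff_zero_of_freeGrading {e : ℕ} {f : Fin s →₀ SRing K n}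
    (hf : (freeGrading K n dg).comp e f = f) {k : Fin s} (hk : dg k ≠ e) :
    coeff 0 (f k) = 0 := by
  rw [← hf, freeGrading_comp_apply]
  split_ifs with h
  · rw [coeff_homogeneousComponent', if_neg]
    simp [mdeg_eq]
    omega
  · exact coeff_zero _

/-- Exactness of the Koszul complex of a free module outside the constants. -/
lemma exists_koszul_eq_of_free {c : Finset (Fin n) → Fin s →₀ SRing K n}
    (hc : koszul (X : Fin n → SRing K n) c = 0) (h0 : ∀ k, coeff 0 (c ∅ k) = 0) :
    ∃ q, koszul (X : Fin n → SRing K n) q = c := by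
  have h : ∀ k, ∃ q, koszul (X : Fin n → SRing K n) q = fun T => c T k := fun k => by
    refine exists_koszul_eq_of_coeff_zero ?_ (h0 k)
    have := koszul_map X (Finsupp.lapply (R := SRing K n) k) c
    rw [hc] at this
    exact this.trans (by funext T; simp)
  choose q hq using h
  refine ⟨fun T => Finsupp.equivFunOnFinite.symm fun k => q k T, ?_⟩
  funext T
  ext1 k
  have := koszul_map X (Finsupp.lapply (R := SRing K n) k)
    (fun T => Finsupp.equivFunOnFinite.symm fun k => q k T)
  refine (congr_fun this T).symm.trans ?_
  exact congr_fun (hq k) T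

variable {N : Type} [AddCommGroup N] [Module (SRing K n) N] (gr : Grading K n N)

namespace Grading

lemma comp_koszul (e : ℕ) (c : Finset (Fin n) → N) (T : Finset (Fin n)) :
    gr.comp (e + 1) (koszul (X : Fin n → SRing K n) c T) =
      koszul (X : Fin n → SRing K n) (fun T => gr.comp e (c T)) T := by
  simp only [koszul_apply, map_sum, map_zsmul, gr.comp_X]

lemma comp_self (e : ℕ) (x : N) : gr.comp e (gr.comp e x) = gr.comp e x := by
  rw [gr.comp_comp, if_pos rfl]

variable {dg} {φ : (Fin s →₀ SRing K n) →ₗ[SRing K n] N}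

lemma comp_map (hφ : ∀ k, gr.comp (dg k) (φ (Finsupp.single k 1)) = φ (Finsupp.single k 1))
    (e : ℕ) (f : Fin s →₀ SRing K n) :
    gr.comp e (φ f) = φ ((freeGrading K n dg).comp e f) := by
  induction f using Finsupp.induction_linear with
  | zero => simp
  | add f g hf hg => simp [hf, hg]
  | single k p =>
    induction p using MvPolynomial.induction_on generalizing e with
    | C a =>
      rw [show Finsupp.single k (C a : SRing K n) = (C a : SRing K n) • Finsupp.single k 1 by simp,
        map_smul, gr.comp_C, Grading.comp_C, map_smul, ← hφ k, gr.comp_comp,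
        ← freeGrading_comp_single dg k, Grading.comp_comp]
      split_ifs with h
      · rw [freeGrading_comp_single, hφ]
      · rw [map_zero]
    | add p q hp hq => simp [Finsupp.single_add, hp, hq]
    | mul_X p v h =>
      rw [show Finsupp.single k (p * X v : SRing K n) = (X v : SRing K n) • Finsupp.single k p by
        simp [mul_comm], map_smul]
      cases e with
      | zero => rw [gr.comp_X_zero, Grading.comp_X_zero, map_zero]
      | succ e => rw [gr.comp_X, Grading.comp_X, map_smul, h]

lemma comp_mem_ker (hφ : ∀ k, gr.comp (dg k) (φ (Finsupp.single k 1)) = φ (Finsupp.single k 1))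
    (e : ℕ) {f : Fin s →₀ SRing K n} (hf : f ∈ LinearMap.ker φ) :
    (freeGrading K n dg).comp e f ∈ LinearMap.ker φ := by
  rw [LinearMap.mem_ker, ← gr.comp_map hφ, LinearMap.mem_ker.1 hf, map_zero]

lemma exists_lift (hφ : ∀ k, gr.comp (dg k) (φ (Finsupp.single k 1)) = φ (Finsupp.single k 1))
    {e : ℕ} {x : N} (hx : x ∈ LinearMap.range φ) (hxe : gr.comp e x = x) :
    ∃ f, φ f = x ∧ (freeGrading K n dg).comp e f = f := by
  obtain ⟨f, rfl⟩ := hx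
  exact ⟨(freeGrading K n dg).comp e f, by rw [← gr.comp_map hφ, hxe], Grading.comp_self _ _ _⟩

/-- The graded submodule `M` has regularity at most `d`, expressed by the vanishing of the
homology of its Koszul complex. -/
def Lin (M : Submodule (SRing K n) N) (d : ℕ) : Prop :=
  ∀ e, d < e → ∀ c : Finset (Fin n) → N, (∀ T, c T ∈ M) → (∀ T, gr.comp e (c T) = c T) →
    koszul (X : Fin n → SRing K n) c = 0 →
    ∃ q, koszul (X : Fin n → SRing K n) q = c ∧ ∀ T, q T ∈ M

variable {gr} {M : Submodule (SRing K n) N} {d : ℕ}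

lemma Lin.exists_homogeneous (h : gr.Lin M d) (hM : ∀ e, ∀ x ∈ M, gr.comp e x ∈ M) {e : ℕ}
    (he : d < e + 1) {c : Finset (Fin n) → N} (hcM : ∀ T, c T ∈ M)
    (hce : ∀ T, gr.comp (e + 1) (c T) = c T) (hc : koszul (X : Fin n → SRing K n) c = 0) :
    ∃ q, koszul (X : Fin n → SRing K n) q = c ∧ ∀ T, q T ∈ M ∧ gr.comp e (q T) = q T := by
  obtain ⟨q, hq, hqM⟩ := h _ he c hcM hce hc
  refine ⟨fun T => gr.comp e (q T), ?_, fun T => ⟨hM _ _ (hqM T), gr.comp_self _ _⟩⟩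
  funext T
  rw [← comp_koszul, hq, hce]

lemma koszul_single_empty (x : N) :
    koszul (X : Fin n → SRing K n) (Pi.single ∅ x : Finset (Fin n) → N) = 0 := by
  funext T
  rw [koszul_apply]
  refine Finset.sum_eq_zero fun v _ => ?_
  rw [Pi.single_eq_of_ne (Finset.insert_ne_empty _ _), smul_zero, smul_zero]

lemma Lin.le_span (h : gr.Lin M d) (hM : ∀ e, ∀ x ∈ M, gr.comp e x ∈ M) :
    M = Submodule.span (SRing K n) {x | x ∈ M ∧ ∃ e ≤ d, gr.comp e x = x} := by
  refine le_antisymm (fun x hx => ?_) (Submodule.span_le.2 fun x hx => hx.1)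
  have key : ∀ e, ∀ x ∈ M, gr.comp e x = x →
      x ∈ Submodule.span (SRing K n) {x | x ∈ M ∧ ∃ e ≤ d, gr.comp e x = x} := by
    intro e
    induction e with
    | zero => exact fun x hx he => Submodule.subset_span ⟨hx, 0, zero_le, he⟩
    | succ e ih =>
      intro x hx he
      by_cases hd : d < e + 1
      · obtain ⟨q, hq, hqM⟩ := h.exists_homogeneous hM hd (c := Pi.single ∅ x)
          (fun T => by by_cases hT : T = ∅ <;> simp [hT, hx])
          (fun T => by by_cases hT : T = ∅ <;> simp [hT, he])
          (koszul_single_empty x)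
        have h1 : koszul (X : Fin n → SRing K n) q ∅ = x := by rw [hq, Pi.single_eq_same]
        rw [← h1]
        exact koszul_apply_mem _ _ (fun T => ih _ (hqM T).1 (hqM T).2) _
      · exact Submodule.subset_span ⟨hx, e + 1, by omega, he⟩
  obtain ⟨B, hB⟩ := gr.exists_sum x
  rw [← hB]
  exact Submodule.sum_mem _ fun e _ => key e _ (hM _ _ hx) (gr.comp_self _ _)

lemma Lin.exists_cover [IsNoetherian (SRing K n) N] (h : gr.Lin M d)
    (hM : ∀ e, ∀ x ∈ M, gr.comp e x ∈ M) :
    ∃ (s : ℕ) (dg : Fin s → ℕ) (φ : (Fin s →₀ SRing K n) →ₗ[SRing K n] N),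
      (∀ k, dg k ≤ d) ∧
      (∀ k, gr.comp (dg k) (φ (Finsupp.single k 1)) = φ (Finsupp.single k 1)) ∧
      LinearMap.range φ = M := by
  have hfg : (Submodule.span (SRing K n) {x | x ∈ M ∧ ∃ e ≤ d, gr.comp e x = x}).FG :=
    IsNoetherian.noetherian _
  obtain ⟨t, htH, ht⟩ := (Submodule.fg_span_iff_fg_span_finset_subset _).1 hfg
  let g := t.equivFin.symm
  choose dg hdg hcomp using fun k => (htH (g k).2).2
  refine ⟨t.card, dg, Finsupp.linearCombination _ fun k => (g k : N), hdg, fun k => ?_, ?_⟩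
  · simpa using hcomp k
  · rw [Finsupp.range_linearCombination, h.le_span hM, ht]
    congr 1
    ext x
    constructor
    · rintro ⟨k, rfl⟩
      exact (g k).2
    · intro hx
      exact ⟨g.symm ⟨x, hx⟩, by simp⟩

lemma Lin.ker (h : gr.Lin (LinearMap.range φ) d)
    (hφ : ∀ k, gr.comp (dg k) (φ (Finsupp.single k 1)) = φ (Finsupp.single k 1))
    (hdg : ∀ k, dg k ≤ d) : (freeGrading K n dg).Lin (LinearMap.ker φ) (d + 1) := by
  intro e he b hbM hbe hb
  obtain ⟨e, rfl⟩ : ∃ e', e = e' + 1 := ⟨e - 1, by omega⟩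
  obtain ⟨c, hc⟩ := exists_koszul_eq_of_free hb fun k =>
    coeff_zero_of_freeGrading dg (hbe ∅) (by have := hdg k; omega)
  let c' := fun T => (freeGrading K n dg).comp e (c T)
  have hc' : koszul (X : Fin n → SRing K n) c' = b := by
    funext T
    rw [← comp_koszul, hc, hbe]
  obtain ⟨a, ha, haM⟩ := h e (by omega) (fun T => φ (c' T)) (fun T => ⟨_, rfl⟩)
    (fun T => by rw [gr.comp_map hφ, Grading.comp_self]) (by
      rw [koszul_map, hc']
      funext T
      exact hbM T)
  choose a' ha' using haM
  refine ⟨c' - koszul (X : Fin n → SRing K n) a', ?_, fun T => ?_⟩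
  · rw [map_sub, hc', koszul_koszul, sub_zero]
  · rw [LinearMap.mem_ker, Pi.sub_apply, map_sub, sub_eq_zero]
    have h1 := congr_fun (koszul_map X φ a') T
    simp only [ha'] at h1
    rw [← h1]
    exact (congr_fun ha T).symm

end Grading

end Poly

section Resolution

variable {K : Type} [Field K] {n : ℕ}

/-- A graded submodule of a graded free module, with regularity at most `d`. -/
structure LinStage (K : Type) [Field K] (n d : ℕ) where
  s : ℕ
  dg : Fin s → ℕ
  M : Submodule (SRing K n) (Fin s →₀ SRing K n)
  comp_mem : ∀ e, ∀ x ∈ M, (freeGrading K n dg).comp e x ∈ M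
  lin : (freeGrading K n dg).Lin M d

lemma Grading.Lin.exists_linStage {N : Type} [AddCommGroup N] [Module (SRing K n) N]
    [IsNoetherian (SRing K n) N] {gr : Grading K n N} {M : Submodule (SRing K n) N} {d : ℕ}
    (h : gr.Lin M d) (hM : ∀ e, ∀ x ∈ M, gr.comp e x ∈ M) :
    ∃ (B : LinStage K n (d + 1)) (φ : (Fin B.s →₀ SRing K n) →ₗ[SRing K n] N),
      (∀ k, B.dg k ≤ d) ∧
      (∀ k, gr.comp (B.dg k) (φ (Finsupp.single k 1)) = φ (Finsupp.single k 1)) ∧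
      LinearMap.range φ = M ∧ LinearMap.ker φ = B.M := by
  obtain ⟨s, dg, φ, hdg, hφ, rfl⟩ := h.exists_cover hM
  exact ⟨⟨s, dg, LinearMap.ker φ, fun e x hx => gr.comp_mem_ker hφ e hx, h.ker hφ hdg⟩, φ, hdg, hφ,
    rfl, rfl⟩

lemma freeGrading_comp_eq_self_iff {s : ℕ} (dg : Fin s → ℕ) (e : ℕ) (f : Fin s →₀ SRing K n) :
    (freeGrading K n dg).comp e f = f ↔
      ∀ k, f k = 0 ∨ ∃ m, (f k).IsHomogeneous m ∧ dg k + m = e := by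
  constructor
  · intro h k
    have hk := DFunLike.congr_fun h k
    rw [freeGrading_comp_apply] at hk
    split_ifs at hk with hle
    · refine Or.inr ⟨e - dg k, ?_, by omega⟩
      rw [← hk]
      exact homogeneousComponent_isHomogeneous _ _
    · exact Or.inl hk.symm
  · intro h
    ext1 k
    rw [freeGrading_comp_apply]
    rcases h k with h0 | ⟨m, hm, rfl⟩
    · simp [h0]
    · rw [if_pos (Nat.le_add_right _ _), add_tsub_cancel_left, homogeneousComponent_of_mem hm,
        if_pos rfl]

lemma stdGrading_comp_eq_self_iff (e : ℕ) (p : SRing K n) :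
    (stdGrading K n).comp e p = p ↔ p.IsHomogeneous e := by
  constructor
  · intro h
    rw [← h]
    exact homogeneousComponent_isHomogeneous _ _
  · intro h
    rw [stdGrading_comp, homogeneousComponent_of_mem h, if_pos rfl]

lemma Grading.Lin.exists_gradedPartialRes {I : Ideal (SRing K n)} {d : ℕ}
    (h : (stdGrading K n).Lin I d) (hI : ∀ e, ∀ x ∈ I, (stdGrading K n).comp e x ∈ I) :
    ∃ R : GradedPartialRes I ⊤, ∀ i k, R.dg i k ≤ d + i := by
  obtain ⟨A, aug, hA, haug, hrange, hker⟩ := h.exists_linStage hI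
  choose next φ hdg hφ hφr hφk using fun (m : ℕ) (B : LinStage K n m) =>
    B.lin.exists_linStage B.comp_mem
  let stage : (i : ℕ) → LinStage K n (d + 1 + i) := fun i =>
    Nat.rec (motive := fun i => LinStage K n (d + 1 + i)) A (fun i B => next (d + 1 + i) B) i
  refine ⟨{
    s := fun i => (stage i).s
    dg := fun i => (stage i).dg
    aug := aug
    diff := fun i => φ _ (stage i)
    aug_hom := fun k => (stdGrading_comp_eq_self_iff _ _).1 (haug k)
    diff_hom := fun i k => (freeGrading_comp_eq_self_iff _ _ _).1 (hφ _ (stage i) k)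
    aug_range := hrange
    exact_zero := fun _ => (hφr _ (stage 0)).trans hker.symm
    exact_succ := fun i _ => (hφr _ (stage (i + 1))).trans (hφk _ (stage i)).symm }, ?_⟩
  rintro (_ | i) k
  · exact hA k
  · exact (hdg _ (stage i) k).trans (by omega)

/-- Forgetting exactness in high homological positions. -/
def GradedPartialRes.restrict {I : Ideal (SRing K n)} (R : GradedPartialRes I ⊤) (r : ℕ∞)
    (hr : r ≠ ⊤) : GradedPartialRes I r where
  s := R.s
  dg := R.dg
  aug := R.aug
  diff := R.diff
  aug_hom := R.aug_hom
  diff_hom := R.diff_hom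
  aug_range := R.aug_range
  exact_zero h := R.exact_zero (h.trans (lt_top_iff_ne_top.2 hr))
  exact_succ i h := R.exact_succ i (h.trans (lt_top_iff_ne_top.2 hr))

lemma gradedBetti_eq_zero_iff (I : Ideal (SRing K n)) (i j : ℕ) :
    gradedBetti I i j = 0 ↔ ∃ R : GradedPartialRes I ((i : ℕ∞) + 1), ∀ k, R.dg i k ≠ j := by
  rw [gradedBetti, ENat.iInf_eq_zero]
  simp [Finset.filter_eq_empty_iff]

lemma le_idealIndex {I : Ideal (SRing K n)} {d r : ℕ} (h : stepsLinear I d r) :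
    (r : ℕ∞) + 1 ≤ idealIndex I d := le_sSup ⟨r, rfl, h⟩

lemma idealIndex_eq_top {I : Ideal (SRing K n)} {d : ℕ} (h : ∀ r, stepsLinear I d r) :
    idealIndex I d = ⊤ := by
  refine ENat.eq_top_iff_forall_ge.2 fun m => ?_
  exact le_self_add.trans (le_idealIndex (h m))

lemma Grading.Lin.idealIndex_eq_top {I : Ideal (SRing K n)} {d : ℕ}
    (h : (stdGrading K n).Lin I d) (hI : ∀ e, ∀ x ∈ I, (stdGrading K n).comp e x ∈ I) :
    idealIndex I d = ⊤ := by
  obtain ⟨R, hR⟩ := h.exists_gradedPartialRes hI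
  refine _root_.idealIndex_eq_top fun r i _ j hj => (gradedBetti_eq_zero_iff _ _ _).2
    ⟨R.restrict _ (by exact_mod_cast ENat.natCast_ne_top (i + 1)), fun k hk => ?_⟩
  have := hR i k
  have h' : R.dg i k = i + j := hk
  omega

variable {J : Set (Fin n →₀ ℕ)} {hJ : IsUpperSet J}

lemma coeff_of_stdGrading {e : ℕ} {p : SRing K n} (hp : (stdGrading K n).comp e p = p)
    {a : Fin n →₀ ℕ} (ha : coeff a p ≠ 0) : mdeg a = e := by
  rw [← hp, stdGrading_comp, coeff_homogeneousComponent'] at ha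
  by_contra h
  exact ha (if_neg h)

lemma comp_mem_restrictSupportIdeal (e : ℕ) (p : SRing K n)
    (hp : p ∈ restrictSupportIdeal K J hJ) :
    (stdGrading K n).comp e p ∈ restrictSupportIdeal K J hJ := by
  rw [mem_restrictSupportIdeal] at hp ⊢
  intro a ha
  rw [stdGrading_comp, coeff_homogeneousComponent'] at ha
  split_ifs at ha with h
  · exact hp a ha
  · exact absurd rfl ha

/-- A monomial ideal of regularity at most `d` has infinite index with respect to `d`. -/
lemma KLin.idealIndex_eq_top {d : ℕ} (h : KLin K d J) :
    idealIndex (restrictSupportIdeal K J hJ) d = ⊤ := by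
  refine Grading.Lin.idealIndex_eq_top (fun e he c hcM hce hc => ?_)
    comp_mem_restrictSupportIdeal
  obtain ⟨q, hq, hqJ⟩ := h.exists_koszul_eq he
    (fun T a ha => ⟨mem_restrictSupportIdeal.1 (hcM T) a ha, coeff_of_stdGrading (hce T) ha⟩) hc
  exact ⟨q, hq, fun T => mem_restrictSupportIdeal.2 (hqJ T)⟩

end Resolution

section Betti

variable {K : Type} [Field K] {n : ℕ} {N : Type} [AddCommGroup N] [Module (SRing K n) N]
  (gr : Grading K n N)

namespace Grading

/-- The Koszul homology of `M` vanishes in homological degree `m` and internal degree `e + m`. -/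
def Bdry (M : Submodule (SRing K n) N) (m e : ℕ) : Prop :=
  ∀ c : Finset (Fin n) → N, (∀ T, c T ∈ M) → (∀ T, gr.comp e (c T) = c T) →
    (∀ T, c T ≠ 0 → T.card = m) → koszul (X : Fin n → SRing K n) c = 0 →
    ∃ q, koszul (X : Fin n → SRing K n) q = c ∧ ∀ T, q T ∈ M

variable {gr} {s : ℕ} {dg : Fin s → ℕ} {φ : (Fin s →₀ SRing K n) →ₗ[SRing K n] N}

lemma bdry_zero (hφ : ∀ k, gr.comp (dg k) (φ (Finsupp.single k 1)) = φ (Finsupp.single k 1))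
    {t : ℕ} (ht : ∀ k, dg k ≠ t) : gr.Bdry (LinearMap.range φ) 0 t := by
  intro c hcM hce hc0 _
  obtain ⟨f, hf, hft⟩ := gr.exists_lift hφ (hcM ∅) (hce ∅)
  obtain ⟨q, hq⟩ := exists_koszul_eq_of_free (koszul_single_empty f) fun k => by
    rw [Pi.single_eq_same]
    exact coeff_zero_of_freeGrading dg hft (ht k)
  refine ⟨fun T => φ (q T), ?_, fun T => ⟨_, rfl⟩⟩
  rw [koszul_map, hq]
  funext T
  by_cases hT : T = ∅
  · subst hT
    rw [Pi.single_eq_same, hf]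
  · rw [Pi.single_eq_of_ne hT, map_zero]
    by_contra hne
    exact hT (Finset.card_eq_zero.1 (hc0 T (Ne.symm hne)))

lemma Bdry.range (hφ : ∀ k, gr.comp (dg k) (φ (Finsupp.single k 1)) = φ (Finsupp.single k 1))
    {m e : ℕ} (h : (freeGrading K n dg).Bdry (LinearMap.ker φ) m (e + 1)) :
    gr.Bdry (LinearMap.range φ) (m + 1) e := by
  classical
  intro c hcM hce hcm hc
  have hlift : ∀ T, ∃ f, φ f = c T ∧ (freeGrading K n dg).comp e f = f ∧ (c T = 0 → f = 0) := by
    intro T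
    by_cases h0 : c T = 0
    · exact ⟨0, by simp [h0], by simp, fun _ => rfl⟩
    · obtain ⟨f, hf, hfe⟩ := gr.exists_lift hφ (hcM T) (hce T)
      exact ⟨f, hf, hfe, fun h => absurd h h0⟩
  choose b hb hbe hb0 using hlift
  obtain ⟨q, hq, hqM⟩ := h (koszul (X : Fin n → SRing K n) b)
    (fun T => by
      rw [LinearMap.mem_ker, ← congr_fun (koszul_map X φ b) T]
      simp only [hb, hc, Pi.zero_apply])
    (fun T => by rw [comp_koszul]; simp only [hbe])
    (fun T hT => by
      rw [koszul_apply] at hT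
      obtain ⟨v, hv, hne⟩ := Finset.exists_ne_zero_of_sum_ne_zero hT
      have hbv : b (insert v T) ≠ 0 := fun h0 => hne (by rw [h0, smul_zero, smul_zero])
      have := hcm (insert v T) fun h0 => hbv (hb0 _ h0)
      rw [Finset.card_insert_of_notMem (Finset.mem_compl.1 hv)] at this
      omega)
    (koszul_koszul _ _)
  let q' := Function.update q ∅ 0
  have hq' : koszul (X : Fin n → SRing K n) q' = koszul (X : Fin n → SRing K n) b := by
    rw [← hq]
    funext T
    simp only [koszul_apply]
    refine Finset.sum_congr rfl fun v _ => ?_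
    simp only [q', Function.update_of_ne (Finset.insert_ne_empty _ _)]
  have hq'M : ∀ T, φ (q' T) = 0 := fun T => by
    by_cases hT : T = ∅
    · subst hT
      simp only [q', Function.update_self, map_zero]
    · simp only [q', Function.update_of_ne hT]
      exact hqM T
  have hb_empty : b ∅ = 0 := hb0 _ (by
    by_contra hne
    have := hcm _ hne
    simp at this)
  obtain ⟨p, hp⟩ := exists_koszul_eq_of_free (c := b - q') (by rw [map_sub, hq', sub_self])
    fun k => by simp [q', hb_empty]
  refine ⟨fun T => φ (p T), ?_, fun T => ⟨_, rfl⟩⟩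
  rw [koszul_map, hp]
  funext T
  rw [Pi.sub_apply, map_sub, hq'M, sub_zero, hb]

end Grading

lemma GradedPartialRes.bdry {I : Ideal (SRing K n)} {r : ℕ∞} (R : GradedPartialRes I r) {i e : ℕ}
    (hr : (i : ℕ∞) < r) (hR : ∀ k, R.dg i k ≠ i + e) : (stdGrading K n).Bdry I i e := by
  have hdiff := fun j k => (freeGrading_comp_eq_self_iff _ _ _).2 (R.diff_hom j k)
  have haug := fun k => (stdGrading_comp_eq_self_iff _ _).2 (R.aug_hom k)
  have key : ∀ m j, j + 1 + m = i →
      (freeGrading K n (R.dg j)).Bdry (LinearMap.range (R.diff j)) m (e + j + 1) := by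
    intro m
    induction m with
    | zero =>
      rintro j rfl
      exact Grading.bdry_zero (hdiff j) fun k hk => hR k (by rw [hk]; omega)
    | succ m ih =>
      intro j hj
      refine Grading.Bdry.range (hdiff j) ?_
      rw [← R.exact_succ j (lt_of_le_of_lt (by exact_mod_cast (by omega : j + 1 ≤ i)) hr)]
      exact ih (j + 1) (by omega)
  rw [← R.aug_range]
  cases i with
  | zero => exact Grading.bdry_zero haug fun k hk => hR k (by rw [hk]; omega)
  | succ i =>
    refine Grading.Bdry.range haug ?_
    rw [← R.exact_zero (lt_of_le_of_lt zero_le hr)]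
    exact key i 0 (by omega)

lemma bdry_of_gradedBetti {I : Ideal (SRing K n)} {i e : ℕ} (h : gradedBetti I i (i + e) = 0) :
    (stdGrading K n).Bdry I i e := by
  obtain ⟨R, hR⟩ := (gradedBetti_eq_zero_iff _ _ _).1 h
  exact R.bdry (by exact_mod_cast Nat.lt_succ_self i) hR

end Betti

section NonBoundary

variable {K : Type} [Field K] {n l : ℕ} {G : SimpleGraph (Fin n)} {f : ZMod l → Fin n}
  {W : Finset (Fin n)}

/-- The exponent vector of the `i`-th edge of the cycle `f`. -/
def cycleEdge (f : ZMod l → Fin n) (i : ZMod l) : Fin n →₀ ℕ :=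
  Finsupp.single (f i) 1 + Finsupp.single (f (i + 1)) 1

/-- The set `W` without the `i`-th edge of the cycle `f`. -/
def edgeCompl (W : Finset (Fin n)) (f : ZMod l → Fin n) (i : ZMod l) : Finset (Fin n) :=
  (W.erase (f i)).erase (f (i + 1))

lemma IsInducedCycle.apply_add_one_ne (hf : IsInducedCycle Gᶜ f) (i : ZMod l) :
    f (i + 1) ≠ f i :=
  (((hf.2 i (i + 1)).2 (Or.inl rfl)).ne).symm

lemma insert_edgeCompl (hf : IsInducedCycle Gᶜ f) (hW : ∀ i, f i ∈ W) (i : ZMod l) :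
    insert (f (i + 1)) (edgeCompl W f i) = W.erase (f i) :=
  Finset.insert_erase (Finset.mem_erase.2 ⟨hf.apply_add_one_ne i, hW _⟩)

lemma insert_edgeCompl' (hf : IsInducedCycle Gᶜ f) (hW : ∀ i, f i ∈ W) (i : ZMod l) :
    insert (f i) (edgeCompl W f i) = W.erase (f (i + 1)) := by
  rw [edgeCompl, Finset.erase_right_comm]
  exact Finset.insert_erase (Finset.mem_erase.2 ⟨(hf.apply_add_one_ne i).symm, hW _⟩)

lemma notMem_edgeCompl (i : ZMod l) : f i ∉ edgeCompl W f i := by simp [edgeCompl]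

lemma notMem_edgeCompl' (i : ZMod l) : f (i + 1) ∉ edgeCompl W f i := by simp [edgeCompl]

lemma mem_of_notMem_edgeCompl {i : ZMod l} {v : Fin n} (hv : v ∈ W) (h : v ∉ edgeCompl W f i) :
    v = f i ∨ v = f (i + 1) := by
  by_contra! hne
  exact h (by simp [edgeCompl, hv, hne])

lemma cycleEdge_add_ind (hf : IsInducedCycle Gᶜ f) (hW : ∀ i, f i ∈ W) (i : ZMod l) :
    cycleEdge f i + ind (edgeCompl W f i) = ind W := by
  rw [cycleEdge, add_assoc, ← ind_insert (notMem_edgeCompl' i), insert_edgeCompl hf hW,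
    ← ind_insert (Finset.notMem_erase _ _), Finset.insert_erase (hW i)]

lemma cycleEdge_notMem (hf : IsInducedCycle Gᶜ f) (i : ZMod l) :
    cycleEdge f i ∉ edgeExp G.Adj := by
  rw [mem_edgeExp_iff fun _ => G.loopless.irrefl _]
  rintro ⟨p, q, hpq, hp, hq⟩
  have key : ∀ v, 0 < cycleEdge f i v → v = f i ∨ v = f (i + 1) := fun v hv => by
    by_contra! hne
    simp [cycleEdge, hne.1.symm, hne.2.symm] at hv
  have h := ((hf.2 i (i + 1)).2 (Or.inl rfl))
  rw [SimpleGraph.compl_adj] at h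
  rcases key p hp with rfl | rfl <;> rcases key q hq with rfl | rfl
  · exact hpq.ne rfl
  · exact h.2 hpq
  · exact h.2 hpq.symm
  · exact hpq.ne rfl

lemma edgeCompl_ne (hf : IsInducedCycle Gᶜ f) (hl : 4 ≤ l) (hW : ∀ i, f i ∈ W) {i j : ZMod l}
    (hij : i ≠ j) : edgeCompl W f i ≠ edgeCompl W f j := by
  intro h
  have h2 : (2 : ZMod l) ≠ 0 := by
    simpa using ZMod.natCast_ne_zero_of_lt (l := l) (c := 2) (by omega) (by omega)
  have h1 := mem_of_notMem_edgeCompl (hW i) (h ▸ notMem_edgeCompl i)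
  have h1' := mem_of_notMem_edgeCompl (hW (i + 1)) (h ▸ notMem_edgeCompl' i)
  rcases h1 with h1 | h1
  · exact hij (hf.1 h1)
  rcases h1' with h1' | h1'
  · have e1 := hf.1 h1
    have e2 := hf.1 h1'
    exact h2 (by linear_combination e2 - e1)
  · exact hij (add_right_cancel (hf.1 h1'))

/-- A linear functional on chains which vanishes on boundaries of chains supported in `W`. -/
lemma sum_edgeCompl_eq_zero [NeZero l] (hf : IsInducedCycle Gᶜ f) (hW : ∀ i, f i ∈ W)
    {q : Finset (Fin n) → K} (hq : ∀ T, q T ≠ 0 → T ⊆ W) :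
    ∑ i, (ksgn (f i) (edgeCompl W f i) * ksgn (f (i + 1)) (W.erase (f (i + 1)))) •
      koszul (1 : Fin n → K) q (edgeCompl W f i) = 0 := by
  let g : ZMod l → K := fun i => ksgn (f i) (W.erase (f i)) • q (W.erase (f i))
  have key : ∀ i, (ksgn (f i) (edgeCompl W f i) * ksgn (f (i + 1)) (W.erase (f (i + 1)))) •
      koszul (1 : Fin n → K) q (edgeCompl W f i) = g (i + 1) - g i := by
    intro i
    have h1 : koszul (1 : Fin n → K) q (edgeCompl W f i) =
        ksgn (f i) (edgeCompl W f i) • q (W.erase (f (i + 1))) +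
        ksgn (f (i + 1)) (edgeCompl W f i) • q (W.erase (f i)) := by
      rw [koszul_apply, Finset.sum_eq_add_of_mem (f i) (f (i + 1))
        (Finset.mem_compl.2 (notMem_edgeCompl i)) (Finset.mem_compl.2 (notMem_edgeCompl' i))
        (hf.apply_add_one_ne i).symm]
      · simp only [insert_edgeCompl hf hW, insert_edgeCompl' hf hW, Pi.one_apply, one_smul]
      · rintro v hv ⟨hv1, hv2⟩
        have : q (insert v (edgeCompl W f i)) = 0 := by
          by_contra hne
          have hvW := hq _ hne (Finset.mem_insert_self _ _)
          rcases mem_of_notMem_edgeCompl hvW (Finset.mem_compl.1 hv) with h | h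
          exacts [hv1 h, hv2 h]
        rw [this, smul_zero, smul_zero]
    have h2 := ksgn_anticomm (hf.apply_add_one_ne i).symm (notMem_edgeCompl (W := W) i)
      (notMem_edgeCompl' i)
    rw [insert_edgeCompl hf hW, insert_edgeCompl' hf hW] at h2
    have h3 := ksgn_mul_self (f i) (edgeCompl W f i)
    have h4 := ksgn_mul_self (f (i + 1)) (edgeCompl W f i)
    rw [h1, h2]
    simp only [g, zsmul_eq_mul]
    have h2' := congrArg (Int.cast : ℤ → K) h2
    have h3' := congrArg (Int.cast : ℤ → K) h3
    have h4' := congrArg (Int.cast : ℤ → K) h4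
    push_cast at h2' h3' h4' ⊢
    generalize (ksgn (f i) (edgeCompl W f i) : K) = a at *
    generalize (ksgn (f (i + 1)) (edgeCompl W f i) : K) = b at *
    generalize (ksgn (f i) (W.erase (f i)) : K) = c at *
    generalize (ksgn (f (i + 1)) (W.erase (f (i + 1))) : K) = d at *
    linear_combination (-a * q (W.erase (f (i + 1)))) * h2' +
      d * q (W.erase (f (i + 1))) * h3' - c * q (W.erase (f i)) * h4'
  rw [Finset.sum_congr rfl fun i _ => key i, Finset.sum_sub_distrib]
  exact sub_eq_zero.2 (Equiv.sum_comp (Equiv.addRight (1 : ZMod l)) g)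

/-- An induced cycle of the complement of `G` produces nonlinear syzygies of the edge ideal. -/
lemma not_bdry_of_isInducedCycle (hf : IsInducedCycle Gᶜ f) (hl : 4 ≤ l) (hW : ∀ i, f i ∈ W)
    {i₀ : ZMod l} (hW₀ : ∀ v ∈ edgeCompl W f i₀, G.Adj v (f i₀) ∨ G.Adj v (f (i₀ + 1))) :
    ¬ (stdGrading K n).Bdry (edgeIdeal K G.Adj) (W.card - 3) 3 := by
  classical
  intro hB
  have : NeZero l := ⟨by omega⟩
  rw [edgeIdeal_eq] at hB
  let z : Finset (Fin n) → SRing K n := fun T =>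
    if T = edgeCompl W f i₀ then monomial (cycleEdge f i₀) 1 else 0
  have hz : ∀ T, (stdGrading K n).comp 2 (z T) = z T := fun T => by
    rw [stdGrading_comp_eq_self_iff]
    simp only [z]
    split_ifs
    · refine isHomogeneous_monomial _ ?_
      rw [Finsupp.degree_eq_sum, ← mdeg_eq, cycleEdge, mdeg_add, mdeg_single, mdeg_single]
    · exact isHomogeneous_zero _ _ _
  have hcard : (edgeCompl W f i₀).card = W.card - 2 := by
    rw [edgeCompl, Finset.card_erase_of_mem
      (Finset.mem_erase.2 ⟨hf.apply_add_one_ne i₀, hW _⟩), Finset.card_erase_of_mem (hW _)]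
    omega
  obtain ⟨B, hB, hBI⟩ := hB (koszul (X : Fin n → SRing K n) z)
    (fun T => by
      rw [koszul_apply]
      refine Ideal.sum_mem _ fun v hv => zsmul_mem ?_ _
      simp only [z]
      split_ifs with hT
      · rw [smul_eq_mul, X, monomial_mul, one_mul, mem_restrictSupportIdeal]
        intro a ha
        rw [coeff_monomial] at ha
        split_ifs at ha with h
        · subst h
          rcases hW₀ v (hT ▸ Finset.mem_insert_self _ _) with h | h
          · exact ⟨_, _, h, by rw [cycleEdge, ← add_assoc]; exact le_self_add⟩
          · exact ⟨_, _, h, by rw [cycleEdge, add_left_comm]; exact le_add_self⟩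
        · exact absurd rfl ha
      · rw [smul_zero]
        exact Submodule.zero_mem _)
    (fun T => by rw [Grading.comp_koszul]; simp only [hz])
    (fun T hT => by
      rw [koszul_apply] at hT
      obtain ⟨v, hv, hne⟩ := Finset.exists_ne_zero_of_sum_ne_zero hT
      have hv' : insert v T = edgeCompl W f i₀ := by
        by_contra h
        exact hne (by simp only [z, if_neg h, smul_zero])
      have := congrArg Finset.card hv'
      rw [Finset.card_insert_of_notMem (Finset.mem_compl.1 hv)] at this
      omega)
    (koszul_koszul _ _)
  let y := multiPart (ind W) (z - B)
  have hy : koszul (1 : Fin n → K) y = 0 := by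
    rw [← multiPart_koszul, map_sub, hB, sub_self]
    funext T
    simp [multiPart]
  have hyW : ∀ T, y T ≠ 0 → T ⊆ W := fun T hT v hv => by
    by_contra hvW
    refine hT (if_neg fun h => ?_)
    have := h v
    simp [hv, hvW] at this
  have hq : koszul (1 : Fin n → K) (khtpy (f 0) y) = y := by
    have := koszul_khtpy (f 0) y
    rwa [hy, khtpy_zero, add_zero] at this
  have hqW : ∀ T, khtpy (f 0) y T ≠ 0 → T ⊆ W := fun T hT => by
    simp only [khtpy] at hT
    split_ifs at hT with h
    · have h1 := hyW (T.erase (f 0)) fun h0 => hT (by rw [h0, smul_zero])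
      rw [← Finset.insert_erase h]
      exact Finset.insert_subset (hW 0) h1
    · exact absurd rfl hT
  have hyi : ∀ i, y (edgeCompl W f i) = if i = i₀ then 1 else 0 := fun i => by
    simp only [y]
    rw [← cycleEdge_add_ind hf hW i, multiPart_add_ind, Pi.sub_apply, coeff_sub]
    have h0 : coeff (cycleEdge f i) (B (edgeCompl W f i)) = 0 := by
      by_contra hne
      exact cycleEdge_notMem hf i (mem_restrictSupportIdeal.1 (hBI _) _ hne)
    rw [h0, sub_zero]
    simp only [z]
    split_ifs with h1 h2 h2
    · subst h2; simp
    · exact absurd h1 (edgeCompl_ne hf hl hW h2)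
    · subst h2; exact absurd rfl h1
    · simp
  have hsum := sum_edgeCompl_eq_zero hf hW hqW
  simp only [hq, hyi] at hsum
  rw [Finset.sum_eq_single_of_mem i₀ (Finset.mem_univ _) fun i _ hi => by
    rw [if_neg hi, smul_zero], if_pos rfl, zsmul_one] at hsum
  have h1 := congrArg (Int.cast : ℤ → K) (ksgn_mul_self (f i₀) (edgeCompl W f i₀))
  have h2 := congrArg (Int.cast : ℤ → K)
    (ksgn_mul_self (f (i₀ + 1)) (W.erase (f (i₀ + 1))))
  push_cast at h1 h2 hsum
  rcases mul_eq_zero.1 hsum with h | h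
  · simp [h] at h1
  · simp [h] at h2

end NonBoundary

section Main

variable {K : Type} [Field K] {n l : ℕ} {G : SimpleGraph (Fin n)} {f : ZMod l → Fin n}

lemma IsInducedCycle.adj_of_mem_edgeCompl (hf : IsInducedCycle Gᶜ f) (hl : 4 ≤ l) {i j : ZMod l}
    (hi : j ≠ i) (hi' : j ≠ i + 1) : G.Adj (f j) (f i) ∨ G.Adj (f j) (f (i + 1)) := by
  by_contra! h
  have h3 : (3 : ZMod l) ≠ 0 := by
    simpa using ZMod.natCast_ne_zero_of_lt (l := l) (c := 3) (by omega) (by omega)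
  have e1 := (hf.2 j i).1 ((SimpleGraph.compl_adj _ _ _).2 ⟨hf.1.ne hi, h.1⟩)
  have e2 := (hf.2 j (i + 1)).1 ((SimpleGraph.compl_adj _ _ _).2 ⟨hf.1.ne hi', h.2⟩)
  rcases e1 with e1 | e1
  · rcases e2 with e2 | e2
    · exact hi (add_right_cancel e2).symm
    · exact h3 (by linear_combination -e1 - e2)
  · exact hi' e1

lemma card_image_cycle [NeZero l] (hf : IsInducedCycle Gᶜ f) :
    (Finset.univ.image f).card = l := by
  rw [Finset.card_image_of_injective _ hf.1, Finset.card_univ, ZMod.card]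

/-- An induced cycle of length `l` in the complement of `G` obstructs `l - 3` steps linearity. -/
lemma not_bdry_cycle (hf : IsInducedCycle Gᶜ f) (hl : 4 ≤ l) :
    ¬ (stdGrading K n).Bdry (edgeIdeal K G.Adj) (l - 3) 3 := by
  have : NeZero l := ⟨by omega⟩
  have h := not_bdry_of_isInducedCycle (K := K) (W := Finset.univ.image f) (i₀ := 0) hf hl
    (fun i => Finset.mem_image_of_mem _ (Finset.mem_univ _)) fun v hv => by
      simp only [edgeCompl, Finset.mem_erase] at hv
      obtain ⟨h1, h2, h3⟩ := hv
      obtain ⟨j, -, rfl⟩ := Finset.mem_image.1 h3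
      exact hf.adj_of_mem_edgeCompl hl (fun h => h2 (h ▸ rfl)) (fun h => h1 (h ▸ rfl))
  rwa [card_image_cycle hf] at h

lemma not_bdry_cycle_insert (hf : IsInducedCycle Gᶜ f) (hl : 4 ≤ l) {v : Fin n} {i : ZMod l}
    (hv : v ∉ Set.range f) (hvi : G.Adj v (f i)) :
    ¬ (stdGrading K n).Bdry (edgeIdeal K G.Adj) (l - 2) 3 := by
  have : NeZero l := ⟨by omega⟩
  have h := not_bdry_of_isInducedCycle (K := K) (W := insert v (Finset.univ.image f)) (i₀ := i)
    hf hl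
    (fun i => Finset.mem_insert_of_mem (Finset.mem_image_of_mem _ (Finset.mem_univ _)))
    fun w hw => by
      simp only [edgeCompl, Finset.mem_erase] at hw
      obtain ⟨h1, h2, h3⟩ := hw
      rcases Finset.mem_insert.1 h3 with rfl | h3
      · exact Or.inl hvi
      · obtain ⟨j, -, rfl⟩ := Finset.mem_image.1 h3
        exact hf.adj_of_mem_edgeCompl hl (fun h => h2 (h ▸ rfl)) (fun h => h1 (h ▸ rfl))
  rw [Finset.card_insert_of_notMem (fun h => hv (by simpa using h)), card_image_cycle hf] at h
  rwa [show l + 1 - 3 = l - 2 by omega] at h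

lemma isInducedCycle_four {H : SimpleGraph (Fin n)} {a b c d : Fin n} (hab : H.Adj a b)
    (hbc : H.Adj b c) (hcd : H.Adj c d) (hda : H.Adj d a) (hac : a ≠ c) (hbd : b ≠ d)
    (hac' : ¬ H.Adj a c) (hbd' : ¬ H.Adj b d) :
    IsInducedCycle (l := 4) H (![a, b, c, d] : Fin 4 → Fin n) := by
  have h1 := hab.symm
  have h2 := hbc.symm
  have h3 := hcd.symm
  have h4 := hda.symm
  have h5 : ¬ H.Adj c a := fun h => hac' h.symm
  have h6 : ¬ H.Adj d b := fun h => hbd' h.symm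
  have n1 := hab.ne
  have n2 := hbc.ne
  have n3 := hcd.ne
  have n4 := hda.ne
  have inj : ∀ i j : Fin 4, ![a, b, c, d] i = ![a, b, c, d] j → i = j := by
    intro i j
    fin_cases i <;> fin_cases j <;> simp_all [eq_comm]
  have adj : ∀ i j : Fin 4, H.Adj (![a, b, c, d] i) (![a, b, c, d] j) ↔ j = i + 1 ∨ i = j + 1 := by
    intro i j
    fin_cases i <;> fin_cases j <;> simp_all
  exact ⟨inj, adj⟩

/-- Vertices outside a dominating induced cycle of the complement are isolated. -/
lemma exists_eq_of_adj (hf : IsInducedCycle Gᶜ f) (hl : 4 ≤ l)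
    (h4 : ∀ g : ZMod 4 → Fin n, ¬ IsInducedCycle Gᶜ g)
    (hdom : ∀ v, v ∉ Set.range f → ∀ i, ¬ G.Adj v (f i)) {v w : Fin n} (hvw : G.Adj v w) :
    v ∈ Set.range f := by
  by_contra hv
  have hw : w ∉ Set.range f := by
    rintro ⟨i, rfl⟩
    exact hdom v hv i hvw
  have hc : ∀ u, u ∉ Set.range f → ∀ i, Gᶜ.Adj u (f i) := fun u hu i =>
    (SimpleGraph.compl_adj _ _ _).2 ⟨fun h => hu ⟨i, h.symm⟩, hdom u hu i⟩
  have h1 : (1 : ZMod l) ≠ 0 := by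
    simpa using ZMod.natCast_ne_zero_of_lt (l := l) (c := 1) (by omega) (by omega)
  have h2 : (2 : ZMod l) ≠ 0 := by
    simpa using ZMod.natCast_ne_zero_of_lt (l := l) (c := 2) (by omega) (by omega)
  have h3 : (3 : ZMod l) ≠ 0 := by
    simpa using ZMod.natCast_ne_zero_of_lt (l := l) (c := 3) (by omega) (by omega)
  refine h4 _ (isInducedCycle_four (hc v hv 0) (hc w hw 0).symm (hc w hw 2) (hc v hv 2).symm
    hvw.ne (hf.1.ne h2.symm) (fun h => ((SimpleGraph.compl_adj _ _ _).1 h).2 hvw) fun h => ?_)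
  rcases (hf.2 _ _).1 h with h | h
  · exact h1 (by linear_combination h)
  · exact h3 (by linear_combination -h)

end Main

/-- **Corollary.** If the edge ideal `I` of a simple graph has maximal finite
index `> 1`, i.e. `1 < index(I) = projdim(I) < ∞`, then `I^k` has a linear
resolution for all `k ≥ 2`. -/
theorem stmt11 (K : Type) [Field K] (n : ℕ) (G : SimpleGraph (Fin n))
    (I : Ideal (SRing K n)) (hI : I = edgeIdeal K G.Adj)
    (h1 : 1 < idealIndex I 2) (heq : idealIndex I 2 = projDim I)
    (hfin : projDim I ≠ ⊤) :
    ∀ k : ℕ, 2 ≤ k → idealIndex (I ^ k) (2*k) = ⊤ := by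

  obtain ⟨m, hm, R, hR⟩ : ∃ m : ℕ, projDim I = (m : ℕ∞) ∧
      ∃ R : GradedPartialRes I ⊤, ∀ i : ℕ, m < i → R.s i = 0 :=
    csInf_mem (s := {x : ℕ∞ | ∃ m : ℕ, x = (m : ℕ∞) ∧
      ∃ R : GradedPartialRes I ⊤, ∀ i : ℕ, m < i → R.s i = 0})
      (Set.nonempty_iff_ne_empty.2 fun h => hfin (by rw [projDim, h, sInf_empty]))
  rw [hm] at heq
  rw [heq] at h1
  have hm2 : 1 < m := by exact_mod_cast h1
  have hbdry : ∀ i, i ≠ m → (stdGrading K n).Bdry I i 3 := fun i hi => by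
    rcases lt_or_gt_of_ne hi with hi | hi
    · have hlt : (i : ℕ∞) < idealIndex I 2 := by rw [heq]; exact_mod_cast hi
      obtain ⟨x, ⟨r, rfl, hr⟩, hx⟩ := lt_sSup_iff.1 hlt
      exact bdry_of_gradedBetti (hr i (Nat.lt_succ_iff.1 (by exact_mod_cast hx)) 3 (by omega))
    · refine R.bdry (ENat.natCast_lt_top i) fun k => ?_
      have := k.2
      have := hR i hi
      omega
  subst hI
  have hlen : ∀ {l : ℕ} {f : ZMod l → Fin n}, 4 ≤ l → IsInducedCycle Gᶜ f → l - 3 = m :=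
    fun hl hf => by
      by_contra hne
      exact not_bdry_cycle hf hl (hbdry _ hne)
  obtain ⟨l, f, hl, hf⟩ := exists_isInducedCycle_of_not_kLin (K := K) (G := G) fun h => by
    have := h.idealIndex_eq_top (hJ := isUpperSet_edgeExp _)
    rw [← edgeIdeal_eq, heq] at this
    exact ENat.natCast_ne_top m this
  have hl5 : 5 ≤ l := by have := hlen hl hf; omega
  have : NeZero l := ⟨by omega⟩
  have hiso : ∀ v w, G.Adj v w → v ∈ Set.range f := fun v w hvw =>
    exists_eq_of_adj hf hl
      (fun g hg => by have := hlen le_rfl hg; omega)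
      (fun v hv i hvi => not_bdry_cycle_insert (K := K) hf hl hv hvi
        (hbdry _ (by have := hlen hl hf; omega))) hvw
  intro k hk
  rw [edgeIdeal_pow_eq K hf.1 hl5
    (fun i j hij => by
      obtain ⟨i', rfl⟩ := hiso i j hij
      obtain ⟨j', rfl⟩ := hiso j _ hij.symm
      exact ⟨i', j', rfl, rfl⟩)
    (fun i j => by
      have h := hf.2 i j
      rw [SimpleGraph.compl_adj, hf.1.ne_iff] at h
      have hne : G.Adj (f i) (f j) → i ≠ j := fun h h' => G.loopless.irrefl _ (h' ▸ h)
      have h1 : (1 : ZMod l) ≠ 0 := by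
        simpa using ZMod.natCast_ne_zero_of_lt (l := l) (c := 1) (by omega) (by omega)
      have h2 : i = j → ¬ (j = i + 1 ∨ i = j + 1) := by rintro rfl; simpa using h1
      tauto)]
  exact (KLin.anticyclePow hf.1 hl5 hk).idealIndex_eq_top

end
end

section
/- Let G be a simple graph with edge ideal I and matching number nu(G). Then the squarefree power I^{[nu(G)]} (generated by the products of edges in maximum matchings of G) has linear quotients; in particular it has a linear resolution. -/
open MvPolynomial

noncomputable section

/-- a matching of a simple graph, recorded as a finite set of ordered pairs `(i,j)` with
`i < j`: edges of `G` that are pairwise disjoint -/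
def IsMatching {n : ℕ} (G : SimpleGraph (Fin n)) (M : Finset (Fin n × Fin n)) : Prop :=
  (∀ p ∈ M, G.Adj p.1 p.2 ∧ p.1 < p.2) ∧
  ∀ p ∈ M, ∀ q ∈ M, p ≠ q →
    p.1 ≠ q.1 ∧ p.1 ≠ q.2 ∧ p.2 ≠ q.1 ∧ p.2 ≠ q.2

/-- the matching number `ν(G)` -/
def matchNum {n : ℕ} (G : SimpleGraph (Fin n)) : ℕ :=
  sSup {k | ∃ M, IsMatching G M ∧ M.card = k}

/-- the edge `e` meets the edge `f` (as unordered pairs of vertices) -/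
def meets {n : ℕ} (e f : Fin n × Fin n) : Prop :=
  e.1 = f.1 ∨ e.1 = f.2 ∨ e.2 = f.1 ∨ e.2 = f.2

/-- two (disjoint) edges form a gap in `G`: no edge of `G` meets both -/
def FormsGap {n : ℕ} (G : SimpleGraph (Fin n)) (e e' : Fin n × Fin n) : Prop :=
  ¬ ∃ a b, G.Adj a b ∧ meets (a, b) e ∧ meets (a, b) e'

/-- a restricted matching: a matching one of whose edges forms a gap with
every other edge of the matching -/
def IsRestrictedMatching {n : ℕ} (G : SimpleGraph (Fin n)) (M : Finset (Fin n × Fin n)) : Prop :=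
  IsMatching G M ∧ ∃ e ∈ M, ∀ e' ∈ M, e' ≠ e → FormsGap G e e'

/-- `ν₀(G)`: maximal size of a restricted matching, set to `1` if there is none -/
def resMatchNum {n : ℕ} (G : SimpleGraph (Fin n)) : ℕ :=
  max (sSup {k | ∃ M, IsRestrictedMatching G M ∧ M.card = k}) 1

/-- the `k`-th squarefree power `I(G)^{[k]}`: generated by the products of the
edges of the matchings of `G` of size `k` -/
def sqfreePower (K : Type) [Field K] {n : ℕ} (G : SimpleGraph (Fin n)) (k : ℕ) :
    Ideal (SRing K n) :=
  Ideal.span {p | ∃ M : Finset (Fin n × Fin n), IsMatching G M ∧ M.card = k ∧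
    p = ∏ q ∈ M, (X q.1 * X q.2)}

/-- a monomial ideal has linear quotients: for some ordering `u_1, …, u_t` of its minimal
monomial generators, each colon ideal `(u_1, …, u_{i-1}) : u_i` is generated by variables -/
def HasLinearQuotients {K : Type} [Field K] {n : ℕ} (J : Ideal (SRing K n)) : Prop :=
  ∃ (t : ℕ) (u : Fin t → (Fin n →₀ ℕ)), Function.Injective u ∧
    (∀ e, e ∈ minGen J ↔ ∃ i, u i = e) ∧
    ∀ i : Fin t, ∃ V : Set (Fin n),
      Submodule.colon (Ideal.span ((fun j => (monomial (u j) (1:K))) '' {j | j < i}))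
        (Ideal.span {monomial (u i) (1:K)}) =
      Ideal.span ((fun v => (X v : SRing K n)) '' V)

lemma homogeneousComponent_add_mul {K : Type} [Field K] {n a b : ℕ} (c : SRing K n)
    {q : SRing K n} (hq : q.IsHomogeneous b) :
    homogeneousComponent (a + b) (c * q) = homogeneousComponent a c * q := by
  let := gradedAlgebra (R := K) (σ := Fin n)
  rw [← decomposition.decompose'_apply, ← decomposition.decompose'_apply]
  exact DirectSum.coe_decompose_mul_add_of_right_mem (homogeneousSubmodule (Fin n) K) hq

lemma mem_span_X_of_mul_X_mem {K : Type} [Field K] {n : ℕ} {W : Set (Fin n)} {v : Fin n}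
    (hv : v ∉ W) {g : SRing K n}
    (hg : g * X v ∈ Ideal.span ((X : Fin n → SRing K n) '' W)) :
    g ∈ Ideal.span ((X : Fin n → SRing K n) '' W) := by
  rw [mem_ideal_span_X_image] at hg ⊢
  intro m hm
  obtain ⟨i, hi, h⟩ := hg (m + Finsupp.single v 1) (by simpa [support_mul_X] using hm)
  refine ⟨i, hi, ?_⟩
  have hne : v ≠ i := by rintro rfl; exact hv hi
  simpa [Finsupp.single_apply, hne] using h

/-- A linearly ordered family in which the successive colon ideals
`(f j : j < i) : f i` are generated by variables, and whose ambient module carries an operator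
extracting the linear part of the coefficients in any relation among the `f i`. -/
structure HasLinearColons (K : Type) [Field K] (n : ℕ) {M : Type} [AddCommGroup M]
    [Module (SRing K n) M] {ι : Type} [LinearOrder ι] (f : ι → M) : Prop where
  colon : ∀ i, ∃ V : Set (Fin n), ∀ g : SRing K n,
    g • f i ∈ Submodule.span (SRing K n) (f '' Set.Iio i) ↔
      g ∈ Ideal.span ((X : Fin n → SRing K n) '' V)
  linearPart : ∃ D : M →+ M, ∀ (c : SRing K n) i, D (c • f i) = homogeneousComponent 1 c • f i

namespace HasLinearColons

variable {K : Type} [Field K] {n : ℕ} {M : Type} [AddCommGroup M] [Module (SRing K n) M]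
  {ι κ : Type} [LinearOrder ι] [LinearOrder κ]

lemma comp_orderIso {f : ι → M} (hf : HasLinearColons K n f) (e : κ ≃o ι) :
    HasLinearColons K n (f ∘ e) where
  colon k := by
    obtain ⟨V, hV⟩ := hf.colon (e k)
    refine ⟨V, fun g => ?_⟩
    rw [Set.image_comp, OrderIso.image_Iio]
    exact hV g
  linearPart := by
    obtain ⟨D, hD⟩ := hf.linearPart
    exact ⟨D, fun c i => hD c (e i)⟩

/-- The linear syzygy `x_v e_i - ∑ c_j e_j` given by a variable of the `i`-th colon ideal. -/
lemma exists_linear_syzygy {f : ι → M} (hf : HasLinearColons K n f) {i : ι} {v : Fin n}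
    (hv : (X v : SRing K n) • f i ∈ Submodule.span (SRing K n) (f '' Set.Iio i)) :
    ∃ z : ι →₀ SRing K n, Finsupp.linearCombination (SRing K n) f z = 0 ∧ z i = X v ∧
      (∀ j, i < j → z j = 0) ∧ ∀ j, (z j).IsHomogeneous 1 := by
  obtain ⟨D, hD⟩ := hf.linearPart
  obtain ⟨l, hl, hlf⟩ := (Finsupp.mem_span_image_iff_linearCombination _).1 hv
  rw [Finsupp.mem_supported'] at hl
  set c : ι →₀ SRing K n := l.mapRange (homogeneousComponent 1) (map_zero _) with hc
  have hX : homogeneousComponent 1 (X v : SRing K n) = X v :=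
    homogeneousComponent_eq_self (isHomogeneous_X K v)
  have hcf : Finsupp.linearCombination (SRing K n) f c = (X v : SRing K n) • f i := by
    have h := congrArg D hlf
    rw [hD, hX, Finsupp.linearCombination_apply, Finsupp.sum, map_sum] at h
    rw [← h, Finsupp.linearCombination_apply,
      Finsupp.sum_of_support_subset c Finsupp.support_mapRange _ (by simp)]
    exact Finset.sum_congr rfl fun j _ => by simp [hD, hc]
  refine ⟨Finsupp.single i (X v) - c, ?_, ?_, fun j hj => ?_, fun j => ?_⟩
  · rw [map_sub, hcf, Finsupp.linearCombination_single, sub_self]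
  · simp [hc, hl i (by simp)]
  · simp [hc, hl j (by simpa using hj.le), hj.ne]
  · rw [Finsupp.sub_apply]
    refine IsHomogeneous.sub ?_ (homogeneousComponent_isHomogeneous _ _)
    rw [Finsupp.single_apply]
    split_ifs
    exacts [isHomogeneous_X K v, isHomogeneous_zero _ _ _]

/-- The syzygies of a family with linear colon ideals are generated by linear forms, and these
generators can be ordered so as to have linear colon ideals again. -/
theorem exists_syzygies {t : ℕ} {f : Fin t → M} (hf : HasLinearColons K n f) :
    ∃ (t' : ℕ) (h : Fin t' → Fin t →₀ SRing K n), HasLinearColons K n h ∧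
      (∀ k l, (h k l).IsHomogeneous 1) ∧
      LinearMap.range (Finsupp.linearCombination (SRing K n) h) =
        LinearMap.ker (Finsupp.linearCombination (SRing K n) f) := by
  classical
  choose V hV using hf.colon
  have hz : ∀ i v, v ∈ V i → ∃ z : Fin t →₀ SRing K n,
      Finsupp.linearCombination (SRing K n) f z = 0 ∧ z i = X v ∧
      (∀ j, i < j → z j = 0) ∧ ∀ j, (z j).IsHomogeneous 1 := fun i v hv =>
    hf.exists_linear_syzygy ((hV i _).2 (Ideal.subset_span ⟨v, hv, rfl⟩))
  choose! z hzker hzdiag hzupper hzhom using hz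
  let ν := {p : Fin t ×ₗ Fin n // (ofLex p).2 ∈ V (ofLex p).1}
  let h : ν → Fin t →₀ SRing K n := fun p => z (ofLex p.1).1 (ofLex p.1).2
  have hgen : ∀ m : ℕ, ∀ y : Fin t →₀ SRing K n,
      Finsupp.linearCombination (SRing K n) f y = 0 → (∀ j : Fin t, m ≤ j → y j = 0) →
      y ∈ Submodule.span (SRing K n) (h '' {p | ((ofLex p.1).1 : ℕ) < m}) := by
    intro m
    induction m with
    | zero =>
      intro y _ hy
      have : y = 0 := Finsupp.ext fun j => hy j (Nat.zero_le _)
      simp [this]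
    | succ m ih =>
      intro y hyf hy
      have hmono : Submodule.span (SRing K n) (h '' {p | ((ofLex p.1).1 : ℕ) < m}) ≤
          Submodule.span (SRing K n) (h '' {p | ((ofLex p.1).1 : ℕ) < m + 1}) :=
        Submodule.span_mono (Set.image_mono fun p hp => Nat.lt_succ_of_lt hp)
      by_cases hm : m < t
      swap
      · exact hmono (ih y hyf fun j hj => absurd j.2 (by omega))
      set i : Fin t := ⟨m, hm⟩
      have hyi : y i ∈ Ideal.span ((X : Fin n → SRing K n) '' V i) := by
        rw [← hV]
        have hsum : y i • f i =
            -Finsupp.linearCombination (SRing K n) f (y - Finsupp.single i (y i)) := by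
          simp [hyf]
        rw [hsum]
        refine Submodule.neg_mem _ ((Finsupp.mem_span_image_iff_linearCombination _).2
          ⟨_, (Finsupp.mem_supported' _ _).2 fun j hj => ?_, rfl⟩)
        rcases (le_of_not_gt hj : i ≤ j).eq_or_lt with rfl | hij
        · simp
        · simp [hij.ne, hy j (Nat.succ_le_of_lt hij)]
      have himg : y i ∈ Submodule.map (Finsupp.lapply i)
          (Submodule.span (SRing K n) (z i '' V i)) := by
        rw [Submodule.map_span, Set.image_image]
        convert hyi using 2
        exact Set.image_congr fun v hv => hzdiag i v hv
      obtain ⟨w, hw, hwi⟩ := himg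
      have hwf : Finsupp.linearCombination (SRing K n) f w = 0 := by
        have hle : Submodule.span (SRing K n) (z i '' V i) ≤
            LinearMap.ker (Finsupp.linearCombination (SRing K n) f) := by
          rw [Submodule.span_le]
          rintro _ ⟨v, hv, rfl⟩
          exact hzker i v hv
        exact hle hw
      have hwj : ∀ j, i < j → w j = 0 := by
        intro j hj
        have hle : Submodule.span (SRing K n) (z i '' V i) ≤
            LinearMap.ker (Finsupp.lapply j : (Fin t →₀ SRing K n) →ₗ[SRing K n] _) := by
          rw [Submodule.span_le]
          rintro _ ⟨v, hv, rfl⟩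
          exact hzupper i v hv j hj
        exact hle hw
      have hwspan : w ∈ Submodule.span (SRing K n)
          (h '' {p | ((ofLex p.1).1 : ℕ) < m + 1}) := by
        refine Submodule.span_mono ?_ hw
        rintro _ ⟨v, hv, rfl⟩
        exact ⟨⟨toLex (i, v), hv⟩, Nat.lt_succ_self m, rfl⟩
      rw [← sub_add_cancel y w]
      refine Submodule.add_mem _ (hmono (ih _ (by rw [map_sub, hyf, hwf, sub_zero]) ?_)) hwspan
      intro j hj
      rcases (show i ≤ j from hj).eq_or_lt with rfl | hij
      · simpa [sub_eq_zero] using hwi.symm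
      · simp [hwj j hij, hy j (Nat.succ_le_of_lt hij)]
  have hlin : HasLinearColons K n h := by
    refine ⟨?_, ⟨Finsupp.mapRange.addMonoidHom
      (homogeneousComponent 2 : SRing K n →ₗ[K] SRing K n).toAddMonoidHom, ?_⟩⟩
    · rintro ⟨p, hp⟩
      obtain ⟨⟨i, v⟩, rfl⟩ := toLex.surjective p
      change v ∈ V i at hp
      refine ⟨{w | w ∈ V i ∧ w < v}, fun g => ⟨fun hg => ?_, fun hg => ?_⟩⟩
      · refine mem_span_X_of_mul_X_mem (v := v) (by simp) ?_
        have hmem := Submodule.mem_map_of_mem (f := Finsupp.lapply i) hg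
        rw [Submodule.map_span, Set.image_image] at hmem
        have hval : Finsupp.lapply (R := SRing K n) i (g • h ⟨toLex (i, v), hp⟩) = g * X v := by
          simp [h, hzdiag i v hp]
        rw [hval] at hmem
        refine (Submodule.span_le.2 ?_) hmem
        rintro _ ⟨⟨q, hq⟩, hlt, rfl⟩
        obtain ⟨⟨j, w⟩, rfl⟩ := toLex.surjective q
        change w ∈ V j at hq
        have hlt' : toLex (j, w) < toLex (i, v) := hlt
        rcases (Prod.Lex.toLex_lt_toLex).1 hlt' with hji | ⟨rfl, hwv⟩
        · have h0 : z j w i = 0 := hzupper j w hq i hji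
          simp [h, h0]
        · refine Ideal.subset_span ⟨w, ⟨hq, hwv⟩, ?_⟩
          simp [h, hzdiag _ w hq]
      · have hle : Ideal.span ((X : Fin n → SRing K n) '' {w | w ∈ V i ∧ w < v}) ≤
            Submodule.comap (LinearMap.toSpanSingleton (SRing K n) _ (h ⟨toLex (i, v), hp⟩))
              (Submodule.span (SRing K n) (h '' Set.Iio ⟨toLex (i, v), hp⟩)) := by
          refine Submodule.span_le.2 ?_
          rintro _ ⟨w, ⟨hw, hwv⟩, rfl⟩
          change (X w : SRing K n) • z i v ∈
            Submodule.span (SRing K n) (h '' Set.Iio ⟨toLex (i, v), hp⟩)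
          rw [← sub_add_cancel ((X w : SRing K n) • z i v) ((X v : SRing K n) • z i w)]
          refine Submodule.add_mem _ ?_ (Submodule.smul_mem _ _ (Submodule.subset_span
            ⟨⟨toLex (i, w), hw⟩, ?_, rfl⟩))
          · refine Submodule.span_mono (Set.image_mono ?_) (hgen i _ ?_ ?_)
            · intro q hq
              exact Prod.Lex.toLex_lt_toLex.2 (Or.inl hq)
            · simp [hzker i v hp, hzker i w hw]
            · intro j hj
              rcases (show i ≤ j from hj).eq_or_lt with rfl | hij
              · simp [hzdiag _ _ hp, hzdiag _ _ hw, mul_comm]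
              · simp [hzupper i v hp j hij, hzupper i w hw j hij]
          · exact Prod.Lex.toLex_lt_toLex.2 (Or.inr ⟨rfl, hwv⟩)
        exact hle hg
    · intro c p
      ext1 l
      exact homogeneousComponent_add_mul c (hzhom _ _ p.2 l)
  let e : Fin (Fintype.card ν) ≃o ν := Fintype.orderIsoFinOfCardEq ν rfl
  refine ⟨_, h ∘ e, hlin.comp_orderIso e, fun k l => hzhom _ _ (e k).2 l, ?_⟩
  rw [Finsupp.range_linearCombination, Set.range_comp, e.surjective.range_eq, Set.image_univ]
  refine le_antisymm (Submodule.span_le.2 ?_) fun y hy => ?_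
  · rintro _ ⟨p, rfl⟩
    exact hzker _ _ p.2
  · exact Submodule.span_mono (Set.image_subset_range _ _)
      (hgen t y hy fun j hj => absurd j.2 (by omega))

end HasLinearColons

/-- A stage of the linear resolution: linear syzygies `f` with linear colon ideals. -/
structure LinearSyzygyStage (K : Type) [Field K] (n : ℕ) where
  tgt : ℕ
  src : ℕ
  f : Fin src → Fin tgt →₀ SRing K n
  colons : HasLinearColons K n f
  linear : ∀ k l, (f k l).IsHomogeneous 1

/-- The next stage, consisting of the syzygies of the given one. -/
def LinearSyzygyStage.next {K : Type} [Field K] {n : ℕ} (s : LinearSyzygyStage K n) :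
    LinearSyzygyStage K n where
  tgt := s.src
  src := s.colons.exists_syzygies.choose
  f := s.colons.exists_syzygies.choose_spec.choose
  colons := s.colons.exists_syzygies.choose_spec.choose_spec.1
  linear := s.colons.exists_syzygies.choose_spec.choose_spec.2.1

lemma LinearSyzygyStage.range_next {K : Type} [Field K] {n : ℕ} (s : LinearSyzygyStage K n) :
    LinearMap.range (Finsupp.linearCombination (SRing K n) s.next.f) =
      LinearMap.ker (Finsupp.linearCombination (SRing K n) s.f) :=
  s.colons.exists_syzygies.choose_spec.choose_spec.2.2

/-- The stages of the linear resolution starting from `s`. -/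
def LinearSyzygyStage.stage {K : Type} [Field K] {n : ℕ} (s : LinearSyzygyStage K n) :
    ℕ → LinearSyzygyStage K n
  | 0 => s
  | i + 1 => (s.stage i).next

/-- An ideal generated by forms of degree `d` with linear colon ideals has a linear resolution. -/
theorem exists_linear_resolution {K : Type} [Field K] {n : ℕ} {J : Ideal (SRing K n)} {d t : ℕ}
    {f : Fin t → SRing K n} (hf : HasLinearColons K n f) (hd : ∀ k, (f k).IsHomogeneous d)
    (hJ : Ideal.span (Set.range f) = J) (r : ℕ∞) :
    ∃ R : GradedPartialRes J r, ∀ i k, R.dg i k = d + i := by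
  obtain ⟨t', h, hh, hlin, hker⟩ := hf.exists_syzygies
  let s : LinearSyzygyStage K n := ⟨t, t', h, hh, hlin⟩
  refine ⟨{
    s := fun i => (s.stage i).tgt
    dg := fun i _ => d + i
    aug := Finsupp.linearCombination (SRing K n) f
    diff := fun i => Finsupp.linearCombination (SRing K n) (s.stage i).f
    aug_hom := fun k => ?_
    diff_hom := fun i k l => Or.inr ⟨1, ?_, rfl⟩
    aug_range := ?_
    exact_zero := fun _ => hker
    exact_succ := fun i _ => (s.stage i).range_next }, fun _ _ => rfl⟩
  · erw [Finsupp.linearCombination_single, one_smul]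
    exact hd k
  · erw [Finsupp.linearCombination_single, one_smul]
    exact (s.stage i).linear k l
  · exact (Finsupp.range_linearCombination (SRing K n)).trans hJ

theorem idealIndex_eq_top_s12 {K : Type} [Field K] {n : ℕ} {J : Ideal (SRing K n)} {d t : ℕ}
    {f : Fin t → SRing K n} (hf : HasLinearColons K n f) (hd : ∀ k, (f k).IsHomogeneous d)
    (hJ : Ideal.span (Set.range f) = J) : idealIndex J d = ⊤ := by
  have hsteps : ∀ r, stepsLinear J d r := by
    intro r i _ j hj
    obtain ⟨R, hR⟩ := exists_linear_resolution hf hd hJ ((i : ℕ∞) + 1)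
    refine le_antisymm (iInf_le_of_le R ?_) zero_le
    have hempty : (Finset.univ.filter fun k => R.dg i k = i + j) = ∅ :=
      Finset.filter_eq_empty_iff.2 fun k _ => by rw [hR]; omega
    simp [hempty]
  refine ENat.eq_top_iff_forall_gt.2 fun m => ?_
  refine lt_of_lt_of_le ?_ (le_sSup ⟨m, rfl, hsteps m⟩)
  exact ENat.natCast_lt_natCast.2 (Nat.lt_succ_self m)

/-- The set of vertices covered by a set of edges. -/
def coveredVertices {n : ℕ} (M : Finset (Fin n × Fin n)) : Finset (Fin n) :=
  M.biUnion fun e => {e.1, e.2}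

lemma mem_coveredVertices {n : ℕ} {M : Finset (Fin n × Fin n)} {x : Fin n} :
    x ∈ coveredVertices M ↔ ∃ e ∈ M, x = e.1 ∨ x = e.2 := by
  simp [coveredVertices]

namespace IsMatching

variable {n : ℕ} {G : SimpleGraph (Fin n)} {M N : Finset (Fin n × Fin n)}

lemma eq_of_mem (hM : IsMatching G M) {e f : Fin n × Fin n} (he : e ∈ M) (hf : f ∈ M)
    {x : Fin n} (hxe : x = e.1 ∨ x = e.2) (hxf : x = f.1 ∨ x = f.2) : e = f := by
  by_contra hne
  have := hM.2 e he f hf hne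
  grind

lemma mono (hM : IsMatching G M) (h : N ⊆ M) : IsMatching G N :=
  ⟨fun p hp => hM.1 p (h hp), fun p hp q hq => hM.2 p (h hp) q (h hq)⟩

lemma insert_edge (hM : IsMatching G M) {e : Fin n × Fin n} (he : G.Adj e.1 e.2 ∧ e.1 < e.2)
    (h1 : e.1 ∉ coveredVertices M) (h2 : e.2 ∉ coveredVertices M) : IsMatching G (insert e M) := by
  simp only [mem_coveredVertices, not_exists, not_and, not_or] at h1 h2
  refine ⟨fun p hp => ?_, fun p hp q hq hpq => ?_⟩
  · rcases Finset.mem_insert.1 hp with rfl | hp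
    exacts [he, hM.1 p hp]
  · have := hM.2 p
    grind

lemma pairwiseDisjoint (hM : IsMatching G M) :
    (M : Set (Fin n × Fin n)).PairwiseDisjoint fun e => ({e.1, e.2} : Finset (Fin n)) := by
  intro e he f hf hne
  have := hM.2 e he f hf hne
  simp only [Function.onFun, Finset.disjoint_left]
  grind

lemma prod_coveredVertices (hM : IsMatching G M) {R : Type} [CommMonoid R] (g : Fin n → R) :
    ∏ a ∈ coveredVertices M, g a = ∏ e ∈ M, (g e.1 * g e.2) := by
  rw [coveredVertices, Finset.prod_biUnion hM.pairwiseDisjoint]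
  exact Finset.prod_congr rfl fun e he => Finset.prod_pair (hM.1 e he).2.ne

lemma card_coveredVertices (hM : IsMatching G M) : (coveredVertices M).card = 2 * M.card := by
  rw [coveredVertices, Finset.card_biUnion hM.pairwiseDisjoint,
    Finset.sum_congr rfl fun e he => Finset.card_pair (hM.1 e he).2.ne]
  simp [mul_comm]

lemma card_le_matchNum (hM : IsMatching G M) : M.card ≤ matchNum G :=
  le_csSup ⟨Fintype.card (Fin n × Fin n), by rintro _ ⟨N, _, rfl⟩; exact N.card_le_univ⟩
    ⟨M, hM, rfl⟩

/-- The vertex sets of maximum matchings have the exchange property of the bases of a matroid. -/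
theorem exists_exchange (hM : IsMatching G M) (hMcard : M.card = matchNum G)
    (hN : IsMatching G N) {x : Fin n} (hxN : x ∈ coveredVertices N)
    (hxM : x ∉ coveredVertices M) :
    ∃ y ∈ coveredVertices M, y ∉ coveredVertices N ∧ ∃ M', IsMatching G M' ∧
      M'.card = matchNum G ∧ coveredVertices M' = insert x ((coveredVertices M).erase y) := by
  induction hk : (N \ M).card using Nat.strong_induction_on generalizing M x with
  | _ k ih =>
  obtain ⟨e, heN, hxe⟩ := mem_coveredVertices.1 hxN
  have heM : e ∉ M := fun h => hxM (mem_coveredVertices.2 ⟨e, h, hxe⟩)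
  obtain ⟨z, hz⟩ : ∃ z, e = (x, z) ∨ e = (z, x) := by
    rcases hxe with rfl | rfl
    exacts [⟨e.2, Or.inl rfl⟩, ⟨e.1, Or.inr rfl⟩]
  have hxz : x ≠ z := by
    have := (hN.1 e heN).2.ne
    grind
  have hzM : z ∈ coveredVertices M := by
    by_contra hzM
    have := (hM.insert_edge (hN.1 e heN) (by grind) (by grind)).card_le_matchNum
    rw [Finset.card_insert_of_notMem heM] at this
    omega
  obtain ⟨f, hfM, hzf⟩ := mem_coveredVertices.1 hzM
  obtain ⟨w, hw⟩ : ∃ w, f = (z, w) ∨ f = (w, z) := by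
    rcases hzf with rfl | rfl
    exacts [⟨f.2, Or.inl rfl⟩, ⟨f.1, Or.inr rfl⟩]
  have hzw : z ≠ w := by
    have := (hM.1 f hfM).2.ne
    grind
  have hwM : w ∈ coveredVertices M := mem_coveredVertices.2 ⟨f, hfM, by grind⟩
  have hfN : f ∉ N := fun h => heM (hN.eq_of_mem heN h (x := z) (by grind) hzf ▸ hfM)
  have hErase : coveredVertices (M.erase f) = ((coveredVertices M).erase z).erase w := by
    ext a
    have huniq : ∀ g ∈ M, (a = g.1 ∨ a = g.2) → (a = f.1 ∨ a = f.2) → g = f :=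
      fun g hg h h' => hM.eq_of_mem hg hfM h h'
    simp only [Finset.mem_erase, mem_coveredVertices]
    grind
  set M₁ := insert e (M.erase f) with hM₁
  have hM₁match : IsMatching G M₁ :=
    (hM.mono (Finset.erase_subset _ _)).insert_edge (hN.1 e heN) (by grind) (by grind)
  have hM₁card : M₁.card = matchNum G := by
    rw [hM₁, Finset.card_insert_of_notMem (by grind), Finset.card_erase_of_mem hfM]
    have := Finset.card_pos.2 ⟨f, hfM⟩
    omega
  have hcov : coveredVertices M₁ = insert x ((coveredVertices M).erase w) := by
    have : coveredVertices M₁ = {e.1, e.2} ∪ coveredVertices (M.erase f) := by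
      rw [hM₁, coveredVertices, Finset.biUnion_insert]; rfl
    rw [this, hErase]
    grind
  by_cases hwN : w ∈ coveredVertices N
  swap
  · exact ⟨w, hwM, hwN, M₁, hM₁match, hM₁card, hcov⟩
  have hlt : (N \ M₁).card < k := by
    rw [← hk]
    refine Finset.card_lt_card ((Finset.ssubset_iff_of_subset ?_).2 ⟨e, by grind, by grind⟩)
    intro g hg
    grind
  obtain ⟨y, hy, hyN, M', hM', hM'card, hM'cov⟩ :=
    ih _ hlt hM₁match hM₁card hwN (by grind) rfl
  refine ⟨y, by grind, hyN, M', hM', hM'card, ?_⟩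
  rw [hM'cov, hcov]
  grind

end IsMatching

/-- The exponent vector of the squarefree monomial with support `A`. -/
def sqfreeExponent {n : ℕ} (A : Finset (Fin n)) : Fin n →₀ ℕ := ∑ a ∈ A, Finsupp.single a 1

lemma sqfreeExponent_apply {n : ℕ} (A : Finset (Fin n)) (x : Fin n) :
    sqfreeExponent A x = if x ∈ A then 1 else 0 := by
  simp [sqfreeExponent, Finsupp.finsetSum_apply, Finsupp.single_apply]

lemma sqfreeExponent_injective {n : ℕ} :
    Function.Injective (sqfreeExponent : Finset (Fin n) → Fin n →₀ ℕ) := by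
  intro A B h
  ext x
  have := DFunLike.congr_fun h x
  simp only [sqfreeExponent_apply] at this
  grind

lemma degree_sqfreeExponent {n : ℕ} (A : Finset (Fin n)) :
    (sqfreeExponent A).degree = A.card := by
  simp [sqfreeExponent, map_sum]

lemma monomial_sqfreeExponent {K : Type} [Field K] {n : ℕ} (A : Finset (Fin n)) :
    (monomial (sqfreeExponent A) 1 : SRing K n) = ∏ a ∈ A, X a :=
  monomial_sum_one _ _

/-- If all generators of a monomial ideal have the same degree then they are all minimal. -/
lemma minGen_span_monomial {K : Type} [Field K] {n d : ℕ} {U : Set (Fin n →₀ ℕ)}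
    (hU : ∀ e ∈ U, e.degree = d) :
    minGen (Ideal.span ((fun e => (monomial e (1 : K) : SRing K n)) '' U)) = U := by
  have hmem : ∀ e, (monomial e (1 : K) : SRing K n) ∈
      Ideal.span ((fun e => (monomial e (1 : K) : SRing K n)) '' U) ↔ ∃ u ∈ U, u ≤ e := by
    intro e
    classical
    simp [mem_ideal_span_monomial_image, support_monomial]
  ext e
  simp only [minGen, Set.mem_ofPred_eq, hmem]
  constructor
  · rintro ⟨⟨u, hu, hue⟩, hmin⟩
    by_contra he
    exact hmin u hue (by rintro rfl; exact he hu) ⟨u, hu, le_rfl⟩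
  · refine fun he => ⟨⟨e, he, le_rfl⟩, ?_⟩
    rintro e' hle hne ⟨u, hu, hue⟩
    have hlt : u < e := hue.trans_lt (lt_of_le_of_ne hle hne)
    have hadd : u.degree + (e - u).degree = e.degree := by
      rw [← map_add, add_tsub_cancel_of_le hlt.le]
    rw [hU u hu, hU e he, Nat.add_eq_left, Finsupp.degree_eq_zero_iff] at hadd
    exact hlt.not_ge (tsub_eq_zero_iff_le.1 hadd)

/-- The vertex sets of the matchings of size `k`. -/
def matchedSets {n : ℕ} (G : SimpleGraph (Fin n)) (k : ℕ) : Set (Finset (Fin n)) :=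
  {A | ∃ M, IsMatching G M ∧ M.card = k ∧ coveredVertices M = A}

lemma sqfreePower_eq_span (K : Type) [Field K] {n : ℕ} (G : SimpleGraph (Fin n)) (k : ℕ) :
    sqfreePower K G k = Ideal.span ((fun e => (monomial e (1 : K) : SRing K n)) ''
      (sqfreeExponent '' matchedSets G k)) := by
  rw [sqfreePower, Set.image_image]
  congr 1
  ext p
  constructor
  · rintro ⟨M, hM, hk, rfl⟩
    exact ⟨_, ⟨M, hM, hk, rfl⟩,
      (monomial_sqfreeExponent _).trans (hM.prod_coveredVertices _)⟩
  · rintro ⟨_, ⟨M, hM, hk, rfl⟩, rfl⟩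
    exact ⟨M, hM, hk, (monomial_sqfreeExponent _).trans (hM.prod_coveredVertices _)⟩

lemma degree_of_mem_matchedSets {n k : ℕ} {G : SimpleGraph (Fin n)} :
    ∀ e ∈ sqfreeExponent '' matchedSets G k, e.degree = 2 * k := by
  rintro _ ⟨_, ⟨M, hM, rfl, rfl⟩, rfl⟩
  rw [degree_sqfreeExponent, hM.card_coveredVertices]

/-- A family of squarefree monomials has linear colon ideals if each earlier generator can be
replaced by an earlier one that contributes a single new variable. -/
lemma hasLinearColons_of_exchange {K : Type} [Field K] {n d : ℕ} {ι : Type} [LinearOrder ι]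
    (A : ι → Finset (Fin n)) (hd : ∀ i, (A i).card = d)
    (hA : ∀ i, ∀ j < i, ∃ x ∈ A j, x ∉ A i ∧ ∃ k < i, A k ⊆ insert x (A i)) :
    HasLinearColons K n fun i => (monomial (sqfreeExponent (A i)) (1 : K) : SRing K n) where
  colon i := by
    refine ⟨{x | ∃ k < i, A k ⊆ insert x (A i)}, fun g => ?_⟩
    have himg : (fun i => (monomial (sqfreeExponent (A i)) (1 : K) : SRing K n)) '' Set.Iio i =
        (fun e => (monomial e (1 : K) : SRing K n)) ''
          ((fun j => sqfreeExponent (A j)) '' Set.Iio i) := by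
      rw [Set.image_image]
    rw [himg, smul_eq_mul]
    change _ ∈ Ideal.span _ ↔ _
    rw [mem_ideal_span_monomial_image, mem_ideal_span_X_image]
    constructor
    · intro h m hm
      obtain ⟨_, ⟨j, hj, rfl⟩, hle⟩ := h (m + sqfreeExponent (A i)) (by
        rw [mem_support_iff, coeff_mul_monomial, mul_one]
        exact mem_support_iff.1 hm)
      obtain ⟨x, hxj, hxi, hk⟩ := hA i j hj
      refine ⟨x, hk, ?_⟩
      have := hle x
      simp only [Finsupp.add_apply, sqfreeExponent_apply, if_pos hxj, if_neg hxi] at this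
      omega
    · intro h m hm
      rw [mem_support_iff, coeff_mul_monomial', mul_one, ne_eq, ite_eq_right_iff,
        Classical.not_imp] at hm
      obtain ⟨x, ⟨k, hk, hsub⟩, hx⟩ := h _ (mem_support_iff.2 hm.2)
      refine ⟨_, ⟨k, hk, rfl⟩, fun y => ?_⟩
      have hy := hm.1 y
      have hyk := @hsub y
      rw [Finsupp.tsub_apply] at hx
      simp only [sqfreeExponent_apply, Finset.mem_insert] at hy hyk hx ⊢
      grind
  linearPart := by
    refine ⟨(homogeneousComponent (1 + d) : SRing K n →ₗ[K] SRing K n).toAddMonoidHom,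
      fun c i => homogeneousComponent_add_mul c ?_⟩
    exact isHomogeneous_monomial _ ((degree_sqfreeExponent _).trans (hd i))


/-- The vertex sets of maximum matchings, listed in reverse colexicographic order. -/
theorem exists_ordering_matchedSets {n : ℕ} (G : SimpleGraph (Fin n)) :
    ∃ (t : ℕ) (A : Fin t → Finset (Fin n)), Function.Injective A ∧
      Set.range A = matchedSets G (matchNum G) ∧
      ∀ i, ∀ j < i, ∃ x ∈ A j, x ∉ A i ∧ ∃ k < i, A k ⊆ insert x (A i) := by
  classical
  let S := {B : (Colex (Finset (Fin n)))ᵒᵈ //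
    ofColex (OrderDual.ofDual B) ∈ matchedSets G (matchNum G)}
  have : Finite S := Finite.of_injective (fun B : S => ofColex (OrderDual.ofDual B.1))
    fun B C h => Subtype.ext (congrArg (fun D => OrderDual.toDual (toColex D)) h)
  let := Fintype.ofFinite S
  let o : Fin (Fintype.card S) ≃o S := Fintype.orderIsoFinOfCardEq S rfl
  let A : Fin (Fintype.card S) → Finset (Fin n) := fun i => ofColex (OrderDual.ofDual (o i).1)
  have hlt : ∀ i j, j < i ↔ toColex (A i) < toColex (A j) := fun i j => o.lt_iff_lt.symm
  have hrange : Set.range A = matchedSets G (matchNum G) := by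
    ext B
    refine ⟨?_, fun hB => ?_⟩
    · rintro ⟨i, rfl⟩
      exact (o i).2
    · obtain ⟨i, hi⟩ := o.surjective ⟨OrderDual.toDual (toColex B), hB⟩
      exact ⟨i, by simp [A, hi]⟩
  refine ⟨_, A, fun i j hij => o.injective (Subtype.ext hij), hrange, fun i j hji => ?_⟩
  obtain ⟨x, hxj, hxi, hmax⟩ :=
    Finset.Colex.toColex_lt_toColex_iff_exists_forall_lt.1 ((hlt i j).1 hji)
  refine ⟨x, hxj, hxi, ?_⟩
  obtain ⟨M, hM, hMcard, hMi⟩ : A i ∈ matchedSets G (matchNum G) := hrange ▸ ⟨i, rfl⟩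
  obtain ⟨N, hN, -, hNj⟩ : A j ∈ matchedSets G (matchNum G) := hrange ▸ ⟨j, rfl⟩
  obtain ⟨y, hyi, hyj, M', hM', hM'card, hcov⟩ :=
    hM.exists_exchange hMcard hN (x := x) (hNj ▸ hxj) (hMi ▸ hxi)
  rw [hMi] at hyi hcov
  rw [hNj] at hyj
  obtain ⟨k, hk⟩ : insert x ((A i).erase y) ∈ Set.range A :=
    hrange ▸ ⟨M', hM', hM'card, hcov⟩
  refine ⟨k, (hlt i k).2 ?_, by grind⟩
  rw [hk, Finset.Colex.toColex_lt_toColex_iff_exists_forall_lt]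
  exact ⟨x, by simp, hxi, fun b hb hbk => hmax b hb (by grind)⟩

/-- **Theorem.** For a simple graph `G` with matching number `ν(G)`, the squarefree
power `I(G)^{[ν(G)]}` has linear quotients; in particular it has a linear resolution. -/
theorem stmt12 (K : Type) [Field K] (n : ℕ) (G : SimpleGraph (Fin n)) :
    HasLinearQuotients (sqfreePower K G (matchNum G)) ∧
    idealIndex (sqfreePower K G (matchNum G)) (2 * matchNum G) = ⊤ := by
  obtain ⟨t, A, hinj, hrange, hexch⟩ := exists_ordering_matchedSets G
  have hmem : ∀ i, sqfreeExponent (A i) ∈ sqfreeExponent '' matchedSets G (matchNum G) :=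
    fun i => ⟨A i, hrange ▸ ⟨i, rfl⟩, rfl⟩
  have hdeg : ∀ i, (sqfreeExponent (A i)).degree = 2 * matchNum G :=
    fun i => degree_of_mem_matchedSets _ (hmem i)
  have hlin : HasLinearColons K n
      fun i => (monomial (sqfreeExponent (A i)) (1 : K) : SRing K n) :=
    hasLinearColons_of_exchange A (fun i => (degree_sqfreeExponent _).symm.trans (hdeg i)) hexch
  constructor
  · refine ⟨t, fun i => sqfreeExponent (A i), sqfreeExponent_injective.comp hinj, fun e => ?_,
      fun i => ?_⟩
    · rw [sqfreePower_eq_span, minGen_span_monomial degree_of_mem_matchedSets, ← hrange,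
        ← Set.range_comp]
      rfl
    · obtain ⟨V, hV⟩ := hlin.colon i
      refine ⟨V, Ideal.ext fun g => ?_⟩
      rw [← hV g]
      exact Submodule.mem_colon_span_singleton
  · refine idealIndex_eq_top_s12 hlin (fun i => isHomogeneous_monomial _ (hdeg i)) ?_
    rw [sqfreePower_eq_span, ← hrange, ← Set.range_comp, ← Set.range_comp]
    rfl

end
end

section
/- Let G be a simple graph with edge ideal I and let 0 < k < nu_0(G). Then index(I^{[k]}) = 1, i.e. the k-th squarefree power of I is not linearly related. -/
open MvPolynomial

noncomputable section

section Syzygies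

variable {K : Type} [Field K] {n : ℕ}

lemma exists_coeff_eq_ite (f : SRing K n) (P : (Fin n →₀ ℕ) → Prop) [DecidablePred P] :
    ∃ q : SRing K n, ∀ e, coeff e q = if P e then coeff e f else 0 := by
  refine ⟨∑ e ∈ f.support with P e, monomial e (coeff e f), fun e => ?_⟩
  rw [coeff_sum]
  simp only [coeff_monomial, Finset.sum_ite_eq', Finset.mem_filter, mem_support_iff]
  by_cases hP : P e <;> by_cases hf : coeff e f = 0 <;> simp [hP, hf]

/-- If every monomial of `g` that divides `L` equals `L`, then only the constant term of `f`
contributes to the coefficient of `L` in `f * g`. -/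
lemma coeff_mul_eq_of_minimal {f g : SRing K n} {L : Fin n →₀ ℕ}
    (hg : ∀ e ∈ g.support, e ≤ L → e = L) : coeff L (f * g) = coeff 0 f * coeff L g := by
  classical
  rw [coeff_mul, Finset.sum_eq_single (0, L)]
  · rintro ⟨a, b⟩ hab hne
    replace hab := Finset.HasAntidiagonal.mem_antidiagonal.mp hab
    dsimp only at hab ⊢
    by_cases hb : b ∈ g.support
    · have hbL : b = L := hg b hb (hab ▸ le_add_self)
      subst hbL
      have ha : a = 0 := by simpa using hab
      exact absurd (by rw [ha]) hne
    · rw [notMem_support_iff.mp hb, mul_zero]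
  · intro h
    simp at h

/-- Let `u` be a monomial generator and let `L` be a multiple of `u` and of another generator
such that `lcm(w, u) = L` for every generator `w ≠ u` dividing `L`.
Then every graded presentation of the ideal has a first syzygy in degree `deg L`. -/
lemma exists_syzygy_degree_eq {W : Set (Fin n →₀ ℕ)} {u v L : Fin n →₀ ℕ} (hu : u ∈ W)
    (hv : v ∈ W) (huL : u ≤ L) (hvL : v ≤ L) (huv : ¬ u ≤ v)
    (hW : ∀ w ∈ W, w ≠ u → ¬ w ≤ u) (hL : ∀ w ∈ W, w ≠ u → w ≤ L → w ⊔ u = L)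
    {I : Ideal (SRing K n)} (hI : I = Ideal.span ((fun e => monomial e (1 : K)) '' W))
    {r : ℕ∞} (hr : 0 < r) (R : GradedPartialRes I r) : ∃ l, R.dg 1 l = L.degree := by
  classical
  by_contra! hdeg
  choose q hq using fun k => exists_coeff_eq_ite (R.aug (Finsupp.single k 1)) (fun e => u ≤ e)
  set ψ : (Fin (R.s 0) →₀ SRing K n) →ₗ[SRing K n] SRing K n :=
    Finsupp.linearCombination _ q with hψ
  have hψq : ∀ k, ψ (Finsupp.single k 1) = q k := fun k => by simp [hψ]
  have hmemu : ∀ x, ψ x ∈ Ideal.span ((fun e => monomial e (1 : K)) '' {u}) := by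
    intro x
    induction x using Finsupp.induction_linear with
    | zero => simp
    | add x y hx hy => rw [map_add]; exact add_mem hx hy
    | single k a =>
      rw [← mul_one a, ← smul_eq_mul, ← Finsupp.smul_single, map_smul, hψq]
      refine Submodule.smul_mem _ _ (mem_ideal_span_monomial_image.mpr fun e he => ?_)
      rw [mem_support_iff, hq] at he
      exact ⟨u, rfl, by by_contra h; simp [h] at he⟩
  have hmemv : ∀ x, R.aug x - ψ x ∈
      Ideal.span ((fun e => monomial e (1 : K)) '' (W \ {u})) := by
    intro x
    induction x using Finsupp.induction_linear with
    | zero => simp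
    | add x y hx hy => rw [map_add, map_add, add_sub_add_comm]; exact add_mem hx hy
    | single k a =>
      rw [← mul_one a, ← smul_eq_mul, ← Finsupp.smul_single, map_smul, map_smul, hψq, ← smul_sub]
      refine Submodule.smul_mem _ _ (mem_ideal_span_monomial_image.mpr fun e he => ?_)
      rw [mem_support_iff, coeff_sub, hq] at he
      have hue : ¬ u ≤ e := fun h => by simp [h] at he
      have hmem : R.aug (Finsupp.single k 1) ∈
          Ideal.span ((fun e => monomial e (1 : K)) '' W) := by
        exact (R.aug_range.trans hI) ▸ LinearMap.mem_range_self R.aug (Finsupp.single k 1)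
      obtain ⟨w, hw, hwe⟩ := mem_ideal_span_monomial_image.mp hmem e
        (mem_support_iff.mpr fun h => by simp [h] at he)
      exact ⟨w, ⟨hw, fun h => hue (h ▸ hwe)⟩, hwe⟩
  have hqhom : ∀ k, (q k).IsHomogeneous (R.dg 0 k) := by
    intro k e he
    refine R.aug_hom k fun h => he ?_
    rw [hq, h, ite_self]
  have hψdiff : ∀ l, (ψ (R.diff 0 (Finsupp.single l 1))).IsHomogeneous (R.dg 1 l) := by
    intro l
    rw [hψ, Finsupp.linearCombination_apply, Finsupp.sum]
    refine IsHomogeneous.sum _ _ _ fun k _ => ?_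
    rw [smul_eq_mul]
    rcases R.diff_hom 0 l k with h | ⟨m, hm, hdg⟩
    · rw [h, zero_mul]
      exact isHomogeneous_zero _ _ _
    · exact ((Nat.add_comm _ _).trans hdg) ▸ hm.mul (hqhom k)
  have hmin : ∀ x, R.aug x = 0 → ∀ e ∈ (ψ x).support, e ≤ L → e = L := by
    intro x hx e he heL
    have h₁ := hmemv x
    rw [hx, zero_sub, neg_mem_iff] at h₁
    obtain ⟨w, ⟨hw, hwu⟩, hwe⟩ := mem_ideal_span_monomial_image.mp h₁ e he
    obtain ⟨_, rfl, hue⟩ := mem_ideal_span_monomial_image.mp (hmemu x) e he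
    exact le_antisymm heL (hL w hw hwu (hwe.trans heL) ▸ sup_le hwe hue)
  have hker : ∀ x, R.aug x = 0 → coeff L (ψ x) = 0 := by
    have haug : ∀ y, R.aug (R.diff 0 y) = 0 := by
      intro y
      rw [← LinearMap.mem_ker, ← R.exact_zero hr]
      exact LinearMap.mem_range_self _ _
    intro x hx
    rw [← LinearMap.mem_ker, ← R.exact_zero hr] at hx
    obtain ⟨y, rfl⟩ := hx
    induction y using Finsupp.induction_linear with
    | zero => simp
    | add x y hx hy => rw [map_add, map_add, coeff_add, hx, hy, add_zero]
    | single l a =>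
      rw [← mul_one a, ← smul_eq_mul, ← Finsupp.smul_single, map_smul, map_smul, smul_eq_mul,
        coeff_mul_eq_of_minimal (hmin _ (haug _)),
        (hψdiff l).coeff_eq_zero (hdeg l).symm, mul_zero]
  have hsurj : ∀ w ∈ W, ∃ x, R.aug x = monomial w 1 := by
    intro w hw
    rw [← LinearMap.mem_range, R.aug_range, hI]
    exact Ideal.subset_span ⟨w, hw, rfl⟩
  obtain ⟨xu, hxu⟩ := hsurj u hu
  obtain ⟨xv, hxv⟩ := hsurj v hv
  have hcu : coeff u (ψ xu) = 1 := by
    have h : coeff u (R.aug xu - ψ xu) = 0 := by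
      by_contra h
      obtain ⟨w, ⟨hw, hwu⟩, hle⟩ :=
        mem_ideal_span_monomial_image.mp (hmemv xu) u (mem_support_iff.mpr h)
      exact hW w hw hwu hle
    rw [hxu, coeff_sub, coeff_monomial, if_pos rfl, sub_eq_zero] at h
    exact h.symm
  have hcv : coeff v (ψ xv) = 0 := by
    by_contra h
    obtain ⟨_, rfl, hle⟩ :=
      mem_ideal_span_monomial_image.mp (hmemu xv) v (mem_support_iff.mpr h)
    exact huv hle
  have h := hker ((monomial (L - u) 1 : SRing K n) • xu - (monomial (L - v) 1 : SRing K n) • xv)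
    (by rw [map_sub, map_smul, map_smul, hxu, hxv, smul_eq_mul, smul_eq_mul, monomial_mul,
      monomial_mul, tsub_add_cancel_of_le huL, tsub_add_cancel_of_le hvL, sub_self])
  rw [map_sub, map_smul, map_smul, smul_eq_mul, smul_eq_mul, coeff_sub, coeff_monomial_mul',
    coeff_monomial_mul', if_pos tsub_le_self, if_pos tsub_le_self,
    tsub_tsub_cancel_of_le huL, tsub_tsub_cancel_of_le hvL, hcu, hcv] at h
  simp at h

lemma homogeneousComponent_mul_monomial (p : SRing K n) (g : Fin n →₀ ℕ) (j : ℕ) :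
    homogeneousComponent j p * monomial g 1 =
      homogeneousComponent (j + g.degree) (p * monomial g 1) := by
  ext e
  rw [coeff_mul_monomial', coeff_homogeneousComponent, coeff_homogeneousComponent,
    coeff_mul_monomial']
  by_cases hge : g ≤ e
  · obtain ⟨c, rfl⟩ := exists_add_of_le hge
    simp [add_comm g.degree]
  · simp [hge]

/-- The kernel of a map of free modules sending the basis to monomials of one fixed degree is
generated by finitely many homogeneous elements. -/
lemma exists_homogeneous_generators_ker {m d : ℕ} (g : Fin m → (Fin n →₀ ℕ))
    (hg : ∀ i, (g i).degree = d) :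
    ∃ (t : ℕ) (c : Fin t → (Fin m →₀ SRing K n)) (δ : Fin t → ℕ),
      (∀ i l, (c i l).IsHomogeneous (δ i)) ∧
      Submodule.span (SRing K n) (Set.range c) = LinearMap.ker
        (Finsupp.linearCombination (SRing K n) fun i => (monomial (g i) 1 : SRing K n)) := by
  classical
  set f := Finsupp.linearCombination (SRing K n) fun i => (monomial (g i) 1 : SRing K n) with hf
  have hfx : ∀ x, f x = ∑ i, x i * monomial (g i) 1 := fun x => by
    rw [hf, Finsupp.linearCombination_apply, Finsupp.sum_fintype _ _ (by simp)]
    rfl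
  set H : Set (Fin m →₀ SRing K n) := {x | f x = 0 ∧ ∃ j, ∀ l, (x l).IsHomogeneous j} with hH
  have hspan : Submodule.span (SRing K n) H = LinearMap.ker f := by
    refine le_antisymm (Submodule.span_le.mpr fun x hx => hx.1) fun x hx => ?_
    rw [LinearMap.mem_ker, hfx] at hx
    let comp (j : ℕ) : Fin m →₀ SRing K n := x.mapRange (homogeneousComponent j) (map_zero _)
    have hsum : x = ∑ j ∈ Finset.range ((∑ l, (x l).totalDegree) + 1), comp j := by
      ext1 l
      rw [Finsupp.finsetSum_apply]
      simp only [comp, Finsupp.mapRange_apply]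
      conv_lhs => rw [← sum_homogeneousComponent (x l)]
      refine Finset.sum_subset (Finset.range_mono ?_) fun j _ hj => ?_
      · exact Nat.succ_le_succ
          (Finset.single_le_sum (f := fun l => (x l).totalDegree) (by simp) (Finset.mem_univ l))
      · exact homogeneousComponent_eq_zero _ _ (by simpa using hj)
    rw [hsum]
    refine sum_mem fun j _ => Submodule.subset_span ⟨?_, j, fun l => ?_⟩
    · rw [hfx]
      simp only [comp, Finsupp.mapRange_apply, homogeneousComponent_mul_monomial, hg]
      rw [← map_sum, hx, map_zero]
    · simpa [comp] using homogeneousComponent_isHomogeneous j (x l)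
  obtain ⟨T, hTH, hT⟩ := (Submodule.fg_span_iff_fg_span_finset_subset H).mp
    (IsNoetherian.noetherian (Submodule.span (SRing K n) H))
  choose δ hδ using fun x : T => (hTH x.2).2
  refine ⟨T.card, fun i => T.equivFin.symm i, fun i => δ (T.equivFin.symm i),
    fun i l => hδ _ l, ?_⟩
  rw [← hspan, hT, ← Function.comp_def, Set.range_comp, T.equivFin.symm.surjective.range_eq,
    Set.image_univ, Subtype.range_coe_subtype]
  rfl

lemma stepsLinear_zero_of_monomial_span {W : Set (Fin n →₀ ℕ)} {d : ℕ} (hfin : W.Finite)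
    (hd : ∀ w ∈ W, w.degree = d) :
    stepsLinear (Ideal.span ((fun e => monomial e (1 : K)) '' W)) d 0 := by
  intro i hi j hj
  obtain rfl := Nat.le_zero.mp hi
  let σ := hfin.toFinset.equivFin
  let g : Fin hfin.toFinset.card → (Fin n →₀ ℕ) := fun i => σ.symm i
  have hgW : ∀ i, g i ∈ W := fun i => hfin.mem_toFinset.mp (σ.symm i).2
  have hg : ∀ i, (g i).degree = d := fun i => hd _ (hgW i)
  have hrange : Set.range g = W := by
    ext w
    refine ⟨fun ⟨i, hi⟩ => hi ▸ hgW i, fun hw => ⟨σ ⟨w, hfin.mem_toFinset.mpr hw⟩, ?_⟩⟩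
    simp [g]
  obtain ⟨t, c, δ, hc, hspan⟩ := exists_homogeneous_generators_ker (K := K) g hg
  refine ENat.iInf_eq_zero.mpr ⟨
    { s := fun i => match i with
        | 0 => hfin.toFinset.card
        | 1 => t
        | _ + 2 => 0
      dg := fun i => match i with
        | 0 => fun _ => d
        | 1 => fun l => d + δ l
        | _ + 2 => fun _ => 0
      aug := Finsupp.linearCombination _ fun i => (monomial (g i) 1 : SRing K n)
      diff := fun i => match i with
        | 0 => Finsupp.linearCombination _ c
        | _ + 1 => 0
      aug_hom := fun k => by
        rw [Finsupp.linearCombination_single, one_smul]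
        exact isHomogeneous_monomial _ (hg k)
      diff_hom := fun i k l => by
        match i with
        | 0 =>
          refine Or.inr ⟨δ k, ?_, rfl⟩
          rw [Finsupp.linearCombination_single, one_smul]
          exact hc k l
        | _ + 1 => exact Or.inl rfl
      aug_range := by
        rw [Finsupp.range_linearCombination, ← Function.comp_def (fun e => monomial e (1 : K)) g,
          Set.range_comp, hrange]
      exact_zero := fun _ => by
        rw [← hspan]
        exact Finsupp.range_linearCombination _
      exact_succ := fun i hi => by
        simp at hi }, ?_⟩
  simp only [Nat.cast_eq_zero, Finset.card_eq_zero]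
  exact Finset.filter_eq_empty_iff.mpr fun k _ => by simpa using hj.ne

/-- The index of a monomial ideal generated in degree `d` equals `1` as soon as some generator
`u` is isolated, in the sense of `exists_syzygy_degree_eq`, below a monomial of degree `> d + 1`. -/
lemma idealIndex_eq_one_of_isolated {W : Set (Fin n →₀ ℕ)} {d : ℕ} (hfin : W.Finite)
    (hd : ∀ w ∈ W, w.degree = d) {u v L : Fin n →₀ ℕ} (hu : u ∈ W)
    (hv : v ∈ W) (huL : u ≤ L) (hvL : v ≤ L) (hne : u ≠ v) (hLd : d + 1 < L.degree)
    (hL : ∀ w ∈ W, w ≠ u → w ≤ L → w ⊔ u = L) :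
    idealIndex (Ideal.span ((fun e => monomial e (1 : K)) '' W)) d = 1 := by
  have eq_of_le : ∀ a ∈ W, ∀ b ∈ W, a ≤ b → a = b := by
    intro a ha b hb hab
    obtain ⟨c, rfl⟩ := exists_add_of_le hab
    have h := (hd _ hb).trans (hd _ ha).symm
    rw [map_add, Nat.add_eq_left, Finsupp.degree_eq_zero_iff] at h
    rw [h, add_zero]
  have hset : {x : ℕ∞ | ∃ r : ℕ, x = (r : ℕ∞) + 1 ∧
      stepsLinear (Ideal.span ((fun e => monomial e (1 : K)) '' W)) d r} = {1} := by
    ext x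
    constructor
    · rintro ⟨r, rfl, hr⟩
      rcases Nat.eq_zero_or_pos r with rfl | hpos
      · simp
      · have h := hr 1 hpos (L.degree - 1) (by omega)
        obtain ⟨R, hR⟩ := ENat.iInf_eq_zero.mp h
        obtain ⟨l, hl⟩ := exists_syzygy_degree_eq hu hv huL hvL
          (fun h => hne (eq_of_le u hu v hv h)) (fun w hw hwu h => hwu (eq_of_le w hw u hu h))
          hL rfl (by simp) R
        rw [Nat.cast_eq_zero, Finset.card_eq_zero, Finset.filter_eq_empty_iff] at hR
        exact absurd (hl.trans (by omega)) (hR (Finset.mem_univ l))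
    · rintro rfl
      exact ⟨0, by simp, stepsLinear_zero_of_monomial_span hfin hd⟩
  rw [idealIndex, hset, sSup_singleton]

end Syzygies

section Matchings

variable {n : ℕ} {G : SimpleGraph (Fin n)}

/-- The exponent vector of the product of all endpoints of the pairs in `M`. -/
def matchingExponent (M : Finset (Fin n × Fin n)) : Fin n →₀ ℕ :=
  ∑ q ∈ M, (Finsupp.single q.1 1 + Finsupp.single q.2 1)

lemma monomial_matchingExponent (K : Type) [Field K] (M : Finset (Fin n × Fin n)) :
    (monomial (matchingExponent M) 1 : SRing K n) = ∏ q ∈ M, (X q.1 * X q.2) := by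
  rw [matchingExponent, monomial_sum_one]
  refine Finset.prod_congr rfl fun q _ => ?_
  rw [X, X, monomial_mul, one_mul]

lemma degree_matchingExponent (M : Finset (Fin n × Fin n)) :
    (matchingExponent M).degree = 2 * M.card := by
  simp [matchingExponent, map_sum, mul_comm]

lemma matchingExponent_eq_zero_iff {M : Finset (Fin n × Fin n)} {i : Fin n} :
    matchingExponent M i = 0 ↔ ∀ q ∈ M, q.1 ≠ i ∧ q.2 ≠ i := by
  simp [matchingExponent, Finsupp.finsetSum_apply, Finset.sum_eq_zero_iff, Finsupp.single_apply]

lemma matchingExponent_mono {M N : Finset (Fin n × Fin n)} (h : M ⊆ N) :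
    matchingExponent M ≤ matchingExponent N :=
  Finset.sum_le_sum_of_subset h

lemma IsMatching.subset {M N : Finset (Fin n × Fin n)} (hN : IsMatching G N) (h : M ⊆ N) :
    IsMatching G M :=
  ⟨fun p hp => hN.1 p (h hp), fun p hp q hq => hN.2 p (h hp) q (h hq)⟩

/-- If `e` forms a gap with all the other edges of a matching, then a matching supported on the
vertices of the former covers both endpoints of `e` or none. -/
lemma matchingExponent_ne_zero_of_gap {M N : Finset (Fin n × Fin n)} {e : Fin n × Fin n}
    (hgap : ∀ e' ∈ M, FormsGap G e e') (hN : ∀ p ∈ N, G.Adj p.1 p.2)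
    (hle : matchingExponent N ≤ matchingExponent (insert e M))
    (h : matchingExponent N e.1 ≠ 0 ∨ matchingExponent N e.2 ≠ 0) :
    matchingExponent N e.1 ≠ 0 ∧ matchingExponent N e.2 ≠ 0 := by
  have endpoint : ∀ a b, G.Adj a b → (a = e.1 ∨ a = e.2) → matchingExponent N b ≠ 0 →
      b = e.1 ∨ b = e.2 := by
    intro a b hab ha hb
    have hb' : matchingExponent (insert e M) b ≠ 0 := fun h0 =>
      hb (Nat.le_zero.mp (h0 ▸ hle b))
    simp only [ne_eq, matchingExponent_eq_zero_iff, not_forall] at hb'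
    obtain ⟨q, hq, hqb⟩ := hb'
    rcases Finset.mem_insert.mp hq with rfl | hq
    · grind
    · refine absurd ⟨a, b, hab, ?_, ?_⟩ (hgap q hq)
      · simp only [meets]; grind
      · simp only [meets]; grind
  have hmem : ∀ p ∈ N, matchingExponent N p.1 ≠ 0 ∧ matchingExponent N p.2 ≠ 0 := by
    intro p hp
    simp only [ne_eq, matchingExponent_eq_zero_iff]
    exact ⟨fun h => (h p hp).1 rfl, fun h => (h p hp).2 rfl⟩
  obtain ⟨p, hp, hpe⟩ : ∃ p ∈ N, (p.1 = e.1 ∨ p.1 = e.2) ∨ (p.2 = e.1 ∨ p.2 = e.2) := by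
    simp only [ne_eq, matchingExponent_eq_zero_iff] at h
    grind
  have hadj := hN p hp
  have hpne := hadj.ne
  have h1 := endpoint p.1 p.2 hadj
  have h2 := endpoint p.2 p.1 hadj.symm
  have := hmem p hp
  grind

end Matchings

/-- **Lemma.** For a simple graph `G` with edge ideal `I` and `0 < k < ν₀(G)`,
the squarefree power `I^{[k]}` has index `1`, i.e. it is not linearly related. -/
theorem stmt15 (K : Type) [Field K] (n : ℕ) (G : SimpleGraph (Fin n)) :
    ∀ k : ℕ, 0 < k → k < resMatchNum G →
      idealIndex (sqfreePower K G k) (2*k) = 1 := by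
  classical
  intro k hk hlt
  obtain ⟨M, ⟨hM, e, heM, hgap⟩, hkM⟩ : ∃ M, IsRestrictedMatching G M ∧ k < M.card := by
    rcases lt_max_iff.mp hlt with h | h
    · have hne : {k | ∃ M, IsRestrictedMatching G M ∧ M.card = k}.Nonempty := by
        rw [Set.nonempty_iff_ne_empty]
        rintro h0
        simp [h0] at h
      obtain ⟨_, ⟨M, hM, rfl⟩, hkM⟩ := exists_lt_of_lt_csSup hne h
      exact ⟨M, hM, hkM⟩
    · omega
  obtain ⟨A, hAM, hAk⟩ := Finset.exists_subset_card_eq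
    (show k ≤ (M.erase e).card by rw [Finset.card_erase_of_mem heM]; omega)
  obtain ⟨e₁, he₁⟩ := Finset.card_pos.mp (hAk ▸ hk)
  have heA : e ∉ A := fun h => (Finset.mem_erase.mp (hAM h)).1 rfl
  have hinsM : insert e A ⊆ M :=
    Finset.insert_subset heM (hAM.trans (Finset.erase_subset _ _))
  have hgapA : ∀ e' ∈ A, FormsGap G e e' := fun e' h =>
    hgap e' (hinsM (Finset.mem_insert_of_mem h)) fun h' => heA (h' ▸ h)
  have hLapp : matchingExponent (insert e A) =
      (Finsupp.single e.1 1 + Finsupp.single e.2 1) + matchingExponent A :=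
    Finset.sum_insert heA
  have hAe : matchingExponent A e.1 = 0 ∧ matchingExponent A e.2 = 0 := by
    simp only [matchingExponent_eq_zero_iff]
    have hdisj := fun q (hq : q ∈ A) => hM.2 q (hinsM (Finset.mem_insert_of_mem hq)) e heM
      fun h => heA (h ▸ hq)
    exact ⟨fun q hq => ⟨(hdisj q hq).1, (hdisj q hq).2.2.1⟩,
      fun q hq => ⟨(hdisj q hq).2.1, (hdisj q hq).2.2.2⟩⟩
  have hene : e.1 ≠ e.2 := (hM.1 e heM).1.ne
  have hBsub : insert e (A.erase e₁) ⊆ insert e A :=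
    Finset.insert_subset_insert _ (Finset.erase_subset _ _)
  set W : Set (Fin n →₀ ℕ) := {w | ∃ N, IsMatching G N ∧ N.card = k ∧ w = matchingExponent N}
    with hWdef
  have hspan : sqfreePower K G k = Ideal.span ((fun e => monomial e (1 : K)) '' W) := by
    rw [sqfreePower]
    congr 1
    ext p
    simp only [Set.mem_ofPred_eq, Set.mem_image, hWdef, ← monomial_matchingExponent K]
    grind
  have hfin : W.Finite :=
    (Set.finite_range (matchingExponent (n := n))).subset fun w ⟨N, _, _, h⟩ => ⟨N, h.symm⟩
  have hdeg : ∀ w ∈ W, w.degree = 2 * k := by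
    rintro w ⟨N, _, hN, rfl⟩
    rw [degree_matchingExponent, hN]
  have hAW : matchingExponent A ∈ W :=
    ⟨A, hM.subset ((Finset.subset_insert _ _).trans hinsM), hAk, rfl⟩
  rw [hspan]
  refine idealIndex_eq_one_of_isolated (u := matchingExponent A)
    (v := matchingExponent (insert e (A.erase e₁))) (L := matchingExponent (insert e A))
    hfin hdeg hAW ⟨_, hM.subset (hBsub.trans hinsM), ?_, rfl⟩
    (matchingExponent_mono (Finset.subset_insert _ _)) (matchingExponent_mono hBsub) ?_ ?_ ?_
  · rw [Finset.card_insert_of_notMem fun h => heA (Finset.mem_of_mem_erase h),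
      Finset.card_erase_of_mem he₁, hAk]
    omega
  · intro h
    have h0 := hAe.1
    rw [h, matchingExponent_eq_zero_iff] at h0
    exact (h0 e (Finset.mem_insert_self _ _)).1 rfl
  · rw [degree_matchingExponent, Finset.card_insert_of_notMem heA, hAk]
    omega
  · rintro w ⟨N, hN, hNk, rfl⟩ hne hle
    by_cases hcov : matchingExponent N e.1 ≠ 0 ∨ matchingExponent N e.2 ≠ 0
    · obtain ⟨h1, h2⟩ :=
        matchingExponent_ne_zero_of_gap hgapA (fun p hp => (hN.1 p hp).1) hle hcov
      refine le_antisymm (sup_le hle (matchingExponent_mono (Finset.subset_insert _ _))) fun i => ?_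
      rw [hLapp]
      simp only [Finsupp.add_apply, Finsupp.sup_apply, Finsupp.single_apply]
      grind
    · have hNA : matchingExponent N ≤ matchingExponent A := by
        intro i
        have := hle i
        rw [hLapp] at this
        simp only [Finsupp.add_apply, Finsupp.single_apply] at this
        grind
      obtain ⟨c, hc⟩ := exists_add_of_le hNA
      have h := congrArg Finsupp.degree hc
      rw [map_add, degree_matchingExponent, degree_matchingExponent, hAk, hNk, left_eq_add,
        Finsupp.degree_eq_zero_iff] at h
      exact absurd (by rw [hc, h, add_zero]) hne

end
end
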